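/- arXiv:1006.3378 — 2 statements merged into one kernel-verified Lean document; each statement's English description precedes it below -/
import Mathlib

section
/- Let p be a constant with 1 − 1/√2 < p < 1 (independent of n). Then asymptotically almost surely the right-angled Artin group A_Γ associated to a random graph Γ ∈ G(n, p) has finite outer automorphism group Out(A_Γ). -/
open Finset Filter Topology

attribute [local instance] Classical.propDecidable

/-- The Erdős–Rényi weight of a graph `Γ` on `n` vertices with edge probability `p`:
`p^{E_Γ} (1-p)^{C(n,2) - E_Γ}`. -/
noncomputable def gnpWeight (n : ℕ) (p : ℝ) (Γ : SimpleGraph (Fin n)) : ℝ :=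
  p ^ Γ.edgeSet.ncard * (1 - p) ^ (n.choose 2 - Γ.edgeSet.ncard)

/-- The probability of the event `A` under the Erdős–Rényi model `G(n,p)`. -/
noncomputable def gnpProb (n : ℕ) (p : ℝ) (A : SimpleGraph (Fin n) → Prop) : ℝ :=
  ∑ Γ : SimpleGraph (Fin n), if A Γ then gnpWeight n p Γ else 0

/-- The expectation of a random variable `X` under the Erdős–Rényi model `G(n,p)`. -/
noncomputable def gnpExp (n : ℕ) (p : ℝ) (X : SimpleGraph (Fin n) → ℝ) : ℝ :=
  ∑ Γ : SimpleGraph (Fin n), gnpWeight n p Γ * X Γ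

/-- The commutator relators `[v,w]` over the edges of `Γ`. -/
def raagRels {n : ℕ} (Γ : SimpleGraph (Fin n)) : Set (FreeGroup (Fin n)) :=
  { r | ∃ v w : Fin n, Γ.Adj v w ∧
      r = FreeGroup.of v * FreeGroup.of w * (FreeGroup.of v)⁻¹ * (FreeGroup.of w)⁻¹ }

/-- The right-angled Artin group of the graph `Γ`. -/
abbrev RAAG {n : ℕ} (Γ : SimpleGraph (Fin n)) := PresentedGroup (raagRels Γ)

namespace RAAG

variable {n : ℕ} {Γ : SimpleGraph (Fin n)}

/-- The standard generator attached to a vertex. -/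
def gen (Γ : SimpleGraph (Fin n)) (v : Fin n) : RAAG Γ := PresentedGroup.of v

lemma gen_commute {v w : Fin n} (h : Γ.Adj v w) : Commute (gen Γ v) (gen Γ w) := by
  have h1 : (PresentedGroup.mk (raagRels Γ)) (FreeGroup.of v * FreeGroup.of w *
      (FreeGroup.of v)⁻¹ * (FreeGroup.of w)⁻¹) = 1 :=
    PresentedGroup.one_of_mem ⟨v, w, h, rfl⟩
  simp only [map_mul, map_inv] at h1
  exact mul_inv_eq_one.1 (by rw [← h1, mul_inv_rev, ← mul_assoc]; rfl)

/-- The universal property of a right-angled Artin group. -/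
def lift {H : Type*} [Group H] (f : Fin n → H) (hf : ∀ v w, Γ.Adj v w → Commute (f v) (f w)) :
    RAAG Γ →* H :=
  PresentedGroup.toGroup (f := f) (by
    rintro r ⟨v, w, h, rfl⟩
    have := (hf v w h).eq
    simp [this])

@[simp]
lemma lift_gen {H : Type*} [Group H] (f : Fin n → H)
    (hf : ∀ v w, Γ.Adj v w → Commute (f v) (f w)) (v : Fin n) :
    lift f hf (gen Γ v) = f v := by
  simp [lift, gen]

lemma closure_range_gen : Subgroup.closure (Set.range (gen Γ)) = ⊤ :=
  PresentedGroup.closure_range_of _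

lemma hom_ext {H : Type*} [Group H] {f g : RAAG Γ →* H} (h : ∀ v, f (gen Γ v) = g (gen Γ v)) :
    f = g :=
  PresentedGroup.ext h

/-- The exponent sum of the generator `w`. -/
noncomputable def expHom (Γ : SimpleGraph (Fin n)) (w : Fin n) : RAAG Γ →* Multiplicative ℤ :=
  lift (fun v => Multiplicative.ofAdd (if v = w then 1 else 0)) fun _ _ _ => Commute.all _ _

/-- The exponent sum of the generator `w`, as an integer. -/
noncomputable def expo (w : Fin n) (g : RAAG Γ) : ℤ := (expHom Γ w g).toAdd

@[simp] lemma expo_one (w : Fin n) : expo w (1 : RAAG Γ) = 0 := by simp [expo]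

@[simp] lemma expo_mul (w : Fin n) (g h : RAAG Γ) : expo w (g * h) = expo w g + expo w h := by
  simp [expo]

@[simp] lemma expo_inv (w : Fin n) (g : RAAG Γ) : expo w g⁻¹ = -expo w g := by simp [expo]

@[simp] lemma expo_pow (w : Fin n) (g : RAAG Γ) (m : ℕ) : expo w (g ^ m) = m * expo w g := by
  simp [expo]

@[simp] lemma expo_zpow (w : Fin n) (g : RAAG Γ) (m : ℤ) : expo w (g ^ m) = m * expo w g := by
  simp [expo]

lemma expo_gen (v w : Fin n) : expo w (gen Γ v) = if v = w then 1 else 0 := by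
  simp [expo, expHom]

/-- The special subgroup generated by the vertices in `S`. -/
def special (Γ : SimpleGraph (Fin n)) (S : Set (Fin n)) : Subgroup (RAAG Γ) :=
  Subgroup.closure (gen Γ '' S)

lemma gen_mem_special {S : Set (Fin n)} {v : Fin n} (h : v ∈ S) : gen Γ v ∈ special Γ S :=
  Subgroup.subset_closure ⟨v, h, rfl⟩

lemma special_mono {S T : Set (Fin n)} (h : S ⊆ T) : special Γ S ≤ special Γ T :=
  Subgroup.closure_mono (Set.image_mono h)

lemma special_univ : special Γ Set.univ = ⊤ := by
  rw [special, Set.image_univ, closure_range_gen]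

lemma expo_eq_zero_of_mem_special {S : Set (Fin n)} {w : Fin n} (hw : w ∉ S) {g : RAAG Γ}
    (hg : g ∈ special Γ S) : expo w g = 0 := by
  induction hg using Subgroup.closure_induction with
  | mem x hx =>
    obtain ⟨v, hv, rfl⟩ := hx
    rw [expo_gen, if_neg (by rintro rfl; exact hw hv)]
  | one => simp
  | mul x y _ _ hx hy => simp [hx, hy]
  | inv x _ hx => simp [hx]

/-- The retraction onto a special subgroup, killing the generators outside `S`. -/
noncomputable def retract (Γ : SimpleGraph (Fin n)) (S : Set (Fin n)) : RAAG Γ →* RAAG Γ :=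
  lift (fun v => if v ∈ S then gen Γ v else 1) fun v w h => by
    split_ifs
    · exact gen_commute h
    · exact Commute.one_right _
    · exact Commute.one_left _
    · exact Commute.one_left _

lemma retract_gen (S : Set (Fin n)) (v : Fin n) :
    retract Γ S (gen Γ v) = if v ∈ S then gen Γ v else 1 := lift_gen _ _ _

lemma retract_mem_inter (S : Set (Fin n)) {T : Set (Fin n)} {g : RAAG Γ} (hg : g ∈ special Γ T) :
    retract Γ S g ∈ special Γ (S ∩ T) := by
  induction hg using Subgroup.closure_induction with
  | mem x hx =>
    obtain ⟨v, hv, rfl⟩ := hx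
    rw [retract_gen]
    split_ifs with h
    · exact gen_mem_special ⟨h, hv⟩
    · exact one_mem _
  | one => simp
  | mul x y _ _ hx hy => rw [map_mul]; exact mul_mem hx hy
  | inv x _ hx => rw [map_inv]; exact inv_mem hx

lemma retract_eq_self {S : Set (Fin n)} {g : RAAG Γ} (hg : g ∈ special Γ S) :
    retract Γ S g = g := by
  induction hg using Subgroup.closure_induction with
  | mem x hx =>
    obtain ⟨v, hv, rfl⟩ := hx
    rw [retract_gen, if_pos hv]
  | one => simp
  | mul x y _ _ hx hy => rw [map_mul, hx, hy]
  | inv x _ hx => rw [map_inv, hx]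

lemma mem_special_inter {S T : Set (Fin n)} {g : RAAG Γ} (hS : g ∈ special Γ S)
    (hT : g ∈ special Γ T) : g ∈ special Γ (S ∩ T) := by
  rw [← retract_eq_self hS]
  exact retract_mem_inter S hT

lemma mem_special_compl_of_forall {g : RAAG Γ} (F : Finset (Fin n))
    (h : ∀ a ∈ F, g ∈ special Γ {a}ᶜ) : g ∈ special Γ ((F : Set (Fin n))ᶜ) := by
  induction F using Finset.induction_on with
  | empty => simp [special_univ]
  | insert a F _ ih =>
    refine special_mono ?_ (mem_special_inter (h a (Finset.mem_insert_self _ _))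
      (ih fun b hb => h b (Finset.mem_insert_of_mem hb)))
    intro x hx
    simpa using hx

lemma commute_gen_of_mem_special {x : Fin n} {g : RAAG Γ}
    (hg : g ∈ special Γ {v | v = x ∨ Γ.Adj v x}) : Commute g (gen Γ x) := by
  induction hg using Subgroup.closure_induction with
  | mem y hy =>
    obtain ⟨v, hv, rfl⟩ := hy
    rcases hv with rfl | hv
    · exact Commute.refl _
    · exact gen_commute hv
  | one => exact Commute.one_left _
  | mul y z _ _ hy hz => exact hy.mul_left hz
  | inv y _ hy => exact hy.inv_left

/-- Three pairwise intersecting cosets of special subgroups have a common point. -/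
lemma exists_mem_three_cosets {S T U : Set (Fin n)} {r s t x y z : RAAG Γ}
    (hxr : r⁻¹ * x ∈ special Γ S) (hxs : s⁻¹ * x ∈ special Γ T)
    (hyr : r⁻¹ * y ∈ special Γ S) (hyt : t⁻¹ * y ∈ special Γ U)
    (hzs : s⁻¹ * z ∈ special Γ T) (hzt : t⁻¹ * z ∈ special Γ U) :
    ∃ q, r⁻¹ * q ∈ special Γ S ∧ s⁻¹ * q ∈ special Γ T ∧ t⁻¹ * q ∈ special Γ U := by
  have h1 : x⁻¹ * z ∈ special Γ T := by
    simpa [mul_assoc] using mul_mem (inv_mem hxs) hzs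
  have h2 : z⁻¹ * y ∈ special Γ U := by
    simpa [mul_assoc] using mul_mem (inv_mem hzt) hyt
  have h3 : x⁻¹ * y ∈ special Γ S := by
    simpa [mul_assoc] using mul_mem (inv_mem hxr) hyr
  have e : x⁻¹ * y = retract Γ S (x⁻¹ * z) * retract Γ S (z⁻¹ * y) := by
    rw [← map_mul, ← retract_eq_self h3]
    congr 1
    group
  have m1 := retract_mem_inter S h1
  have m2 := retract_mem_inter S h2
  have e' : x * retract Γ S (x⁻¹ * z) = y * (retract Γ S (z⁻¹ * y))⁻¹ := by
    rw [eq_mul_inv_iff_mul_eq, mul_assoc, ← e]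
    group
  refine ⟨x * retract Γ S (x⁻¹ * z), ?_, ?_, ?_⟩
  · rw [← mul_assoc]
    exact mul_mem hxr (special_mono Set.inter_subset_left m1)
  · rw [← mul_assoc]
    exact mul_mem hxs (special_mono Set.inter_subset_right m1)
  · rw [e', ← mul_assoc]
    exact mul_mem hyt (inv_mem (special_mono Set.inter_subset_right m2))

/-- The Helly property for cosets of special subgroups. -/
lemma exists_mem_cosets {ι : Type*} (F : Finset ι) (S : ι → Set (Fin n)) (r : ι → RAAG Γ)
    (h : ∀ i ∈ F, ∀ j ∈ F, ∃ y, (r i)⁻¹ * y ∈ special Γ (S i) ∧ (r j)⁻¹ * y ∈ special Γ (S j)) :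
    ∃ y, ∀ i ∈ F, (r i)⁻¹ * y ∈ special Γ (S i) := by
  induction F using Finset.induction_on generalizing S r with
  | empty => exact ⟨1, by simp⟩
  | insert a F _ ih =>
    rcases F.eq_empty_or_nonempty with rfl | ⟨b, hb⟩
    · exact ⟨r a, by simp⟩
    have ha := Finset.mem_insert_self a F
    have hF : ∀ i ∈ F, i ∈ insert a F := fun i hi => Finset.mem_insert_of_mem hi
    choose! q hq1 hq2 using fun i (hi : i ∈ F) => h i (hF i hi) a ha
    obtain ⟨y, hy⟩ := ih (fun i => S i ∩ S a) q (by
      intro i hi j hj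
      obtain ⟨z, hz1, hz2⟩ := h i (hF i hi) j (hF j hj)
      obtain ⟨y, h1, h2, h3⟩ := exists_mem_three_cosets hz1 hz2 (hq1 i hi) (hq2 i hi)
        (hq1 j hj) (hq2 j hj)
      refine ⟨y, mem_special_inter ?_ ?_, mem_special_inter ?_ ?_⟩
      · simpa [mul_assoc] using mul_mem (inv_mem (hq1 i hi)) h1
      · simpa [mul_assoc] using mul_mem (inv_mem (hq2 i hi)) h3
      · simpa [mul_assoc] using mul_mem (inv_mem (hq1 j hj)) h2
      · simpa [mul_assoc] using mul_mem (inv_mem (hq2 j hj)) h3)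
    refine ⟨y, fun i hi => ?_⟩
    rcases Finset.mem_insert.1 hi with rfl | hi
    · simpa [mul_assoc] using
        mul_mem (hq2 b hb) (special_mono Set.inter_subset_right (hy b hb))
    · simpa [mul_assoc] using
        mul_mem (hq1 i hi) (special_mono Set.inter_subset_left (hy i hi))

/-- Translation of finitely supported functions on a `G`-set. -/
noncomputable def translate {G X : Type*} [Group G] [MulAction G X] (g : G) :
    (X →₀ ℤ) ≃+ (X →₀ ℤ) :=
  Finsupp.domCongr (MulAction.toPerm g)

section translate

variable {G X : Type*} [Group G] [MulAction G X]

@[simp]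
lemma translate_apply (g : G) (f : X →₀ ℤ) (x : X) : translate g f x = f (g⁻¹ • x) := rfl

lemma translate_mul (g h : G) (f : X →₀ ℤ) :
    translate (g * h) f = translate g (translate h f) := by
  ext x
  simp [mul_smul]

lemma translate_single (g : G) (x : X) : translate g (Finsupp.single x 1) =
    Finsupp.single (g • x) 1 := by
  simp [translate]

lemma exists_pow_smul_eq_of_mapsTo {g : G} {s : Set X} (hs : s.Finite)
    (h : ∀ x ∈ s, g • x ∈ s) {x : X} (hx : x ∈ s) : ∃ m : ℕ, 0 < m ∧ g ^ m • x = x := by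
  have key : ∀ i : ℕ, g ^ i • x ∈ s := by
    intro i
    induction i with
    | zero => simpa
    | succ i ih => rw [pow_succ', mul_smul]; exact h _ ih
  have := hs.to_subtype
  obtain ⟨i, j, hij, e⟩ := Finite.exists_ne_map_eq_of_infinite (fun i : ℕ => (⟨_, key i⟩ : s))
  simp only [Subtype.mk.injEq] at e
  wlog hlt : i < j generalizing i j
  · exact this j i hij.symm e.symm (by omega)
  refine ⟨j - i, by omega, ?_⟩
  have e2 : g ^ j • x = g ^ i • (g ^ (j - i) • x) := by
    rw [← mul_smul, ← pow_add]
    congr 2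
    omega
  rw [e2] at e
  exact ((MulAction.injective (g ^ i)) e).symm

lemma exists_pow_smul_eq_of_translate_eq {g : G} {f : X →₀ ℤ} (h : translate g f = f)
    (hf : f ≠ 0) : ∃ x : X, ∃ m : ℕ, 0 < m ∧ g ^ m • x = x := by
  obtain ⟨x, hx⟩ := Finsupp.support_nonempty_iff.2 hf
  refine ⟨x, exists_pow_smul_eq_of_mapsTo f.support.finite_toSet (fun y hy => ?_) hx⟩
  simp only [Finset.mem_coe, Finsupp.mem_support_iff] at hy ⊢
  rwa [← h, translate_apply, inv_smul_smul]

end translate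

/-! For each vertex `a` the group acts on the tree of its splitting as an HNN extension with stable
letter `a`. The vertices of this tree are the cosets of the special subgroup on the complement
of `a`, the edges are the cosets of the special subgroup on the link of `a`. -/

/-- Vertices of the tree of the splitting along `a`. -/
abbrev TreeVertex (Γ : SimpleGraph (Fin n)) (a : Fin n) := RAAG Γ ⧸ special Γ {a}ᶜ

/-- Edges of the tree of the splitting along `a`. -/
abbrev TreeEdge (Γ : SimpleGraph (Fin n)) (a : Fin n) := RAAG Γ ⧸ special Γ {v | Γ.Adj a v}

/-- The affine action on `0`-chains of edges: the generator `a` acts by translation followed by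
addition of the base edge, the other generators act by translation. -/
noncomputable def affine (Γ : SimpleGraph (Fin n)) (a : Fin n) :
    RAAG Γ →* Equiv.Perm (TreeEdge Γ a →₀ ℤ) :=
  lift (fun v => Equiv.addRight
      (if v = a then Finsupp.single ((1 : RAAG Γ) : TreeEdge Γ a) 1 else 0) *
      (translate (gen Γ v)).toEquiv) (by
    have key : ∀ v, Γ.Adj a v → translate (gen Γ v)
        (Finsupp.single ((1 : RAAG Γ) : TreeEdge Γ a) 1) =
          Finsupp.single ((1 : RAAG Γ) : TreeEdge Γ a) 1 := by
      intro v hv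
      rw [translate_single]
      congr 1
      rw [MulAction.Quotient.smul_coe, eq_comm, QuotientGroup.eq, smul_eq_mul, inv_one, one_mul,
        mul_one]
      exact gen_mem_special hv
    intro v w h
    ext1 f
    have hc : translate (gen Γ v) (translate (gen Γ w) f) =
        translate (gen Γ w) (translate (gen Γ v) f) := by
      rw [← translate_mul, ← translate_mul, (gen_commute h).eq]
    simp only [Equiv.Perm.mul_apply, Equiv.coe_addRight, AddEquiv.toEquiv_eq_coe,
      AddEquiv.coe_toEquiv, map_add, hc]
    by_cases hv : v = a
    · subst hv
      have hw : w ≠ v := h.ne'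
      simp [hw, key w h]
    · by_cases hw : w = a
      · subst hw
        simp [hv, key v h.symm]
      · simp [hv, hw])

lemma affine_gen (a v : Fin n) (f : TreeEdge Γ a →₀ ℤ) : affine Γ a (gen Γ v) f =
    translate (gen Γ v) f +
      if v = a then Finsupp.single ((1 : RAAG Γ) : TreeEdge Γ a) 1 else 0 := by
  simp [affine]

lemma affine_mul (a : Fin n) (g h : RAAG Γ) (f : TreeEdge Γ a →₀ ℤ) :
    affine Γ a (g * h) f = affine Γ a g (affine Γ a h f) := by
  simp

@[elab_as_elim]
lemma induction {p : RAAG Γ → Prop} (g : RAAG Γ) (gen : ∀ v, p (gen Γ v)) (one : p 1)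
    (mul : ∀ g h, p g → p h → p (g * h)) (inv : ∀ g, p g → p g⁻¹) : p g := by
  have hg : g ∈ Subgroup.closure (Set.range (RAAG.gen Γ)) := by
    rw [closure_range_gen]; trivial
  induction hg using Subgroup.closure_induction with
  | mem x hx => obtain ⟨v, rfl⟩ := hx; exact gen v
  | one => exact one
  | mul x y _ _ hx hy => exact mul x y hx hy
  | inv x _ hx => exact inv x hx

lemma affine_sub (a : Fin n) (g : RAAG Γ) (f f' : TreeEdge Γ a →₀ ℤ) :
    affine Γ a g f - affine Γ a g f' = translate g (f - f') := by
  induction g using induction generalizing f f' with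
  | gen v => simp [affine_gen]
  | one => ext; simp
  | mul g h hg hh => rw [affine_mul, affine_mul, hg, hh, translate_mul]
  | inv g hg =>
    have := hg (affine Γ a g⁻¹ f) (affine Γ a g⁻¹ f')
    rw [← affine_mul, ← affine_mul, mul_inv_cancel, map_one] at this
    rw [Equiv.Perm.one_apply, Equiv.Perm.one_apply] at this
    rw [this, ← translate_mul, inv_mul_cancel]
    ext
    simp

lemma affine_eq (a : Fin n) (g : RAAG Γ) (f : TreeEdge Γ a →₀ ℤ) :
    affine Γ a g f = translate g f + affine Γ a g 0 := by
  have := affine_sub a g f 0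
  rw [sub_zero] at this
  rw [← this, sub_add_cancel]

lemma affine_zero_of_mem {a : Fin n} {g : RAAG Γ} (hg : g ∈ special Γ {a}ᶜ) :
    affine Γ a g 0 = 0 := by
  induction hg using Subgroup.closure_induction with
  | mem x hx =>
    obtain ⟨v, hv, rfl⟩ := hx
    rw [affine_gen, if_neg (by simpa using hv)]
    simp
  | one => simp
  | mul x y _ _ hx hy => rw [affine_mul, hy, hx]
  | inv x _ hx =>
    rw [map_inv, Equiv.Perm.inv_eq_iff_eq, hx]

/-- The origin of an edge. -/
def origin (Γ : SimpleGraph (Fin n)) (a : Fin n) : TreeEdge Γ a → TreeVertex Γ a :=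
  Quotient.map' id fun x y h => by
    rw [QuotientGroup.leftRel_apply] at h ⊢
    exact special_mono (fun v (hv : Γ.Adj a v) => hv.ne') h

/-- The terminus of an edge. -/
def terminus (Γ : SimpleGraph (Fin n)) (a : Fin n) : TreeEdge Γ a → TreeVertex Γ a :=
  Quotient.map' (fun x => x * gen Γ a) fun x y h => by
    rw [QuotientGroup.leftRel_apply] at h ⊢
    have hc : Commute (x⁻¹ * y) (gen Γ a) :=
      commute_gen_of_mem_special (special_mono (fun v hv => Or.inr hv.symm) h)
    have e : (x * gen Γ a)⁻¹ * (y * gen Γ a) = x⁻¹ * y := by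
      rw [mul_inv_rev, mul_assoc, ← mul_assoc x⁻¹, hc.eq, inv_mul_cancel_left]
    rw [e]
    exact special_mono (fun v (hv : Γ.Adj a v) => hv.ne') h

/-- The base vertex plus the boundary of a chain of edges. -/
noncomputable def shiftedBoundary (Γ : SimpleGraph (Fin n)) (a : Fin n) (f : TreeEdge Γ a →₀ ℤ) :
    TreeVertex Γ a →₀ ℤ :=
  f.mapDomain (terminus Γ a) - f.mapDomain (origin Γ a) +
    Finsupp.single ((1 : RAAG Γ) : TreeVertex Γ a) 1

lemma mapDomain_translate {G X Y : Type*} [Group G] [MulAction G X] [MulAction G Y] (g : G)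
    (u : X → Y) (hu : ∀ x, u (g • x) = g • u x) (f : X →₀ ℤ) :
    (translate g f).mapDomain u = translate g (f.mapDomain u) := by
  induction f using Finsupp.induction_linear with
  | zero => simp
  | add f f' h h' => simp [Finsupp.mapDomain_add, h, h']
  | single x c => simp [translate, Finsupp.mapDomain_single, hu]

lemma shiftedBoundary_affine (a : Fin n) (g : RAAG Γ) (f : TreeEdge Γ a →₀ ℤ) :
    shiftedBoundary Γ a (affine Γ a g f) = translate g (shiftedBoundary Γ a f) := by
  have ho : ∀ (g : RAAG Γ) x, origin Γ a (g • x) = g • origin Γ a x := by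
    rintro g ⟨x⟩
    rfl
  have ht : ∀ (g : RAAG Γ) x, terminus Γ a (g • x) = g • terminus Γ a x := by
    rintro g ⟨x⟩
    exact congrArg (QuotientGroup.mk) (mul_assoc _ _ _)
  induction g using induction generalizing f with
  | gen v =>
    rw [affine_gen, shiftedBoundary, shiftedBoundary, Finsupp.mapDomain_add, Finsupp.mapDomain_add,
      mapDomain_translate _ _ (ht _), mapDomain_translate _ _ (ho _), map_add, map_sub,
      translate_single, MulAction.Quotient.smul_coe, smul_eq_mul, mul_one]
    split_ifs with h
    · subst h
      have h1 : terminus Γ v ((1 : RAAG Γ) : TreeEdge Γ v) = ((gen Γ v : RAAG Γ) : TreeVertex Γ v) :=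
        congrArg (QuotientGroup.mk) (one_mul _)
      have h2 : origin Γ v ((1 : RAAG Γ) : TreeEdge Γ v) = ((1 : RAAG Γ) : TreeVertex Γ v) := rfl
      rw [Finsupp.mapDomain_single, Finsupp.mapDomain_single, h1, h2]
      abel
    · have h1 : ((gen Γ v : RAAG Γ) : TreeVertex Γ a) = ((1 : RAAG Γ) : TreeVertex Γ a) := by
        rw [QuotientGroup.eq, mul_one]
        exact inv_mem (gen_mem_special h)
      rw [h1]
      simp
  | one => ext; simp
  | mul g h hg hh => rw [affine_mul, hg, hh, translate_mul]
  | inv g hg =>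
    have := hg (affine Γ a g⁻¹ f)
    rw [← affine_mul, mul_inv_cancel, map_one, Equiv.Perm.one_apply] at this
    rw [this, ← translate_mul, inv_mul_cancel]
    ext
    simp

lemma shiftedBoundary_affine_zero (a : Fin n) (g : RAAG Γ) :
    shiftedBoundary Γ a (affine Γ a g 0) = Finsupp.single (g : TreeVertex Γ a) 1 := by
  rw [shiftedBoundary_affine]
  simp [shiftedBoundary, translate_single]

lemma shiftedBoundary_ne_zero (a : Fin n) (f : TreeEdge Γ a →₀ ℤ) :
    shiftedBoundary Γ a f ≠ 0 := by
  intro h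
  have := congrArg (Finsupp.mapDomain (fun _ => ())) h
  rw [shiftedBoundary, Finsupp.mapDomain_add, ← Finsupp.mapDomain.addMonoidHom_apply,
    map_sub] at this
  simp only [Finsupp.mapDomain.addMonoidHom_apply, ← Finsupp.mapDomain_comp,
    Finsupp.mapDomain_single] at this
  have := DFunLike.congr_fun this ()
  simp [Function.comp_def] at this

lemma affine_fixes_of_smul_eq {a : Fin n} {g k : RAAG Γ}
    (h : g • (k : TreeVertex Γ a) = k) : affine Γ a g (affine Γ a k 0) = affine Γ a k 0 := by
  rw [MulAction.Quotient.smul_coe, eq_comm, QuotientGroup.eq, smul_eq_mul] at h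
  have e : g * k = k * (k⁻¹ * (g * k)) := by group
  rw [← affine_mul, e, affine_mul, affine_zero_of_mem h]

/-- An element fixing an edge has vanishing exponents outside the link. -/
lemma expo_eq_zero_of_smul_edge {a w : Fin n} (hw : ¬ Γ.Adj a w) {g : RAAG Γ} {e : TreeEdge Γ a}
    (h : g • e = e) : expo w g = 0 := by
  obtain ⟨k, rfl⟩ := QuotientGroup.mk_surjective e
  rw [MulAction.Quotient.smul_coe, eq_comm, QuotientGroup.eq, smul_eq_mul] at h
  have := expo_eq_zero_of_mem_special (w := w) (by simpa using hw) h
  simpa using this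

/-- An element with a nonzero exponent outside the link of `a` fixes at most one vertex. -/
lemma eq_of_smul_vertex_eq {a w : Fin n} (hw : ¬ Γ.Adj a w) {g : RAAG Γ} (hg : expo w g ≠ 0)
    {x y : TreeVertex Γ a} (hx : g • x = x) (hy : g • y = y) : x = y := by
  obtain ⟨k, rfl⟩ := QuotientGroup.mk_surjective x
  obtain ⟨l, rfl⟩ := QuotientGroup.mk_surjective y
  by_contra hne
  have h1 := affine_sub a g (affine Γ a k 0) (affine Γ a l 0)
  rw [affine_fixes_of_smul_eq hx, affine_fixes_of_smul_eq hy] at h1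
  obtain ⟨e, m, hm, he⟩ := exists_pow_smul_eq_of_translate_eq h1.symm (by
    intro h0
    have h2 := congrArg (shiftedBoundary Γ a) (sub_eq_zero.1 h0)
    rw [shiftedBoundary_affine_zero, shiftedBoundary_affine_zero] at h2
    exact hne (Finsupp.single_left_injective one_ne_zero h2))
  have := expo_eq_zero_of_smul_edge hw he
  simp only [expo_pow, mul_eq_zero, Nat.cast_eq_zero] at this
  omega

lemma smul_eq_of_commute {a w : Fin n} (hw : ¬ Γ.Adj a w) {g h : RAAG Γ} (hg : expo w g ≠ 0)
    (hgh : Commute g h) {x : TreeVertex Γ a} (hx : g • x = x) : h • x = x :=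
  eq_of_smul_vertex_eq hw hg (by rw [← mul_smul, hgh.eq, mul_smul, hx]) hx

/-- Two commuting elements with independent exponents outside the link of `a` are elliptic. -/
lemma exists_smul_vertex_eq {a u v : Fin n} (hu : ¬ Γ.Adj a u) (hv : ¬ Γ.Adj a v)
    {g h : RAAG Γ} (hgh : Commute g h) (hvg : expo v g = 1) (hug : expo u g = 0)
    (huh : expo u h = 1) : ∃ x : TreeVertex Γ a, g • x = x := by
  set f := affine Γ a g 0 with hf
  have free : ∀ (e : TreeEdge Γ a) (i j : ℤ), (g ^ i * h ^ j) • e = e → j = 0 := by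
    intro e i j he
    simpa [hug, huh] using expo_eq_zero_of_smul_edge hu he
  have hN : ∃ N : ℕ, ∀ e ∈ f.support, ∀ e' ∈ f.support, ∀ i : ℤ, g ^ i • h ^ N • e ≠ e' := by
    have : {N : ℕ | ∃ e ∈ f.support, ∃ e' ∈ f.support, ∃ i : ℤ, g ^ i • h ^ N • e = e'}.Finite := by
      have : {N : ℕ | ∃ e ∈ f.support, ∃ e' ∈ f.support, ∃ i : ℤ, g ^ i • h ^ N • e = e'} =
          ⋃ e ∈ f.support, ⋃ e' ∈ f.support, {N : ℕ | ∃ i : ℤ, g ^ i • h ^ N • e = e'} := by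
        ext N
        simp only [Set.mem_ofPred_eq, Set.mem_iUnion, exists_prop]
      rw [this]
      refine f.support.finite_toSet.biUnion fun e _ => f.support.finite_toSet.biUnion fun e' _ => ?_
      refine Set.Subsingleton.finite ?_
      rintro N ⟨i, hi⟩ M ⟨j, hj⟩
      have hc : Commute (h ^ (-(M : ℤ))) (g ^ (i - j)) := (hgh.symm.zpow_zpow _ _)
      have h3 : (g ^ (i - j) * h ^ ((N : ℤ) - M)) • e = e := by
        have h4 : g ^ (i - j) * h ^ ((N : ℤ) - M) = h ^ (-(M : ℤ)) * (g ^ (-j) * (g ^ i * h ^ N)) := by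
          rw [sub_eq_neg_add (N : ℤ), zpow_add, ← mul_assoc, ← hc.eq, zpow_natCast,
            sub_eq_neg_add i, zpow_add]
          simp only [mul_assoc]
        rw [h4, mul_smul, mul_smul, mul_smul, hi, ← hj]
        simp [← mul_smul, ← mul_assoc]
      have := free e _ _ h3
      omega
    obtain ⟨N, hN⟩ := this.exists_notMem
    refine ⟨N, ?_⟩
    simpa only [Set.mem_ofPred_eq, not_exists, not_and] using hN
  obtain ⟨N, hN⟩ := hN
  set P : TreeEdge Γ a → Prop := fun e => ∃ i : ℤ, g ^ i • e ∈ f.support with hP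
  have hPg : ∀ e, P (g⁻¹ • e) ↔ P e := by
    intro e
    constructor
    · rintro ⟨i, hi⟩
      exact ⟨i - 1, by rwa [zpow_sub_one, mul_smul]⟩
    · rintro ⟨i, hi⟩
      exact ⟨i + 1, by rwa [zpow_add_one, mul_smul, smul_inv_smul]⟩
  set ξ := (affine Γ a (h ^ N) 0).filter P with hξ
  have hfix : affine Γ a g ξ = ξ := by
    have hc : affine Γ a g (affine Γ a (h ^ N) 0) = affine Γ a (h ^ N) (affine Γ a g 0) := by
      rw [← affine_mul, ← affine_mul, (hgh.pow_right N).eq]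
    rw [affine_eq a g, affine_eq a (h ^ N) (affine Γ a g 0), ← hf] at hc
    rw [affine_eq, ← hf]
    ext e
    have hc := DFunLike.congr_fun hc e
    simp only [Finsupp.add_apply, translate_apply, hξ, Finsupp.filter_apply, hPg] at hc ⊢
    split_ifs with hPe
    · rw [hc]
      have : f ((h ^ N)⁻¹ • e) = 0 := by
        by_contra h0
        obtain ⟨i, hi⟩ := hPe
        exact hN _ (Finsupp.mem_support_iff.2 h0) _ hi i (by rw [smul_inv_smul])
      rw [this, zero_add]
    · have : f e = 0 := by
        by_contra h0
        exact hPe ⟨0, by simpa using h0⟩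
      rw [this, zero_add]
  have hinv := shiftedBoundary_affine a g ξ
  rw [hfix] at hinv
  obtain ⟨x, m, hm, hx⟩ :=
    exists_pow_smul_eq_of_translate_eq hinv.symm (shiftedBoundary_ne_zero a ξ)
  refine ⟨x, smul_eq_of_commute hv ?_ (Commute.pow_self g m) hx⟩
  simp [hvg]
  omega

/-- A graph in which all extension problems of small size have a solution. -/
structure IsExtendable (Γ : SimpleGraph (Fin n)) : Prop where
  exists_adj_adj : ∀ x y a, x ≠ a → y ≠ a → ∃ z, z ≠ a ∧ Γ.Adj x z ∧ Γ.Adj y z ∧ ¬ Γ.Adj a z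
  exists_not_adj : ∀ a b, ∃ x, x ≠ a ∧ x ≠ b ∧ ¬ Γ.Adj a x ∧ ¬ Γ.Adj b x

/-! ### Endomorphisms acting trivially on the abelianization -/

section trivialOnAbelianization

variable {φ : RAAG Γ →* RAAG Γ}

lemma exists_conj_mem_special (hΓ : IsExtendable Γ) (hφ : ∀ w g, expo w (φ g) = expo w g)
    {a v : Fin n} (hva : v ≠ a) : ∃ k, k⁻¹ * φ (gen Γ v) * k ∈ special Γ {a}ᶜ := by
  suffices h : ∃ x : TreeVertex Γ a, φ (gen Γ v) • x = x by
    obtain ⟨x, hx⟩ := h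
    obtain ⟨k, rfl⟩ := QuotientGroup.mk_surjective x
    rw [MulAction.Quotient.smul_coe, eq_comm, QuotientGroup.eq, smul_eq_mul, ← mul_assoc] at hx
    exact ⟨k, hx⟩
  have key : ∀ v, v ≠ a → ¬ Γ.Adj a v → ∃ x : TreeVertex Γ a, φ (gen Γ v) • x = x := by
    intro v hva hav
    obtain ⟨u, -, hvu, -, hau⟩ := hΓ.exists_adj_adj v v a hva hva
    exact exists_smul_vertex_eq hau hav ((gen_commute hvu).map φ) (by simp [hφ, expo_gen])
      (by simp [hφ, expo_gen, hvu.ne]) (by simp [hφ, expo_gen])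
  obtain ⟨u, hua, hvu, -, hau⟩ := hΓ.exists_adj_adj v v a hva hva
  obtain ⟨x, hx⟩ := key u hua hau
  exact ⟨x, smul_eq_of_commute hau (by simp [hφ, expo_gen]) ((gen_commute hvu.symm).map φ) hx⟩

lemma exists_conj_mem_special_compl (hΓ : IsExtendable Γ)
    (hφ : ∀ w g, expo w (φ g) = expo w g) (v : Fin n) (F : Finset (Fin n)) (hv : v ∉ F) :
    ∃ k, k⁻¹ * φ (gen Γ v) * k ∈ special Γ ((F : Set (Fin n))ᶜ) := by
  induction F using Finset.induction_on with
  | empty => exact ⟨1, by simp [special_univ]⟩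
  | insert a F _ ih =>
    obtain ⟨hva, hvF⟩ : v ≠ a ∧ v ∉ F := by simpa using hv
    obtain ⟨k, hk⟩ := ih hvF
    obtain ⟨l, hl⟩ := exists_conj_mem_special hΓ hφ hva
    set ρ := retract Γ ((F : Set (Fin n))ᶜ)
    have h1 := retract_mem_inter ((F : Set (Fin n))ᶜ) hl
    refine ⟨k * ρ (k⁻¹ * l), ?_⟩
    have e : (k * ρ (k⁻¹ * l))⁻¹ * φ (gen Γ v) * (k * ρ (k⁻¹ * l)) =
        ρ (l⁻¹ * φ (gen Γ v) * l) := by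
      have e1 : l⁻¹ * φ (gen Γ v) * l =
          (k⁻¹ * l)⁻¹ * (k⁻¹ * φ (gen Γ v) * k) * (k⁻¹ * l) := by group
      have hk' : ρ (k⁻¹ * φ (gen Γ v) * k) = k⁻¹ * φ (gen Γ v) * k := retract_eq_self hk
      have e2 : ρ (l⁻¹ * φ (gen Γ v) * l) =
          (ρ (k⁻¹ * l))⁻¹ * (k⁻¹ * φ (gen Γ v) * k) * ρ (k⁻¹ * l) := by
        rw [e1, map_mul ρ (_ * _) (k⁻¹ * l), map_mul ρ (_)⁻¹ _, map_inv ρ, hk']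
      rw [e2]
      group
    rw [e]
    refine special_mono (fun x hx => ?_) h1
    simp only [Set.mem_inter_iff, Set.mem_compl_iff, Finset.mem_coe, Set.mem_singleton_iff] at hx
    simp [hx]

lemma exists_conj_eq (hΓ : IsExtendable Γ) (hφ : ∀ w g, expo w (φ g) = expo w g) (v : Fin n) :
    ∃ k, φ (gen Γ v) = k * gen Γ v * k⁻¹ := by
  obtain ⟨k, hk⟩ := exists_conj_mem_special_compl hΓ hφ v (Finset.univ.erase v) (by simp)
  have hs : ((Finset.univ.erase v : Finset (Fin n)) : Set (Fin n))ᶜ = {v} := by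
    ext x
    simp
  rw [hs, special, Set.image_singleton, Subgroup.mem_closure_singleton] at hk
  obtain ⟨j, hj⟩ := hk
  have he := congrArg (expo v) hj
  simp only [expo_zpow, expo_mul, expo_inv, hφ, expo_gen, if_true] at he
  have : j = 1 := by linarith
  subst this
  rw [zpow_one] at hj
  refine ⟨k, ?_⟩
  calc φ (gen Γ v) = k * (k⁻¹ * φ (gen Γ v) * k) * k⁻¹ := by group
    _ = k * gen Γ v * k⁻¹ := by rw [← hj]

/-- An endomorphism acting trivially on the abelianization is inner. -/
theorem exists_eq_conj (hΓ : IsExtendable Γ) (hφ : ∀ w g, expo w (φ g) = expo w g) :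
    ∃ y, ∀ g, φ g = y * g * y⁻¹ := by
  choose k hk using exists_conj_eq hΓ hφ
  have hne : ∀ x, expo x (φ (gen Γ x)) ≠ 0 := fun x => by simp [hφ, expo_gen]
  have hfix : ∀ a x, x ≠ a → φ (gen Γ x) • (k x : TreeVertex Γ a) = k x := by
    intro a x hx
    rw [hk, MulAction.Quotient.smul_coe, eq_comm, QuotientGroup.eq, smul_eq_mul]
    have e : (k x)⁻¹ * (k x * gen Γ x * (k x)⁻¹ * k x) = gen Γ x := by group
    rw [e]
    exact gen_mem_special hx
  have hadj : ∀ a x z, x ≠ a → ¬ Γ.Adj a x → z ≠ a → ¬ Γ.Adj a z → Γ.Adj x z →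
      (k x : TreeVertex Γ a) = k z := by
    intro a x z hx hax hz haz hxz
    exact eq_of_smul_vertex_eq haz (hne z)
      (smul_eq_of_commute hax (hne x) ((gen_commute hxz).map φ) (hfix a x hx)) (hfix a z hz)
  have hconn : ∀ a x y, x ≠ a → ¬ Γ.Adj a x → y ≠ a → ¬ Γ.Adj a y →
      (k x : TreeVertex Γ a) = k y := by
    intro a x y hx hax hy hay
    obtain ⟨z, hza, hxz, hyz, haz⟩ := hΓ.exists_adj_adj x y a hx hy
    exact (hadj a x z hx hax hza haz hxz).trans (hadj a y z hy hay hza haz hyz).symm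
  choose b hb hb' using fun a => hΓ.exists_not_adj a a
  have hpair : ∀ a x, x ≠ a → ¬ Γ.Adj a x → (k (b a))⁻¹ * k x ∈ special Γ {a}ᶜ := fun a x hx hax =>
    QuotientGroup.eq.1 (hconn a (b a) x (hb a) (hb' a).2.1 hx hax)
  obtain ⟨y, hy⟩ := exists_mem_cosets Finset.univ (fun a => {a}ᶜ) (fun a => k (b a)) (by
    intro a _ c _
    obtain ⟨x, hxa, hxc, hax, hcx⟩ := hΓ.exists_not_adj a c
    exact ⟨k x, hpair a x hxa hax, hpair c x hxc hcx⟩)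
  refine ⟨y, fun g => ?_⟩
  suffices h : φ = (MulAut.conj y).toMonoidHom by rw [h]; simp
  refine hom_ext fun x => ?_
  have hmem : y⁻¹ * k x ∈ special Γ {v | v = x ∨ Γ.Adj v x} := by
    refine special_mono ?_ (mem_special_compl_of_forall
      (Finset.univ.filter fun a => x ≠ a ∧ ¬ Γ.Adj a x) fun a ha => ?_)
    · intro v hv
      simp only [Finset.coe_filter, Finset.mem_univ, true_and, Set.mem_compl_iff,
        Set.mem_ofPred_eq, not_and, not_not] at hv ⊢
      by_cases h : v = x
      · exact Or.inl h
      · exact Or.inr (hv (Ne.symm h))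
    · obtain ⟨-, hxa, hax⟩ := Finset.mem_filter.1 ha
      have := mul_mem (inv_mem (hy a (Finset.mem_univ a))) (hpair a x hxa hax)
      simpa [mul_assoc] using this
  have hc := (commute_gen_of_mem_special hmem).eq
  have e : k x = y * (y⁻¹ * k x) := by group
  rw [hk, e, mul_assoc y, hc]
  simp [mul_assoc]

end trivialOnAbelianization

/-! ### The action on the abelianization -/

/-- A representation of the integral Heisenberg group: `p` acts by a shear and `q` by a
translation of `ℤ × ℤ`. -/
def heisenberg {p q : Fin n} (hpq : p ≠ q) (h : ¬ Γ.Adj p q) : RAAG Γ →* Equiv.Perm (ℤ × ℤ) :=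
  lift (fun v => if v = p then ⟨fun z => (z.1, z.2 + z.1), fun z => (z.1, z.2 - z.1),
      fun z => by simp, fun z => by simp⟩
    else if v = q then ⟨fun z => (z.1 + 1, z.2), fun z => (z.1 - 1, z.2),
      fun z => by simp, fun z => by simp⟩ else 1) (by
    intro v w hvw
    have h1 := hvw.ne
    have h2 := hvw.symm
    split_ifs
    all_goals first | exact Commute.one_left _ | exact Commute.one_right _ | (subst_vars; tauto))

lemma heisenberg_apply {p q : Fin n} (hpq : p ≠ q) (h : ¬ Γ.Adj p q) (g : RAAG Γ) :
    ∃ c, ∀ z, heisenberg hpq h g z = (z.1 + expo q g, z.2 + expo p g * z.1 + c) := by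
  induction g using induction with
  | gen v =>
    refine ⟨0, fun z => ?_⟩
    simp only [heisenberg, lift_gen, expo_gen]
    split_ifs <;> simp_all
  | one => exact ⟨0, fun z => by simp⟩
  | mul g g' hg hg' =>
    obtain ⟨c, hc⟩ := hg
    obtain ⟨c', hc'⟩ := hg'
    refine ⟨c' + expo p g * expo q g' + c, fun z => ?_⟩
    rw [map_mul, Equiv.Perm.mul_apply, hc', hc, expo_mul, expo_mul]
    ext <;> simp <;> ring
  | inv g hg =>
    obtain ⟨c, hc⟩ := hg
    refine ⟨expo p g * expo q g - c, fun z => ?_⟩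
    rw [map_inv, Equiv.Perm.inv_eq_iff_eq, hc, expo_inv, expo_inv]
    ext
    · simp
    · simp
      ring

/-- The images of `g` and `h` in the class two nilpotent quotient commute. -/
def Orthogonal (g h : RAAG Γ) : Prop :=
  ∀ p q, p ≠ q → ¬ Γ.Adj p q → expo p g * expo q h = expo p h * expo q g

lemma Orthogonal.of_commute {g h : RAAG Γ} (hgh : Commute g h) : Orthogonal g h := by
  intro p q hpq hadj
  obtain ⟨c, hc⟩ := heisenberg_apply hpq hadj g
  obtain ⟨d, hd⟩ := heisenberg_apply hpq hadj h
  have e := congrArg (fun x => heisenberg hpq hadj x (0, 0)) hgh.eq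
  simp only [map_mul, Equiv.Perm.mul_apply, hc, hd, Prod.mk.injEq] at e
  linarith [e.2]

lemma expo_map (φ : RAAG Γ →* RAAG Γ) (w : Fin n) (g : RAAG Γ) :
    expo w (φ g) = ∑ u, expo u g * expo w (φ (gen Γ u)) := by
  induction g using induction with
  | gen v => simp [expo_gen]
  | one => simp
  | mul g h hg hh => simp [hg, hh, add_mul, Finset.sum_add_distrib]
  | inv g hg => simp [hg]

lemma Orthogonal.map {g h : RAAG Γ} (hgh : Orthogonal g h) (φ : RAAG Γ →* RAAG Γ) :
    Orthogonal (φ g) (φ h) := by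
  intro p q hpq hadj
  set D : Fin n → Fin n → ℤ := fun u u' =>
    expo p (φ (gen Γ u)) * expo q (φ (gen Γ u')) - expo p (φ (gen Γ u')) * expo q (φ (gen Γ u))
    with hD
  have key : expo p (φ g) * expo q (φ h) - expo p (φ h) * expo q (φ g) =
      ∑ u, ∑ u', expo u g * expo u' h * D u u' := by
    rw [expo_map φ p g, expo_map φ q h, expo_map φ p h, expo_map φ q g, Finset.sum_mul_sum,
      mul_comm (∑ u, expo u h * _), Finset.sum_mul_sum, ← Finset.sum_sub_distrib]
    refine Finset.sum_congr rfl fun u _ => ?_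
    rw [← Finset.sum_sub_distrib]
    refine Finset.sum_congr rfl fun u' _ => ?_
    simp only [hD]
    ring
  have key2 : ∑ u, ∑ u', expo u g * expo u' h * D u u' =
      -∑ u, ∑ u', expo u' g * expo u h * D u u' := by
    rw [Finset.sum_comm, ← Finset.sum_neg_distrib]
    refine Finset.sum_congr rfl fun u _ => ?_
    rw [← Finset.sum_neg_distrib]
    refine Finset.sum_congr rfl fun u' _ => ?_
    simp only [hD]
    ring
  have key3 : ∑ u, ∑ u', expo u g * expo u' h * D u u' =
      ∑ u, ∑ u', expo u' g * expo u h * D u u' := by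
    refine Finset.sum_congr rfl fun u _ => Finset.sum_congr rfl fun u' _ => ?_
    by_cases huu : u = u'
    · subst huu; rfl
    by_cases hadj' : Γ.Adj u u'
    · have : D u u' = 0 :=
        sub_eq_zero.2 (Orthogonal.of_commute ((gen_commute hadj').map φ) p q hpq hadj)
      rw [this, mul_zero, mul_zero]
    · rw [hgh u u' huu hadj', mul_comm (expo u h)]
  linarith

lemma Orthogonal.gen_right {g : RAAG Γ} {s : Fin n}
    (h : ∀ r, r ≠ s → ¬ Γ.Adj s r → expo r g = 0) : Orthogonal g (gen Γ s) := by
  intro p q hpq hadj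
  simp only [expo_gen]
  split_ifs with h1 h2 h2
  · exact absurd (h2.symm.trans h1) hpq
  · subst h1; simp [h p hpq fun h => hadj h.symm]
  · subst h2; simp [h q hpq.symm hadj]
  · simp

lemma Orthogonal.symm {g h : RAAG Γ} (hgh : Orthogonal g h) : Orthogonal h g :=
  fun p q hpq hadj => (hgh p q hpq hadj).symm

lemma IsExtendable.exists_two (hΓ : IsExtendable Γ) {v w : Fin n} (h : v ≠ w) :
    ∃ u₁ u₂, u₁ ≠ u₂ ∧ (u₁ ≠ w ∧ Γ.Adj v u₁ ∧ ¬ Γ.Adj w u₁) ∧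
      (u₂ ≠ w ∧ Γ.Adj v u₂ ∧ ¬ Γ.Adj w u₂) := by
  obtain ⟨u, huw, hvu, -, hwu⟩ := hΓ.exists_adj_adj v v w h h
  obtain ⟨y, hyw, -, -, hyu⟩ := hΓ.exists_not_adj w u
  obtain ⟨u', hu'w, hvu', hyu', hwu'⟩ := hΓ.exists_adj_adj v y w h hyw
  refine ⟨u, u', ?_, ⟨huw, hvu, hwu⟩, ⟨hu'w, hvu', hwu'⟩⟩
  rintro rfl
  exact hyu hyu'.symm

section automorphism

variable {φ ψ : RAAG Γ →* RAAG Γ}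

/-- The support of the image of a generator in the abelianization is a clique. -/
lemma adj_of_expo_ne_zero (hΓ : IsExtendable Γ) (hφψ : ∀ g, φ (ψ g) = g) (hψφ : ∀ g, ψ (φ g) = g)
    {v s t : Fin n} (hst : s ≠ t) (hs : expo s (φ (gen Γ v)) ≠ 0)
    (ht : expo t (φ (gen Γ v)) ≠ 0) : Γ.Adj s t := by
  by_contra hadj
  obtain ⟨w, hwv, hvw, hw⟩ : ∃ w, w ≠ v ∧ ¬ Γ.Adj v w ∧ expo w (ψ (gen Γ s)) ≠ 0 := by
    by_contra! hcon
    have := (Orthogonal.gen_right hcon).map φ s t hst hadj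
    simp [hφψ, expo_gen, hst, ht] at this
  obtain ⟨u₁, u₂, hne, ⟨h1w, hv1, hw1⟩, ⟨h2w, hv2, hw2⟩⟩ := hΓ.exists_two hwv.symm
  have key : ∀ c₁ c₂ : ℤ, expo s (φ (gen Γ u₁ ^ c₁ * gen Γ u₂ ^ c₂)) = 0 → c₁ = 0 ∧ c₂ = 0 := by
    intro c₁ c₂ h0
    set z := gen Γ u₁ ^ c₁ * gen Γ u₂ ^ c₂ with hz
    have hcomm : Commute z (gen Γ v) :=
      ((gen_commute hv1.symm).zpow_left c₁).mul_left ((gen_commute hv2.symm).zpow_left c₂)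
    have ho := Orthogonal.of_commute (hcomm.map φ)
    have ho' : Orthogonal (φ z) (gen Γ s) := by
      refine Orthogonal.gen_right fun r hr hsr => ?_
      have := ho s r hr.symm hsr
      rw [h0, zero_mul, eq_comm, mul_eq_zero] at this
      exact this.resolve_left hs
    have ho2 := ho'.map ψ
    rw [hψφ] at ho2
    have e1 := ho2 u₁ w h1w fun h => hw1 h.symm
    have e2 := ho2 u₂ w h2w fun h => hw2 h.symm
    simp [hz, expo_gen, h1w, h2w, hne, hne.symm, hw] at e1 e2
    exact ⟨e1, e2⟩
  obtain ⟨-, h2⟩ := key (expo s (φ (gen Γ u₂))) (-expo s (φ (gen Γ u₁))) (by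
    simp only [map_mul, map_zpow, expo_mul, expo_zpow]
    ring)
  have h1 := (key 1 0 (by simpa using h2)).1
  exact one_ne_zero h1

lemma expo_eq_zero_or_one_or_neg_one (hΓ : IsExtendable Γ) (hφψ : ∀ g, φ (ψ g) = g)
    (hψφ : ∀ g, ψ (φ g) = g) (v s : Fin n) : expo s (φ (gen Γ v)) = 0 ∨
      expo s (φ (gen Γ v)) = 1 ∨ expo s (φ (gen Γ v)) = -1 := by
  by_cases hs : expo s (φ (gen Γ v)) = 0
  · exact Or.inl hs
  refine Or.inr (Int.eq_one_or_neg_one_of_mul_eq_one (v := expo v (ψ (gen Γ s))) ?_)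
  have hz : ∀ w, w ≠ v → expo w (ψ (gen Γ s)) = 0 := by
    intro w hw
    obtain ⟨u, huw, hvu, -, hwu⟩ := hΓ.exists_adj_adj v v w hw.symm hw.symm
    have ho := Orthogonal.of_commute ((gen_commute hvu.symm).map φ)
    have ho' : Orthogonal (φ (gen Γ u)) (gen Γ s) := by
      refine Orthogonal.gen_right fun r hr hsr => ?_
      have hr0 : expo r (φ (gen Γ v)) = 0 := by
        by_contra h0
        exact hsr (adj_of_expo_ne_zero hΓ hφψ hψφ hr.symm hs h0)
      have := ho s r hr.symm hsr
      rw [hr0, mul_zero, eq_comm, mul_eq_zero] at this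
      exact this.resolve_left hs
    have ho2 := ho'.map ψ u w huw fun h => hwu h.symm
    simpa [hψφ, expo_gen, huw] using ho2
  have := expo_map φ s (ψ (gen Γ s))
  rw [hφψ, expo_gen, if_pos rfl, Finset.sum_eq_single v (fun w _ hw => by rw [hz w hw, zero_mul])
    (by simp)] at this
  rw [this, mul_comm]

end automorphism

theorem finite_out (hΓ : IsExtendable Γ) :
    Finite (MulAut (RAAG Γ) ⧸ (MulAut.conj : RAAG Γ →* MulAut (RAAG Γ)).range) := by
  have hM : ∀ (φ : MulAut (RAAG Γ)) v s, expo s (φ (gen Γ v)) ∈ Set.Icc (-1 : ℤ) 1 := by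
    intro φ v s
    have := expo_eq_zero_or_one_or_neg_one (φ := φ.toMonoidHom) (ψ := φ.symm.toMonoidHom) hΓ
      (by simp) (by simp) v s
    simp only [MulEquiv.toMonoidHom_eq_coe, MonoidHom.coe_coe] at this
    rw [Set.mem_Icc]
    omega
  refine Finite.of_injective (β := Fin n → Fin n → Set.Icc (-1 : ℤ) 1)
    (fun c v s => ⟨_, hM c.out v s⟩) fun c d hcd => ?_
  rw [← c.out_eq', ← d.out_eq']
  refine QuotientGroup.eq.2 ?_
  set φ := c.out
  set ψ := d.out
  have h1 : ∀ v s, expo s (φ (gen Γ v)) = expo s (ψ (gen Γ v)) := fun v s =>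
    congrArg Subtype.val (congrFun (congrFun hcd v) s)
  have h2 : ∀ g s, expo s (φ g) = expo s (ψ g) := by
    intro g s
    have e1 := expo_map φ.toMonoidHom s g
    have e2 := expo_map ψ.toMonoidHom s g
    simp only [MulEquiv.toMonoidHom_eq_coe, MonoidHom.coe_coe, h1] at e1 e2
    rw [e1, e2]
  obtain ⟨y, hy⟩ := exists_eq_conj (φ := (φ⁻¹ * ψ).toMonoidHom) hΓ (by
    intro w g
    have e1 := expo_map φ⁻¹.toMonoidHom w (ψ g)
    have e2 := expo_map φ⁻¹.toMonoidHom w (φ g)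
    simp only [h2] at e2
    have e3 := e1.trans e2.symm
    simpa using e3)
  exact ⟨y, MulEquiv.ext fun g => (hy g).symm⟩

end RAAG


namespace GnpModel

variable {n : ℕ} {p : ℝ}

lemma ncard_edgeSet_le (Γ : SimpleGraph (Fin n)) : Γ.edgeSet.ncard ≤ n.choose 2 := by
  have := Γ.card_edgeFinset_le_card_choose_two
  rwa [Fintype.card_fin, SimpleGraph.edgeFinset, ← Set.ncard_eq_toFinset_card'] at this

lemma weight_nonneg (hp : 0 ≤ p) (hp' : p ≤ 1) (Γ : SimpleGraph (Fin n)) :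
    0 ≤ gnpWeight n p Γ :=
  mul_nonneg (pow_nonneg hp _) (pow_nonneg (by linarith) _)

lemma sum_weight : ∑ Γ : SimpleGraph (Fin n), gnpWeight n p Γ = 1 := by
  have h := Finset.sum_pow_mul_eq_add_pow p (1 - p) (⊤ : SimpleGraph (Fin n)).edgeFinset
  rw [SimpleGraph.card_edgeFinset_top_eq_card_choose_two, Fintype.card_fin, add_sub_cancel,
    one_pow] at h
  rw [← h]
  refine Finset.sum_nbij' (fun Γ => Γ.edgeSet.toFinset)
    (fun s => SimpleGraph.fromEdgeSet (s : Set (Sym2 (Fin n)))) ?_ ?_ ?_ ?_ ?_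
  · intro Γ _
    rw [Finset.mem_powerset]
    intro e he
    simpa using Γ.not_isDiag_of_mem_edgeSet (by simpa using he)
  · simp
  · intro Γ _
    simp
  · intro s hs
    ext e
    have := Finset.subset_iff.1 (Finset.mem_powerset.1 hs) (x := e)
    simp at this ⊢
    exact this
  · intro Γ _
    rw [gnpWeight, Set.ncard_eq_toFinset_card']

lemma prob_eq_sum_filter (A : SimpleGraph (Fin n) → Prop) :
    gnpProb n p A = ∑ Γ with A Γ, gnpWeight n p Γ :=
  (Finset.sum_filter _ _).symm

lemma prob_mono (hp : 0 ≤ p) (hp' : p ≤ 1) {A B : SimpleGraph (Fin n) → Prop}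
    (h : ∀ Γ, A Γ → B Γ) : gnpProb n p A ≤ gnpProb n p B := by
  refine Finset.sum_le_sum fun Γ _ => ?_
  have := weight_nonneg hp hp' Γ
  by_cases hA : A Γ
  · simp [hA, h Γ hA]
  · rw [if_neg hA]
    split_ifs <;> linarith

lemma prob_true : gnpProb n p (fun _ => True) = 1 := by
  simpa [gnpProb] using sum_weight

lemma prob_and_add (A B : SimpleGraph (Fin n) → Prop) :
    gnpProb n p (fun Γ => A Γ ∧ B Γ) + gnpProb n p (fun Γ => A Γ ∧ ¬ B Γ) = gnpProb n p A := by
  rw [gnpProb, gnpProb, gnpProb, ← Finset.sum_add_distrib]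
  refine Finset.sum_congr rfl fun Γ _ => ?_
  by_cases hA : A Γ <;> by_cases hB : B Γ <;> simp [hA, hB]

lemma prob_not (A : SimpleGraph (Fin n) → Prop) :
    gnpProb n p (fun Γ => ¬ A Γ) = 1 - gnpProb n p A := by
  have := prob_and_add (p := p) (fun _ => True) A
  simp only [true_and, prob_true] at this
  linarith

lemma prob_exists_le (hp : 0 ≤ p) (hp' : p ≤ 1) {ι : Type*} [Fintype ι]
    (A : ι → SimpleGraph (Fin n) → Prop) :
    gnpProb n p (fun Γ => ∃ i, A i Γ) ≤ ∑ i, gnpProb n p (A i) := by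
  simp only [gnpProb]
  rw [Finset.sum_comm]
  refine Finset.sum_le_sum fun Γ _ => ?_
  have hw := weight_nonneg hp hp' Γ
  have hnn : ∀ i, 0 ≤ if A i Γ then gnpWeight n p Γ else 0 := fun i => by split_ifs <;> simp [hw]
  split_ifs with h
  · obtain ⟨i, hi⟩ := h
    refine le_trans ?_ (Finset.single_le_sum (fun j _ => hnn j) (Finset.mem_univ i))
    rw [if_pos hi]
  · exact Finset.sum_nonneg fun i _ => hnn i

/-- The event `A` does not depend on the presence of the edge `s(a, b)`. -/
def Ignores (A : SimpleGraph (Fin n) → Prop) (a b : Fin n) : Prop :=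
  ∀ Γ Γ' : SimpleGraph (Fin n),
    (∀ x y, s(x, y) ≠ s(a, b) → (Γ.Adj x y ↔ Γ'.Adj x y)) → (A Γ ↔ A Γ')

lemma weight_sup_edge {a b : Fin n} (hab : a ≠ b) {Γ : SimpleGraph (Fin n)} (h : ¬ Γ.Adj a b) :
    gnpWeight n p (Γ ⊔ SimpleGraph.edge a b) * (1 - p) = gnpWeight n p Γ * p := by
  have hc : (Γ ⊔ SimpleGraph.edge a b).edgeSet.ncard = Γ.edgeSet.ncard + 1 := by
    rw [SimpleGraph.edgeSet_sup, SimpleGraph.edgeSet_edge_of_ne hab, Set.union_singleton,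
      Set.ncard_insert_of_notMem (by simpa using h)]
  have hle := ncard_edgeSet_le (Γ ⊔ SimpleGraph.edge a b)
  rw [gnpWeight, gnpWeight, hc]
  have : n.choose 2 - Γ.edgeSet.ncard = n.choose 2 - (Γ.edgeSet.ncard + 1) + 1 := by omega
  rw [this]
  ring

lemma Ignores.prob_adj {A : SimpleGraph (Fin n) → Prop} {a b : Fin n} (hA : Ignores A a b)
    (hab : a ≠ b) : gnpProb n p (fun Γ => A Γ ∧ Γ.Adj a b) = p * gnpProb n p A := by
  have key : gnpProb n p (fun Γ => A Γ ∧ Γ.Adj a b) * (1 - p) =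
      gnpProb n p (fun Γ => A Γ ∧ ¬ Γ.Adj a b) * p := by
    rw [prob_eq_sum_filter, prob_eq_sum_filter, Finset.sum_mul, Finset.sum_mul]
    refine Finset.sum_nbij' (fun Γ => Γ \ SimpleGraph.edge a b)
      (fun Γ => Γ ⊔ SimpleGraph.edge a b) ?_ ?_ ?_ ?_ ?_
    · intro Γ hΓ
      simp only [Finset.mem_filter, Finset.mem_univ, true_and] at hΓ ⊢
      refine ⟨(hA _ _ fun x y hxy => ?_).1 hΓ.1, ?_⟩
      · simp [SimpleGraph.edge_adj] at hxy ⊢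
        tauto
      · simp [SimpleGraph.edge_adj, hab]
    · intro Γ hΓ
      simp only [Finset.mem_filter, Finset.mem_univ, true_and] at hΓ ⊢
      refine ⟨(hA _ _ fun x y hxy => ?_).1 hΓ.1, ?_⟩
      · simp [SimpleGraph.edge_adj] at hxy ⊢
        tauto
      · simp [SimpleGraph.edge_adj, hab]
    · intro Γ hΓ
      simp only [Finset.mem_filter, Finset.mem_univ, true_and] at hΓ
      exact sdiff_sup_cancel ((SimpleGraph.edge_le_iff Γ).2 (Or.inr hΓ.2))
    · intro Γ hΓ
      simp only [Finset.mem_filter, Finset.mem_univ, true_and] at hΓ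
      refine Disjoint.sup_sdiff_cancel_right ?_
      rw [SimpleGraph.disjoint_edge]
      exact hΓ.2
    · intro Γ hΓ
      simp only [Finset.mem_filter, Finset.mem_univ, true_and] at hΓ
      rw [← weight_sup_edge hab (Γ := Γ \ SimpleGraph.edge a b)
        (by simp [SimpleGraph.edge_adj, hab]),
        sdiff_sup_cancel ((SimpleGraph.edge_le_iff Γ).2 (Or.inr hΓ.2))]
  have := prob_and_add (p := p) A (fun Γ => Γ.Adj a b)
  linear_combination key + p * this

lemma Ignores.prob_not_adj {A : SimpleGraph (Fin n) → Prop} {a b : Fin n} (hA : Ignores A a b)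
    (hab : a ≠ b) : gnpProb n p (fun Γ => A Γ ∧ ¬ Γ.Adj a b) = (1 - p) * gnpProb n p A := by
  have := prob_and_add (p := p) A (fun Γ => Γ.Adj a b)
  rw [hA.prob_adj hab] at this
  linear_combination this

lemma Ignores.and {A B : SimpleGraph (Fin n) → Prop} {a b : Fin n} (hA : Ignores A a b)
    (hB : Ignores B a b) : Ignores (fun Γ => A Γ ∧ B Γ) a b :=
  fun Γ Γ' h => and_congr (hA Γ Γ' h) (hB Γ Γ' h)

lemma Ignores.not {A : SimpleGraph (Fin n) → Prop} {a b : Fin n} (hA : Ignores A a b) :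
    Ignores (fun Γ => ¬ A Γ) a b :=
  fun Γ Γ' h => not_congr (hA Γ Γ' h)

lemma ignores_adj {a b x y : Fin n} (h : s(x, y) ≠ s(a, b)) : Ignores (fun Γ => Γ.Adj x y) a b :=
  fun _ _ h' => h' x y h

/-- The vertex `z` is adjacent to `x` and `y` but not to `a` and `b`. -/
def Extends (Γ : SimpleGraph (Fin n)) (x y a b z : Fin n) : Prop :=
  (((Γ.Adj x z) ∧ Γ.Adj y z) ∧ ¬ Γ.Adj a z) ∧ ¬ Γ.Adj b z

lemma prob_forall_not_extends {x y a b : Fin n} (hxy : x ≠ y) (hxa : x ≠ a) (hxb : x ≠ b)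
    (hya : y ≠ a) (hyb : y ≠ b) (hab : a ≠ b) (Z : Finset (Fin n))
    (hx : x ∉ Z) (hy : y ∉ Z) (ha : a ∉ Z) (hb : b ∉ Z) :
    gnpProb n p (fun Γ => ∀ z ∈ Z, ¬ Extends Γ x y a b z) =
      (1 - p ^ 2 * (1 - p) ^ 2) ^ #Z := by
  induction Z using Finset.induction_on with
  | empty => simpa using prob_true
  | insert z Z hz ih =>
    simp only [Finset.mem_insert, not_or] at hx hy ha hb
    obtain ⟨hxz, hxZ⟩ := hx
    obtain ⟨hyz, hyZ⟩ := hy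
    obtain ⟨haz, haZ⟩ := ha
    obtain ⟨hbz, hbZ⟩ := hb
    set A : SimpleGraph (Fin n) → Prop := fun Γ => ∀ z ∈ Z, ¬ Extends Γ x y a b z with hA
    have hne : ∀ {c d : Fin n}, c ≠ d → s(c, z) ≠ s(d, z) := fun h h' => h (Sym2.congr_left.1 h')
    have ign : ∀ c, c ≠ z → Ignores A c z := by
      intro c hc Γ Γ' h
      refine forall₂_congr fun u hu => ?_
      have huz : u ≠ z := fun h => hz (h ▸ hu)
      have key : ∀ d, d ≠ z → (Γ.Adj d u ↔ Γ'.Adj d u) := fun d hd => h d u (by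
        simp [hd, huz])
      rw [Extends, Extends, key x hxz, key y hyz, key a haz, key b hbz]
    have i1 := (ign x hxz).prob_adj (p := p) hxz
    have i2 := ((ign y hyz).and (ignores_adj (hne hxy))).prob_adj (p := p) hyz
    have i3 := (((ign a haz).and (ignores_adj (hne hxa))).and
      (ignores_adj (hne hya))).prob_not_adj (p := p) haz
    have i4 := ((((ign b hbz).and (ignores_adj (hne hxb))).and
      (ignores_adj (hne hyb))).and (ignores_adj (hne hab)).not).prob_not_adj (p := p) hbz
    rw [i3, i2, i1, ih hxZ hyZ haZ hbZ] at i4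
    have hs := prob_and_add (p := p) A (fun Γ => Extends Γ x y a b z)
    have e1 : (fun Γ => A Γ ∧ Extends Γ x y a b z) = fun Γ =>
        (((A Γ ∧ Γ.Adj x z) ∧ Γ.Adj y z) ∧ ¬ Γ.Adj a z) ∧ ¬ Γ.Adj b z := by
      funext Γ
      simp only [Extends, and_assoc]
    have e2 : (fun Γ => ∀ u ∈ insert z Z, ¬ Extends Γ x y a b u) = fun Γ =>
        A Γ ∧ ¬ Extends Γ x y a b z := by
      funext Γ
      simp only [Finset.forall_mem_insert, hA, and_comm]
    rw [e1, i4, ih hxZ hyZ haZ hbZ] at hs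
    rw [e2, Finset.card_insert_of_notMem hz, pow_succ]
    linear_combination hs

/-- Any four distinct vertices `x`, `y`, `a`, `b` admit a vertex adjacent to `x` and `y` but not to
`a` and `b`. -/
def FourExtendable (Γ : SimpleGraph (Fin n)) : Prop :=
  ∀ x y a b, x ≠ y → x ≠ a → x ≠ b → y ≠ a → y ≠ b → a ≠ b →
    ∃ z ∉ ({x, y, a, b} : Finset (Fin n)), Extends Γ x y a b z

lemma prob_not_fourExtendable_le (hp : 0 ≤ p) (hp' : p ≤ 1) :
    gnpProb n p (fun Γ => ¬ FourExtendable Γ) ≤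
      n ^ 4 * (1 - p ^ 2 * (1 - p) ^ 2) ^ (n - 4) := by
  let B : Fin n × Fin n × Fin n × Fin n → SimpleGraph (Fin n) → Prop := fun t Γ =>
    (t.1 ≠ t.2.1 ∧ t.1 ≠ t.2.2.1 ∧ t.1 ≠ t.2.2.2 ∧ t.2.1 ≠ t.2.2.1 ∧ t.2.1 ≠ t.2.2.2 ∧
      t.2.2.1 ≠ t.2.2.2) ∧ ∀ z ∈ ({t.1, t.2.1, t.2.2.1, t.2.2.2} : Finset (Fin n))ᶜ,
        ¬ Extends Γ t.1 t.2.1 t.2.2.1 t.2.2.2 z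
  have hq : 0 ≤ 1 - p ^ 2 * (1 - p) ^ 2 := by
    have h1 : p ^ 2 ≤ 1 := pow_le_one₀ hp hp'
    have h2 : (1 - p) ^ 2 ≤ 1 := pow_le_one₀ (by linarith) (by linarith)
    have := mul_le_one₀ h1 (sq_nonneg (1 - p)) h2
    linarith
  calc gnpProb n p (fun Γ => ¬ FourExtendable Γ)
      ≤ gnpProb n p (fun Γ => ∃ t, B t Γ) := by
        refine prob_mono hp hp' fun Γ h => ?_
        simp only [FourExtendable] at h
        push Not at h
        obtain ⟨x, y, a, b, h1, h2, h3, h4, h5, h6, h⟩ := h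
        exact ⟨(x, y, a, b), ⟨h1, h2, h3, h4, h5, h6⟩, fun z hz => h z (Finset.mem_compl.1 hz)⟩
    _ ≤ ∑ t, gnpProb n p (B t) := prob_exists_le hp hp' B
    _ ≤ ∑ _t : Fin n × Fin n × Fin n × Fin n, (1 - p ^ 2 * (1 - p) ^ 2) ^ (n - 4) := by
        refine Finset.sum_le_sum fun t _ => ?_
        obtain ⟨x, y, a, b⟩ := t
        by_cases h : x ≠ y ∧ x ≠ a ∧ x ≠ b ∧ y ≠ a ∧ y ≠ b ∧ a ≠ b
        · obtain ⟨h1, h2, h3, h4, h5, h6⟩ := h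
          refine (prob_mono hp hp' fun Γ hΓ => hΓ.2).trans (le_of_eq ?_)
          have hc : #({x, y, a, b} : Finset (Fin n))ᶜ = n - 4 := by
            rw [Finset.card_compl, Fintype.card_fin]
            congr 1
            simp [*]
          rw [prob_forall_not_extends h1 h2 h3 h4 h5 h6 _ (by simp) (by simp) (by simp)
            (by simp), hc]
        · refine le_trans (le_of_eq ?_) (pow_nonneg hq _)
          simp [gnpProb, B, h]
    _ = n ^ 4 * (1 - p ^ 2 * (1 - p) ^ 2) ^ (n - 4) := by
        simp only [Finset.sum_const, Finset.card_univ, Fintype.card_prod, Fintype.card_fin,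
          nsmul_eq_mul]
        push_cast
        ring

lemma FourExtendable.isExtendable {Γ : SimpleGraph (Fin n)} (hn : 5 ≤ n) (h : FourExtendable Γ) :
    RAAG.IsExtendable Γ := by
  have fresh : ∀ s : Finset (Fin n), #s ≤ 4 → ∃ z, z ∉ s := by
    intro s hs
    by_contra! hz
    have := Finset.card_le_card (fun z _ => hz z : Finset.univ ⊆ s)
    rw [Finset.card_univ, Fintype.card_fin] at this
    omega
  have fresh3 : ∀ u v w : Fin n, ∃ z, z ≠ u ∧ z ≠ v ∧ z ≠ w := by
    intro u v w
    obtain ⟨z, hz⟩ := fresh {u, v, w} (Finset.card_le_three.trans (by norm_num))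
    exact ⟨z, by simpa using hz⟩
  constructor
  · intro x y a hx hy
    obtain ⟨y', hy', hya, hyy⟩ : ∃ y', x ≠ y' ∧ y' ≠ a ∧ (y = x ∨ y = y') := by
      by_cases hxy : x = y
      · obtain ⟨z, h1, h2, -⟩ := fresh3 x a a
        exact ⟨z, h1.symm, h2, Or.inl hxy.symm⟩
      · exact ⟨y, hxy, hy, Or.inr rfl⟩
    obtain ⟨b, hbx, hby, hba⟩ := fresh3 x y' a
    obtain ⟨z, hz, ⟨⟨hxz, hyz⟩, haz⟩, -⟩ :=
      h x y' a b hy' hx hbx.symm hya hby.symm hba.symm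
    refine ⟨z, fun e => hz (by simp [e]), hxz, ?_, haz⟩
    rcases hyy with rfl | rfl
    · exact hxz
    · exact hyz
  · intro a b
    obtain ⟨b', hb', hbb⟩ : ∃ b', a ≠ b' ∧ (b = a ∨ b = b') := by
      by_cases hab : a = b
      · obtain ⟨z, h1, -⟩ := fresh3 a a a
        exact ⟨z, h1.symm, Or.inl hab.symm⟩
      · exact ⟨b, hab, Or.inr rfl⟩
    obtain ⟨x, hxa, hxb, -⟩ := fresh3 a b' a
    obtain ⟨y, hyx, hya, hyb⟩ := fresh3 x a b'
    obtain ⟨z, hz, ⟨-, haz⟩, hbz⟩ := h x y a b' hyx.symm hxa hxb hya hyb hb'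
    simp only [Finset.mem_insert, Finset.mem_singleton, not_or] at hz
    refine ⟨z, hz.2.2.1, ?_, haz, ?_⟩
    · rcases hbb with rfl | rfl
      · exact hz.2.2.1
      · exact hz.2.2.2
    · rcases hbb with rfl | rfl
      · exact haz
      · exact hbz

lemma tendsto_prob_isExtendable (hp : 0 < p) (hp' : p < 1) :
    Tendsto (fun n => gnpProb n p RAAG.IsExtendable) atTop (nhds 1) := by
  set r := 1 - p ^ 2 * (1 - p) ^ 2 with hr
  have hpos : 0 < p ^ 2 * (1 - p) ^ 2 := mul_pos (pow_pos hp 2) (pow_pos (by linarith) 2)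
  have hr0 : 0 < r := by
    have h1 : p ^ 2 < 1 := pow_lt_one₀ hp.le hp' (by norm_num)
    have h2 : (1 - p) ^ 2 ≤ 1 := pow_le_one₀ (by linarith) (by linarith)
    have := mul_lt_one_of_nonneg_of_lt_one_left (sq_nonneg p) h1 h2
    linarith
  have hlim : Tendsto (fun n : ℕ => 1 - (n : ℝ) ^ 4 * r ^ n / r ^ 4) atTop (nhds 1) := by
    have := (tendsto_pow_const_mul_const_pow_of_abs_lt_one 4
      (abs_lt.2 ⟨by linarith, by linarith⟩ : |r| < 1)).div_const (r ^ 4) |>.const_sub 1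
    simpa using this
  refine tendsto_of_tendsto_of_tendsto_of_le_of_le' hlim tendsto_const_nhds ?_ ?_
  · filter_upwards [eventually_ge_atTop 5] with n hn
    have h1 := prob_not_fourExtendable_le (n := n) hp.le hp'.le
    rw [prob_not, ← hr] at h1
    have h2 := prob_mono (n := n) hp.le hp'.le
      (fun Γ (h : FourExtendable Γ) => h.isExtendable hn)
    have h3 : r ^ n / r ^ 4 = r ^ (n - 4) := by
      rw [pow_sub₀ _ hr0.ne' (by omega), div_eq_mul_inv]
    rw [mul_div_assoc, h3]
    linarith
  · filter_upwards with n
    exact (prob_mono hp.le hp'.le fun _ _ => trivial).trans_eq prob_true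

end GnpModel

/-- For constant `p` with `1 - 1/√2 < p < 1`, a.a.s. the right-angled Artin group `A_Γ` of
`Γ ∈ G(n,p)` has finite outer automorphism group. -/
theorem gnp_aas_raag_finite_out (p : ℝ) (h1 : 1 - 1 / Real.sqrt 2 < p) (h2 : p < 1) :
    Tendsto (fun n : ℕ =>
      gnpProb n p (fun Γ =>
        Finite (MulAut (RAAG Γ) ⧸ (MulAut.conj : RAAG Γ →* MulAut (RAAG Γ)).range)))
      atTop (nhds 1) := by
  have hp : 0 < p := by
    have : 1 / Real.sqrt 2 ≤ 1 := (div_le_one₀ (by positivity)).2 (Real.one_le_sqrt.2 one_le_two)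
    linarith
  refine tendsto_of_tendsto_of_tendsto_of_le_of_le
    (GnpModel.tendsto_prob_isExtendable hp h2) tendsto_const_nhds (fun n => ?_) (fun n => ?_)
  · exact GnpModel.prob_mono hp.le h2.le fun _ h => RAAG.finite_out h
  · exact (GnpModel.prob_mono hp.le h2.le fun _ _ => trivial).trans_eq GnpModel.prob_true
end

section
/- Fix a function m : ℕ → ℕ with m(i) ≠ 1 for all i, prescribing cyclic vertex groups (ℤ/m(i)ℤ, with m(i) = 0 meaning the infinite cyclic group ℤ). Let p be a constant with 1 − 1/√2 < p < 1 (independent of n). For a random graph Γ ∈ G(n, p), let Γ_G be the graph product of these cyclic groups along Γ. Then asymptotically almost surely Γ_G has finite outer automorphism group Out(Γ_G). -/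
open Finset Filter Topology

attribute [local instance] Classical.propDecidable

/-- The relators for the graph product of the cyclic groups `ℤ/m(i)ℤ` along `Γ`:
`gᵢ^{m i}` for each vertex `i` (with `m i = 0` giving the infinite cyclic group `ℤ`),
and the commutators `[gᵢ, gⱼ]` over the edges of `Γ`. -/
def graphProdRels {n : ℕ} (m : ℕ → ℕ) (Γ : SimpleGraph (Fin n)) : Set (FreeGroup (Fin n)) :=
  { r | ∃ i : Fin n, r = (FreeGroup.of i) ^ (m i.val) } ∪
    { r | ∃ i j : Fin n, Γ.Adj i j ∧
        r = FreeGroup.of i * FreeGroup.of j * (FreeGroup.of i)⁻¹ * (FreeGroup.of j)⁻¹ }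

/-- The graph product of the cyclic groups `ℤ/m(i)ℤ` along the graph `Γ`. -/
abbrev GraphProd {n : ℕ} (m : ℕ → ℕ) (Γ : SimpleGraph (Fin n)) :=
  PresentedGroup (graphProdRels m Γ)

section

open scoped Pointwise

/-- A `G`-invariant system of halfspaces of a tree with vertex set `Y`. -/
structure IsHalfspaceSystem (G : Type*) {Y : Type*} [Group G] [MulAction G Y]
    (𝓗 : Set (Set Y)) : Prop where
  smul_mem : ∀ (g : G) (A : Set Y), A ∈ 𝓗 → g • A ∈ 𝓗
  compl_mem : ∀ A ∈ 𝓗, Aᶜ ∈ 𝓗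
  nested : ∀ A ∈ 𝓗, ∀ B ∈ 𝓗, A ⊆ B ∨ B ⊆ A ∨ A ⊆ Bᶜ ∨ Aᶜ ⊆ B
  finite_sep : ∀ y y' : Y, {A | A ∈ 𝓗 ∧ y ∈ A ∧ y' ∉ A}.Finite
  sep : ∀ y y' : Y, y ≠ y' → ∃ A ∈ 𝓗, y ∈ A ∧ y' ∉ A
  edge : ∀ A ∈ 𝓗, ∃ y₀ ∉ A, ∃ y₁ ∈ A, ∀ B ∈ 𝓗, B ≠ A → B ≠ Aᶜ → (y₀ ∈ B ↔ y₁ ∈ B)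
  no_inv : ∀ (g : G) (A : Set Y), A ∈ 𝓗 → g • A ≠ Aᶜ

/-- An element that moves no halfspace properly inside itself. -/
def IsElliptic {G Y : Type*} [Group G] [MulAction G Y] (𝓗 : Set (Set Y)) (a : G) : Prop :=
  ∀ A ∈ 𝓗, ¬ a • A ⊂ A

/-- The fixed vertices of `a` lie in the halfspace `A`, off its boundary edge. -/
def LivesIn {G Y : Type*} [Group G] [MulAction G Y] (a : G) (A : Set Y) : Prop :=
  a • Aᶜ ⊆ A

namespace IsHalfspaceSystem

variable {G Y : Type*} [Group G] [MulAction G Y] {𝓗 : Set (Set Y)}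

theorem nonempty (h : IsHalfspaceSystem G 𝓗) {A : Set Y} (hA : A ∈ 𝓗) : A.Nonempty := by
  obtain ⟨_, _, y, hy, _⟩ := h.edge A hA
  exact ⟨y, hy⟩

theorem exists_notMem (h : IsHalfspaceSystem G 𝓗) {A : Set Y} (hA : A ∈ 𝓗) : ∃ y, y ∉ A := by
  obtain ⟨y, hy, _⟩ := h.edge A hA
  exact ⟨y, hy⟩

/-- Elements fixing two distinct vertices fix a common halfspace. -/
theorem exists_fixed_of_ne (h : IsHalfspaceSystem G 𝓗) {y y' : Y} (hy : y ≠ y') :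
    ∃ A ∈ 𝓗, ∀ g : G, g • y = y → g • y' = y' → g • A = A := by
  obtain ⟨A₀, hA₀, h1, h2⟩ := h.sep y y' hy
  obtain ⟨A, hA⟩ := (h.finite_sep y y').exists_minimal ⟨A₀, hA₀, h1, h2⟩
  obtain ⟨⟨hA1, hA2, hA3⟩, hmin⟩ := hA
  have key : ∀ g : G, g • y = y → g • y' = y' → A ⊆ g • A := by
    intro g hg hg'
    have m1 : y ∈ g • A := by
      rw [Set.mem_smul_set_iff_inv_smul_mem, inv_smul_eq_iff.2 hg.symm]; exact hA2
    have m2 : y' ∉ g • A := by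
      rw [Set.mem_smul_set_iff_inv_smul_mem, inv_smul_eq_iff.2 hg'.symm]; exact hA3
    rcases h.nested A hA1 (g • A) (h.smul_mem g A hA1) with h1 | h1 | h1 | h1
    · exact h1
    · exact hmin ⟨h.smul_mem g A hA1, m1, m2⟩ h1
    · exact absurd m1 (h1 hA2)
    · exact absurd (h1 hA3) m2
  refine ⟨A, hA1, fun g hg hg' => Set.Subset.antisymm ?_ (key g hg hg')⟩
  have := key g⁻¹ (inv_smul_eq_iff.2 hg.symm) (inv_smul_eq_iff.2 hg'.symm)
  rwa [Set.subset_smul_set_iff, inv_inv] at this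

theorem pow_smul_antitone {a : G} {A : Set Y} (ha : a • A ⊂ A) :
    StrictAnti fun n : ℤ => a ^ n • A := by
  refine strictAnti_int_of_succ_lt fun n => ?_
  show a ^ (n + 1) • A ⊂ a ^ n • A
  rw [zpow_add, zpow_one, mul_smul, Set.ssubset_iff_subset_ne]
  refine ⟨Set.smul_set_mono ha.1, fun he => ha.ne ?_⟩
  exact MulAction.injective (a ^ n) he

theorem exists_notMem_pow (h : IsHalfspaceSystem G 𝓗) {a : G} {A : Set Y} (hA : A ∈ 𝓗)
    (ha : a • A ⊂ A) (y : Y) : ∃ n : ℤ, y ∉ a ^ n • A := by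
  by_contra! hc
  obtain ⟨y', hy'⟩ := h.exists_notMem hA
  refine Set.infinite_of_injective_forall_mem (f := fun n : ℕ => a ^ (n : ℤ) • A) ?_ ?_
    (h.finite_sep y y')
  · exact (pow_smul_antitone ha).injective.comp Nat.cast_injective
  · intro n
    refine ⟨h.smul_mem _ _ hA, hc n, fun hm => hy' ?_⟩
    have := (pow_smul_antitone ha).antitone (Int.natCast_nonneg n)
    simpa using this hm

theorem exists_mem_pow (h : IsHalfspaceSystem G 𝓗) {a : G} {A : Set Y} (hA : A ∈ 𝓗)
    (ha : a • A ⊂ A) (y : Y) : ∃ n : ℤ, y ∈ a ^ n • A := by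
  have ha' : a⁻¹ • Aᶜ ⊂ Aᶜ := by
    rw [Set.smul_set_compl]
    refine compl_lt_compl_iff_lt.2 ?_
    have := pow_smul_antitone ha (show (-1 : ℤ) < 0 by norm_num)
    simpa using this
  obtain ⟨n, hn⟩ := h.exists_notMem_pow (h.compl_mem A hA) ha' y
  refine ⟨-n, ?_⟩
  rw [Set.smul_set_compl, inv_zpow'] at hn
  simpa using hn

theorem isElliptic_of_fixed (h : IsHalfspaceSystem G 𝓗) {a : G} {y : Y} (hy : a • y = y) :
    IsElliptic 𝓗 a := by
  intro A hA ha
  have hfix : ∀ n : ℤ, y ∈ a ^ n • A ↔ y ∈ A := by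
    intro n
    rw [Set.mem_smul_set_iff_inv_smul_mem]
    have : (a ^ n)⁻¹ • y = y := by
      have hm : a ∈ MulAction.stabilizer G y := hy
      exact (inv_mem (zpow_mem hm n) : _ ∈ MulAction.stabilizer G y)
    rw [this]
  obtain ⟨n, hn⟩ := h.exists_notMem_pow hA ha y
  obtain ⟨k, hk⟩ := h.exists_mem_pow hA ha y
  exact hn ((hfix n).2 ((hfix k).1 hk))

theorem not_isElliptic_zpow (h : IsHalfspaceSystem G 𝓗) {a : G} {A : Set Y} (hA : A ∈ 𝓗)
    (ha : a • A ⊂ A) {k : ℤ} (hk : k ≠ 0) : ¬ IsElliptic 𝓗 (a ^ k) := by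
  intro he
  rcases lt_or_gt_of_ne hk with hk | hk
  · refine he Aᶜ (h.compl_mem A hA) ?_
    rw [Set.smul_set_compl]
    refine compl_lt_compl_iff_lt.2 ?_
    simpa using pow_smul_antitone ha hk
  · refine he A hA ?_
    simpa using pow_smul_antitone ha hk

theorem trichotomy (h : IsHalfspaceSystem G 𝓗) {a : G} (ha : IsElliptic 𝓗 a) {A : Set Y}
    (hA : A ∈ 𝓗) : a • A = A ∨ LivesIn a A ∨ LivesIn a Aᶜ := by
  unfold LivesIn
  rcases h.nested A hA (a • A) (h.smul_mem a A hA) with h1 | h1 | h1 | h1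
  · left
    by_contra hne
    refine ha Aᶜ (h.compl_mem A hA) ?_
    rw [Set.smul_set_compl]
    exact compl_lt_compl_iff_lt.2 (Set.ssubset_iff_subset_ne.2 ⟨h1, Ne.symm hne⟩)
  · left
    by_contra hne
    exact ha A hA (Set.ssubset_iff_subset_ne.2 ⟨h1, hne⟩)
  · right; right
    rw [compl_compl]
    exact Set.subset_compl_comm.1 h1
  · right; left
    rw [Set.smul_set_compl]
    exact Set.compl_subset_comm.1 h1

theorem not_livesIn_both (h : IsHalfspaceSystem G 𝓗) {a : G} {A : Set Y} (hA : A ∈ 𝓗)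
    (h1 : LivesIn a A) (h2 : LivesIn a Aᶜ) : False := by
  unfold LivesIn at h1 h2
  rw [compl_compl] at h2
  rw [Set.smul_set_compl] at h1
  exact h.no_inv a A hA (Set.Subset.antisymm h2 (Set.compl_subset_comm.1 h1))

/-- Commuting elements cannot live on opposite sides of an edge. -/
theorem not_livesIn_opposite (h : IsHalfspaceSystem G 𝓗) {a b : G} {A : Set Y} (hA : A ∈ 𝓗)
    (hab : a * b = b * a) (h1 : LivesIn a A) (h2 : LivesIn b Aᶜ) : False := by
  unfold LivesIn at h1 h2
  rw [compl_compl] at h2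
  have e1 : (a * b) • A ⊆ a • Aᶜ := by rw [mul_smul]; exact Set.smul_set_mono h2
  have e2 : (a * b) • Aᶜ ⊆ b • A := by rw [hab, mul_smul]; exact Set.smul_set_mono h1
  have e3 : (a * b) • Aᶜ ⊆ Aᶜ := e2.trans h2
  have e4 : A ⊆ (a * b) • A := by
    rw [Set.smul_set_compl] at e3
    exact Set.compl_subset_compl.1 e3
  have e5 : a • Aᶜ = A := Set.Subset.antisymm h1 (e4.trans e1)
  have e6 : a • Aᶜ = Aᶜᶜ := by rw [e5, compl_compl]
  exact h.no_inv a Aᶜ (h.compl_mem A hA) e6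

/-- A Helly property: finitely many elliptic elements, no two of which live on opposite sides of
an edge and which do not all fix a common edge, have a common fixed vertex. -/
theorem exists_common_fixed (h : IsHalfspaceSystem G 𝓗) [Nonempty Y] {ι : Type*} [Finite ι]
    (a : ι → G) (ha : ∀ i, IsElliptic 𝓗 (a i))
    (hfix : ∀ A ∈ 𝓗, ¬ ∀ i, a i • A = A)
    (hopp : ∀ A ∈ 𝓗, ∀ i j, LivesIn (a i) A → LivesIn (a j) Aᶜ → False) :
    ∃ y : Y, ∀ i, a i • y = y := by
  set Ω : Set (Set Y) := {A | A ∈ 𝓗 ∧ ∃ i, LivesIn (a i) A} with hΩ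
  have hor : ∀ A ∈ 𝓗, A ∈ Ω ∨ Aᶜ ∈ Ω := by
    intro A hA
    have := hfix A hA
    push Not at this
    obtain ⟨i, hi⟩ := this
    rcases h.trichotomy (ha i) hA with h1 | h1 | h1
    · exact absurd h1 hi
    · exact Or.inl ⟨hA, i, h1⟩
    · exact Or.inr ⟨h.compl_mem A hA, i, h1⟩
  have hexcl : ∀ A, A ∈ Ω → Aᶜ ∈ Ω → False := by
    rintro A ⟨hA, i, hi⟩ ⟨_, j, hj⟩
    exact hopp A hA i j hi hj
  have hfin : ∀ y, {A | A ∈ Ω ∧ y ∉ A}.Finite := by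
    intro y
    refine (Set.finite_iUnion fun i => h.finite_sep (a i • y) y).subset ?_
    rintro A ⟨⟨hA, i, hi⟩, hy⟩
    refine Set.mem_iUnion.2 ⟨i, hA, hi ?_, hy⟩
    exact Set.smul_mem_smul_set hy
  obtain ⟨y, -, hmin⟩ := (measure fun y : Y => {A | A ∈ Ω ∧ y ∉ A}.ncard).wf.has_min
    Set.univ Set.univ_nonempty
  have hempty : ∀ A ∈ Ω, y ∈ A := by
    intro A hAΩ
    by_contra hyA
    obtain ⟨y₀, hy₀, y₁, hy₁, hedge⟩ := h.edge A hAΩ.1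
    refine hmin y₁ (Set.mem_univ _) ?_
    show {A | A ∈ Ω ∧ y₁ ∉ A}.ncard < {A | A ∈ Ω ∧ y ∉ A}.ncard
    refine Set.ncard_lt_ncard (Set.ssubset_iff_subset_ne.2 ⟨?_, ?_⟩) (hfin y)
    · rintro B ⟨hB, hyB⟩
      refine ⟨hB, ?_⟩
      have hBA : B ≠ A := by rintro rfl; exact hyB hy₁
      have hBA' : B ≠ Aᶜ := by rintro rfl; exact hexcl A hAΩ hB
      have hy₀B : y₀ ∉ B := fun hm => hyB ((hedge B hB.1 hBA hBA').1 hm)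
      rcases h.nested A hAΩ.1 B hB.1 with h1 | h1 | h1 | h1
      · exact absurd (h1 hy₁) hyB
      · exact fun hm => hyA (h1 hm)
      · exfalso
        refine hexcl A hAΩ ⟨h.compl_mem A hAΩ.1, ?_⟩
        obtain ⟨j, hj⟩ := hB.2
        refine ⟨j, ?_⟩
        unfold LivesIn at hj ⊢
        rw [compl_compl]
        exact (Set.smul_set_mono h1).trans (hj.trans (Set.subset_compl_comm.1 h1))
      · exact absurd (h1 hy₀) hy₀B
    · intro he
      have : A ∈ {A | A ∈ Ω ∧ y₁ ∉ A} := by rw [he]; exact ⟨hAΩ, hyA⟩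
      exact this.2 hy₁
  refine ⟨y, fun i => ?_⟩
  by_contra hne
  obtain ⟨A, hA, hyA, hiA⟩ := h.sep y (a i • y) (Ne.symm hne)
  have hAΩ : A ∈ Ω := (hor A hA).resolve_right fun hc => hempty _ hc hyA
  have hA' : (a i)⁻¹ • A ∈ 𝓗 := h.smul_mem _ _ hA
  have hAΩ' : ((a i)⁻¹ • A)ᶜ ∈ Ω := by
    refine (hor _ hA').resolve_left fun hc => hiA ?_
    have := hempty _ hc
    rwa [Set.mem_smul_set_iff_inv_smul_mem, inv_inv] at this
  rcases h.trichotomy (ha i) hA with h1 | h1 | h1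
  · exact hiA (h1 ▸ Set.smul_mem_smul_set hyA)
  · refine hexcl _ ⟨hA', i, ?_⟩ hAΩ'
    unfold LivesIn at h1 ⊢
    rw [← Set.smul_set_compl, smul_inv_smul, Set.subset_smul_set_iff, inv_inv]
    exact h1
  · exact hexcl A hAΩ ⟨h.compl_mem A hA, i, h1⟩

/-- The halfspaces lying between two translates of `A` under powers of `a`. -/
def axis (𝓗 : Set (Set Y)) (a : G) (A : Set Y) : Set (Set Y) :=
  {B | B ∈ 𝓗 ∧ ∃ n k : ℤ, a ^ n • A ⊆ B ∧ B ⊆ a ^ k • A}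

theorem axis_total (h : IsHalfspaceSystem G 𝓗) {a : G} {A : Set Y} (hA : A ∈ 𝓗)
    (ha : a • A ⊂ A) {B B' : Set Y} (hB : B ∈ axis 𝓗 a A) (hB' : B' ∈ axis 𝓗 a A) :
    B ⊆ B' ∨ B' ⊆ B := by
  obtain ⟨hB, n, k, h1, h2⟩ := hB
  obtain ⟨hB', n', k', h1', h2'⟩ := hB'
  have anti := (pow_smul_antitone ha).antitone
  rcases h.nested B hB B' hB' with h3 | h3 | h3 | h3
  · exact Or.inl h3
  · exact Or.inr h3
  · exfalso
    obtain ⟨y, hy⟩ := h.nonempty (h.smul_mem (a ^ (max n n')) A hA)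
    exact h3 (h1 (anti (le_max_left n n') hy)) (h1' (anti (le_max_right n n') hy))
  · exfalso
    obtain ⟨y, hy⟩ := h.exists_notMem (h.smul_mem (a ^ (min k k')) A hA)
    refine hy (anti (min_le_right k k') (h2' (h3 fun hm => ?_)))
    exact hy (anti (min_le_left k k') (h2 hm))

theorem exists_pow_subset (h : IsHalfspaceSystem G 𝓗) {a z : G} {A : Set Y} (hA : A ∈ 𝓗)
    (ha : a • A ⊂ A) (hz : a * z = z * a) : ∃ n : ℤ, a ^ n • A ⊆ z • A := by
  have anti := (pow_smul_antitone ha).antitone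
  have hzn : ∀ n : ℤ, a ^ n • z • A = z • a ^ n • A := by
    intro n
    have hc : Commute a z := hz
    rw [← mul_smul, ← mul_smul, (hc.zpow_left n).eq]
  obtain ⟨y, hy⟩ := h.nonempty (h.smul_mem z A hA)
  obtain ⟨n, hn⟩ := h.exists_notMem_pow hA ha y
  rcases h.nested (z • A) (h.smul_mem z A hA) (a ^ n • A) (h.smul_mem _ A hA) with
    h1 | h1 | h1 | h1
  · exact absurd (h1 hy) hn
  · exact ⟨n, h1⟩
  · exfalso
    obtain ⟨k, hk⟩ := h.exists_mem_pow hA ha y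
    obtain ⟨l, hl⟩ := h.exists_mem_pow hA ha (z⁻¹ • y)
    set j := min l (k - n)
    have e1 : a ^ j • z • A ⊆ (a ^ (j + n) • A)ᶜ := by
      rw [zpow_add, mul_smul, ← Set.smul_set_compl]
      exact Set.smul_set_mono h1
    rw [hzn] at e1
    refine e1 (Set.mem_smul_set_iff_inv_smul_mem.2 (anti (min_le_left _ _) hl)) (anti ?_ hk)
    have : j ≤ k - n := min_le_right _ _
    omega
  · exfalso
    obtain ⟨k, hk⟩ := h.exists_notMem_pow hA ha y
    obtain ⟨l, hl⟩ := h.exists_notMem_pow hA ha (z⁻¹ • y)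
    set j := max l (k - n)
    have e1 : (a ^ j • z • A)ᶜ ⊆ a ^ (j + n) • A := by
      rw [zpow_add, mul_smul, ← Set.smul_set_compl]
      exact Set.smul_set_mono h1
    rw [hzn] at e1
    have hjk : k ≤ j + n := by
      have : k - n ≤ j := le_max_right _ _
      omega
    refine hk (anti hjk (e1 fun hm => hl ?_))
    exact anti (le_max_left l (k - n)) (Set.mem_smul_set_iff_inv_smul_mem.1 hm)

theorem smul_mem_axis (h : IsHalfspaceSystem G 𝓗) {a z : G} {A B : Set Y} (hA : A ∈ 𝓗)
    (ha : a • A ⊂ A) (hz : a * z = z * a) (hB : B ∈ axis 𝓗 a A) : z • B ∈ axis 𝓗 a A := by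
  obtain ⟨hB, n, k, h1, h2⟩ := hB
  have hc : Commute a z := hz
  have hzn : ∀ n : ℤ, z • a ^ n • A = a ^ n • z • A := by
    intro n
    rw [← mul_smul, ← mul_smul, (hc.zpow_left n).eq]
  obtain ⟨i, hi⟩ := h.exists_pow_subset hA ha hz
  obtain ⟨j, hj⟩ := h.exists_pow_subset hA ha hc.inv_right.eq
  refine ⟨h.smul_mem z B hB, n + i, k - j, ?_, ?_⟩
  · refine Set.Subset.trans ?_ (Set.smul_set_mono (a := z) h1)
    rw [hzn, zpow_add, mul_smul]
    exact Set.smul_set_mono hi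
  · refine (Set.smul_set_mono (a := z) h2).trans ?_
    rw [hzn, sub_eq_add_neg, zpow_add, mul_smul]
    refine Set.smul_set_mono ?_
    rw [zpow_neg, Set.subset_smul_set_iff, inv_inv, ← hzn, Set.smul_set_subset_iff_subset_inv_smul_set]
    exact hj

end IsHalfspaceSystem

theorem Int.orderIso_apply (f : ℤ ≃o ℤ) (n : ℤ) : f n = f 0 + n := by
  have hs : ∀ k, f (k + 1) = f k + 1 := fun k => by
    simpa [Order.succ_eq_add_one] using f.map_succ k
  induction n using Int.induction_on with
  | zero => simp
  | succ k ih => rw [hs, ih, add_assoc]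
  | pred k ih =>
    have := hs (-k - 1)
    rw [sub_add_cancel, ih] at this
    omega

theorem orderIso_comm_of_locallyFinite {T : Type*} [LinearOrder T] [LocallyFiniteOrder T]
    [NoMaxOrder T] [NoMinOrder T] [Nonempty T] (f g : T ≃o T) (t : T) : f (g t) = g (f t) := by
  let _ : SuccOrder T := LinearLocallyFiniteOrder.succOrder T
  let _ : PredOrder T := LinearLocallyFiniteOrder.predOrder T
  let e : T ≃o ℤ := orderIsoIntOfLinearSuccPredArch
  have hf := Int.orderIso_apply ((e.symm.trans f).trans e)
  have hg := Int.orderIso_apply ((e.symm.trans g).trans e)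
  simp only [OrderIso.trans_apply] at hf hg
  apply e.injective
  have e1 := hf (e (g t))
  have e2 := hg (e (f t))
  have e3 := hf (e t)
  have e4 := hg (e t)
  simp only [OrderIso.symm_apply_apply] at e1 e2 e3 e4
  rw [e1, e2, e3, e4]
  ring

namespace IsHalfspaceSystem

variable {G Y : Type*} [Group G] [MulAction G Y] {𝓗 : Set (Set Y)}

/-- Commutators of elements centralizing a hyperbolic element fix its axis. -/
theorem exists_fixed_of_hyperbolic (h : IsHalfspaceSystem G 𝓗) {a : G} (ha : ¬ IsElliptic 𝓗 a) :
    ∃ A ∈ 𝓗, ∀ z z' : G, a * z = z * a → a * z' = z' * a →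
      (z * z' * z⁻¹ * z'⁻¹) • A = A := by
  unfold IsElliptic at ha
  push Not at ha
  obtain ⟨A, hA, ha⟩ := ha
  refine ⟨A, hA, fun z z' hz hz' => ?_⟩
  let T := {B : Set Y // B ∈ axis 𝓗 a A}
  let _ : LinearOrder T :=
    { (inferInstance : PartialOrder T) with
      le_total := fun B B' => h.axis_total hA ha B.2 B'.2
      toDecidableLE := Classical.decRel _ }
  have hAax : A ∈ axis 𝓗 a A := ⟨hA, 0, 0, by simp, by simp⟩
  have : Nonempty T := ⟨⟨A, hAax⟩⟩
  have hpow : ∀ n : ℤ, a ^ n • A ∈ axis 𝓗 a A := fun n =>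
    ⟨h.smul_mem _ _ hA, n, n, subset_rfl, subset_rfl⟩
  have anti := pow_smul_antitone ha
  have : NoMaxOrder T := ⟨fun B => by
    obtain ⟨hB, n, k, h1, h2⟩ := B.2
    exact ⟨⟨a ^ (k - 1) • A, hpow _⟩, lt_of_le_of_lt (b := (⟨a ^ k • A, hpow _⟩ : T)) h2
      (anti (by omega))⟩⟩
  have : NoMinOrder T := ⟨fun B => by
    obtain ⟨hB, n, k, h1, h2⟩ := B.2
    exact ⟨⟨a ^ (n + 1) • A, hpow _⟩, lt_of_lt_of_le (b := (⟨a ^ n • A, hpow _⟩ : T))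
      (anti (by omega)) h1⟩⟩
  let _ : LocallyFiniteOrder T := LocallyFiniteOrder.ofFiniteIcc fun B B' => by
    obtain ⟨y, hy⟩ := h.nonempty B.2.1
    obtain ⟨y', hy'⟩ := h.exists_notMem B'.2.1
    refine Set.Finite.of_finite_image (f := Subtype.val) ?_ Subtype.val_injective.injOn
    refine (h.finite_sep y y').subset ?_
    rintro _ ⟨D, ⟨hD1, hD2⟩, rfl⟩
    exact ⟨D.2.1, hD1 hy, fun hm => hy' (hD2 hm)⟩
  let act : ∀ z : G, a * z = z * a → (T ≃o T) := fun z hz =>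
    { toFun := fun B => ⟨z • B.1, h.smul_mem_axis hA ha hz B.2⟩
      invFun := fun B => ⟨z⁻¹ • B.1, h.smul_mem_axis hA ha
        (show Commute a z from hz).inv_right.eq B.2⟩
      left_inv := fun B => Subtype.ext (inv_smul_smul z B.1)
      right_inv := fun B => Subtype.ext (smul_inv_smul z B.1)
      map_rel_iff' := fun {B B'} => Set.smul_set_subset_smul_set_iff }
  let B₀ : T := (act z' hz').symm ((act z hz).symm ⟨A, hAax⟩)
  have key := orderIso_comm_of_locallyFinite (act z hz) (act z' hz') B₀
  have k1 : (act z' hz' ((act z hz) B₀)) = ⟨A, hAax⟩ := by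
    rw [← key]; simp [B₀]
  have k2 : z' • z • z'⁻¹ • z⁻¹ • A = A := congrArg Subtype.val k1
  have k3 : (z * z' * z⁻¹ * z'⁻¹)⁻¹ • A = A := by
    simpa [mul_smul, mul_assoc] using k2
  rw [inv_smul_eq_iff] at k3
  exact k3.symm

end IsHalfspaceSystem

/-- The indicator function of the subgroup `H ⊓ K`. -/
noncomputable def edgeIndicator {G : Type*} [Group G] (H K : Subgroup G) (x : G) : ZMod 2 :=
  if x ∈ H ⊓ K then 1 else 0

/-- A mod 2 crossing cocycle: `d g x` counts how often the path from the base vertex `H` to `gH`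
crosses the edge `x (H ⊓ K)`. -/
structure IsCrossingCocycle {G : Type*} [Group G] (H K : Subgroup G) (d : G → G → ZMod 2) :
    Prop where
  mul : ∀ g g' x, d (g * g') x = d g x + d g' (g⁻¹ * x)
  left : ∀ h ∈ H, ∀ x, d h x = 0
  right : ∀ k ∈ K, ∀ x, d k x = edgeIndicator H K (k⁻¹ * x) + edgeIndicator H K x
  mul_right : ∀ g x, ∀ l ∈ H ⊓ K, d g (x * l) = d g x
  sup_eq_top : H ⊔ K = ⊤

namespace IsCrossingCocycle

variable {G : Type*} [Group G] {H K : Subgroup G} {d : G → G → ZMod 2}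

/-- The side of the edge `x (H ⊓ K)` on which a vertex lies. -/
noncomputable def side (hd : IsCrossingCocycle H K d) (x : G) : (G ⧸ H) ⊕ (G ⧸ K) → ZMod 2 :=
  Sum.elim
    (Quotient.lift (fun g => d g x) fun g g' hg => by
      have hm : g⁻¹ * g' ∈ H := QuotientGroup.leftRel_apply.1 hg
      have := hd.mul g (g⁻¹ * g') x
      rw [hd.left _ hm, mul_inv_cancel_left, add_zero] at this
      exact this.symm)
    (Quotient.lift (fun g => d g x + edgeIndicator H K (g⁻¹ * x)) fun g g' hg => by
      have hm : g⁻¹ * g' ∈ K := QuotientGroup.leftRel_apply.1 hg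
      have := hd.mul g (g⁻¹ * g') x
      rw [hd.right _ hm, mul_inv_cancel_left] at this
      simp only [this, mul_inv_rev, inv_inv, mul_assoc, mul_inv_cancel_left]
      generalize edgeIndicator H K (g'⁻¹ * x) = a
      generalize edgeIndicator H K (g⁻¹ * x) = b
      generalize d g x = c
      revert a b c
      decide)

variable (hd : IsCrossingCocycle H K d)
include hd

theorem side_inl (x g : G) : hd.side x (Sum.inl (g : G ⧸ H)) = d g x := rfl

theorem side_inr (x g : G) :
    hd.side x (Sum.inr (g : G ⧸ K)) = d g x + edgeIndicator H K (g⁻¹ * x) := rfl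

theorem side_mul (x l : G) (hl : l ∈ H ⊓ K) (y : (G ⧸ H) ⊕ (G ⧸ K)) :
    hd.side (x * l) y = hd.side x y := by
  rcases y with y | y <;> induction y using QuotientGroup.induction_on with | H g => ?_
  · rw [side_inl, side_inl, hd.mul_right _ _ l hl]
  · rw [side_inr, side_inr, hd.mul_right _ _ l hl]
    simp only [edgeIndicator, ← mul_assoc, Subgroup.mul_mem_cancel_right _ hl]

theorem side_smul (g x : G) (y : (G ⧸ H) ⊕ (G ⧸ K)) :
    hd.side (g * x) (g • y) = hd.side x y + d g (g * x) := by
  rcases y with y | y <;> induction y using QuotientGroup.induction_on with | H z => ?_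
  · show hd.side (g * x) (Sum.inl ((g * z : G) : G ⧸ H)) = _
    rw [side_inl, side_inl, hd.mul, inv_mul_cancel_left, add_comm]
  · show hd.side (g * x) (Sum.inr ((g * z : G) : G ⧸ K)) = _
    rw [side_inr, side_inr, hd.mul, inv_mul_cancel_left, mul_inv_rev, mul_assoc,
      inv_mul_cancel_left]
    ring

theorem side_adj_of_notMem (x g : G) (hx : g⁻¹ * x ∉ H ⊓ K) :
    hd.side x (Sum.inl (g : G ⧸ H)) = hd.side x (Sum.inr (g : G ⧸ K)) := by
  rw [side_inl, side_inr, edgeIndicator, if_neg hx, add_zero]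

theorem side_adj_of_mem (x g : G) (hx : g⁻¹ * x ∈ H ⊓ K) :
    hd.side x (Sum.inr (g : G ⧸ K)) = hd.side x (Sum.inl (g : G ⧸ H)) + 1 := by
  rw [side_inl, side_inr, edgeIndicator, if_pos hx]

/-- The tree is connected: a function that agrees at the two ends of each edge is constant. -/
theorem eq_of_adj {α : Type*} (F : (G ⧸ H) ⊕ (G ⧸ K) → α)
    (hF : ∀ g : G, F (Sum.inl (g : G ⧸ H)) = F (Sum.inr (g : G ⧸ K)))
    (y y' : (G ⧸ H) ⊕ (G ⧸ K)) : F y = F y' := by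
  have key : ∀ x : G, ∀ g : G,
      F (Sum.inl ((g * x : G) : G ⧸ H)) = F (Sum.inl (g : G ⧸ H)) := by
    intro x
    have hx : x ∈ H ⊔ K := hd.sup_eq_top ▸ Subgroup.mem_top x
    rw [Subgroup.sup_eq_closure] at hx
    induction hx using Subgroup.closure_induction with
    | mem k hk =>
      intro g
      rcases hk with hk | hk
      · rw [show ((g * k : G) : G ⧸ H) = (g : G ⧸ H) from
          QuotientGroup.eq.2 (by simpa using H.inv_mem hk)]
      · rw [hF, hF, show ((g * k : G) : G ⧸ K) = (g : G ⧸ K) from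
          QuotientGroup.eq.2 (by simpa using K.inv_mem hk)]
    | one => simp
    | mul a b _ _ ha hb => intro g; rw [← mul_assoc, hb, ha]
    | inv a _ ha => intro g; simpa using (ha (g * a⁻¹)).symm
  have h1 : ∀ y, F y = F (Sum.inl ((1 : G) : G ⧸ H)) := by
    rintro (y | y) <;> induction y using QuotientGroup.induction_on with | H z => ?_
    · simpa using key z 1
    · rw [← hF]; simpa using key z 1
  rw [h1, h1 y']

/-- The halfspaces of the tree: the vertices on a given side of a given edge. -/
noncomputable def halfspaces : Set (Set ((G ⧸ H) ⊕ (G ⧸ K))) :=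
  {A | ∃ x ε, A = {y | hd.side x y = ε}}

theorem smul_halfspace (g x : G) (ε : ZMod 2) :
    g • {y | hd.side x y = ε} = {y | hd.side (g * x) y = ε + d g (g * x)} := by
  ext y
  rw [Set.mem_smul_set_iff_inv_smul_mem]
  have := hd.side_smul g x (g⁻¹ • y)
  rw [smul_inv_smul] at this
  simp only [Set.mem_ofPred_eq, this, add_left_inj]

theorem side_eq_of_mem {x z : G} (h : x⁻¹ * z ∈ H ⊓ K) (y : (G ⧸ H) ⊕ (G ⧸ K)) :
    hd.side z y = hd.side x y := by
  have := hd.side_mul x (x⁻¹ * z) h y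
  rwa [mul_inv_cancel_left] at this

theorem side_ne_self (x : G) :
    hd.side x (Sum.inr (x : G ⧸ K)) ≠ hd.side x (Sum.inl (x : G ⧸ H)) := by
  rw [hd.side_adj_of_mem x x (by simp)]
  simp

theorem side_eq_of_side_ne {x z : G} (h : x⁻¹ * z ∉ H ⊓ K) (y : (G ⧸ H) ⊕ (G ⧸ K))
    (hy : hd.side x y ≠ hd.side x (Sum.inl (z : G ⧸ H))) :
    hd.side z y = hd.side z (Sum.inl (x : G ⧸ H)) := by
  have h' : z⁻¹ * x ∉ H ⊓ K := fun hm => h (by simpa using inv_mem hm)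
  have key := hd.eq_of_adj (fun y => if hd.side x y = hd.side x (Sum.inl (z : G ⧸ H)) then
    hd.side z (Sum.inl (x : G ⧸ H)) else hd.side z y) (fun g => by
      by_cases hx : g⁻¹ * x ∈ H ⊓ K
      · have e1 : (g : G ⧸ H) = x := QuotientGroup.eq.2 hx.1
        have e2 : (g : G ⧸ K) = x := QuotientGroup.eq.2 hx.2
        simp only [e1, e2]
        rw [hd.side_adj_of_notMem z x h]
        simp
      by_cases hz : g⁻¹ * z ∈ H ⊓ K
      · have e1 : (g : G ⧸ H) = z := QuotientGroup.eq.2 hz.1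
        have e2 : (g : G ⧸ K) = z := QuotientGroup.eq.2 hz.2
        simp only [e1, e2]
        rw [hd.side_adj_of_notMem x z h']
        simp
      simp only [hd.side_adj_of_notMem x g hx, hd.side_adj_of_notMem z g hz])
    y (Sum.inl (z : G ⧸ H))
  simpa [hy] using key

theorem inv_mul_mem_of_smul_halfspace {g x : G} {ε δ : ZMod 2}
    (h : g • {y | hd.side x y = ε} = {y | hd.side x y = δ}) : x⁻¹ * g * x ∈ H ⊓ K := by
  by_contra hx
  have hx' : x⁻¹ * (g * x) ∉ H ⊓ K := by rwa [← mul_assoc]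
  rw [hd.smul_halfspace] at h
  have e1 := Set.ext_iff.1 h (Sum.inl (x : G ⧸ H))
  have e2 := Set.ext_iff.1 h (Sum.inr (x : G ⧸ K))
  simp only [Set.mem_ofPred_eq] at e1 e2
  rw [← hd.side_adj_of_notMem _ x hx', e1, hd.side_adj_of_mem x x (by simp)] at e2
  revert e2
  clear e1 h
  generalize hd.side x (Sum.inl (x : G ⧸ H)) = a
  revert a δ
  decide

theorem exists_edge {A : Set ((G ⧸ H) ⊕ (G ⧸ K))} (hA : A ∈ hd.halfspaces) :
    ∃ x : G, ∀ g : G, g • A = A → x⁻¹ * g * x ∈ H ⊓ K := by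
  obtain ⟨x, ε, rfl⟩ := hA
  exact ⟨x, fun g hg => hd.inv_mul_mem_of_smul_halfspace hg⟩

theorem halfspace_compl (x : G) (ε : ZMod 2) :
    {y | hd.side x y = ε}ᶜ = {y | hd.side x y = ε + 1} := by
  ext y
  simp only [Set.mem_compl_iff, Set.mem_ofPred_eq]
  generalize hd.side x y = a
  revert a ε
  decide

theorem finite_halfspaces_sep (y y' : (G ⧸ H) ⊕ (G ⧸ K)) :
    {A | A ∈ hd.halfspaces ∧ y ∈ A ∧ y' ∉ A}.Finite := by
  have step : ∀ (g : G) (w w' : (G ⧸ H) ⊕ (G ⧸ K)),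
      (∀ x, g⁻¹ * x ∉ H ⊓ K → hd.side x w = hd.side x w') →
      {A | A ∈ hd.halfspaces ∧ y ∈ A ∧ w ∉ A}.Finite →
      {A | A ∈ hd.halfspaces ∧ y ∈ A ∧ w' ∉ A}.Finite := by
    intro g w w' hw hf
    refine (hf.union (Set.finite_range fun ε => {y | hd.side g y = ε})).subset ?_
    rintro A ⟨⟨x, ε, rfl⟩, hy, hw'⟩
    by_cases hx : g⁻¹ * x ∈ H ⊓ K
    · right
      refine ⟨ε, ?_⟩
      ext z
      simp only [Set.mem_ofPred_eq, hd.side_eq_of_mem hx]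
    · left
      refine ⟨⟨x, ε, rfl⟩, hy, ?_⟩
      simpa [hw x hx] using hw'
  have key := hd.eq_of_adj (fun w => {A | A ∈ hd.halfspaces ∧ y ∈ A ∧ w ∉ A}.Finite)
    (fun g => propext ⟨step g _ _ fun x hx => hd.side_adj_of_notMem x g hx,
      step g _ _ fun x hx => (hd.side_adj_of_notMem x g hx).symm⟩) y y'
  rw [← key]
  convert Set.finite_empty
  ext A
  simp only [Set.mem_ofPred_eq, Set.mem_empty_iff_false, iff_false]
  tauto

theorem eq_of_side_eq {y y' : (G ⧸ H) ⊕ (G ⧸ K)} (h : ∀ x, hd.side x y = hd.side x y') :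
    y = y' := by
  rcases y with y | y <;> induction y using QuotientGroup.induction_on with | H a => ?_
  · have key := hd.eq_of_adj (fun w => w = Sum.inl (a : G ⧸ H) ∨
      ∃ l ∈ H, hd.side (a * l) w ≠ hd.side (a * l) (Sum.inl (a : G ⧸ H))) (fun g => by
        by_cases hg : g⁻¹ * a ∈ H
        · have e1 : (g : G ⧸ H) = a := QuotientGroup.eq.2 hg
          rw [e1]
          refine propext ⟨fun _ => Or.inr ⟨a⁻¹ * g, by simpa using inv_mem hg, ?_⟩,
            fun _ => Or.inl rfl⟩
          rw [mul_inv_cancel_left, ← e1]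
          exact hd.side_ne_self g
        · have e1 : (g : G ⧸ H) ≠ a := fun e => hg (QuotientGroup.eq.1 e)
          have e2 : ∀ l ∈ H, hd.side (a * l) (Sum.inl (g : G ⧸ H)) =
              hd.side (a * l) (Sum.inr (g : G ⧸ K)) := fun l hl =>
            hd.side_adj_of_notMem _ _ fun hm => hg (by
              have := (Subgroup.mem_inf.1 hm).1
              rwa [← mul_assoc, Subgroup.mul_mem_cancel_right _ hl] at this)
          refine propext (or_congr (by simpa using e1) (exists_congr fun l =>
            and_congr_right fun hl => by rw [e2 l hl]))) (Sum.inl (a : G ⧸ H)) y'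
    rcases key.mp (Or.inl rfl) with e | ⟨l, _, hl⟩
    · exact e.symm
    · exact absurd (h _).symm hl
  · have key := hd.eq_of_adj (fun w => w = Sum.inr (a : G ⧸ K) ∨
      ∃ l ∈ K, hd.side (a * l) w ≠ hd.side (a * l) (Sum.inr (a : G ⧸ K))) (fun g => by
        by_cases hg : g⁻¹ * a ∈ K
        · have e1 : (g : G ⧸ K) = a := QuotientGroup.eq.2 hg
          rw [e1]
          refine propext ⟨fun _ => Or.inl rfl,
            fun _ => Or.inr ⟨a⁻¹ * g, by simpa using inv_mem hg, ?_⟩⟩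
          rw [mul_inv_cancel_left, ← e1]
          exact (hd.side_ne_self g).symm
        · have e1 : (g : G ⧸ K) ≠ a := fun e => hg (QuotientGroup.eq.1 e)
          have e2 : ∀ l ∈ K, hd.side (a * l) (Sum.inl (g : G ⧸ H)) =
              hd.side (a * l) (Sum.inr (g : G ⧸ K)) := fun l hl =>
            hd.side_adj_of_notMem _ _ fun hm => hg (by
              have := (Subgroup.mem_inf.1 hm).2
              rwa [← mul_assoc, Subgroup.mul_mem_cancel_right _ hl] at this)
          refine propext (or_congr (by simpa using e1) (exists_congr fun l =>
            and_congr_right fun hl => by rw [e2 l hl]))) (Sum.inr (a : G ⧸ K)) y'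
    rcases key.mp (Or.inl rfl) with e | ⟨l, _, hl⟩
    · exact e.symm
    · exact absurd (h _).symm hl

theorem isHalfspaceSystem : IsHalfspaceSystem G hd.halfspaces where
  smul_mem := by
    rintro g A ⟨x, ε, rfl⟩
    exact ⟨g * x, _, hd.smul_halfspace g x ε⟩
  compl_mem := by
    rintro A ⟨x, ε, rfl⟩
    exact ⟨x, _, hd.halfspace_compl x ε⟩
  nested := by
    rintro A ⟨x, ε, rfl⟩ B ⟨z, δ, rfl⟩
    by_cases h : x⁻¹ * z ∈ H ⊓ K
    · simp only [hd.side_eq_of_mem h]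
      by_cases e : ε = δ
      · exact Or.inl (by rw [e])
      · exact Or.inr (Or.inr (Or.inl fun y hy hy' => e (hy.symm.trans hy')))
    · have key := fun y => hd.side_eq_of_side_ne h y
      by_cases e : ε = hd.side x (Sum.inl (z : G ⧸ H)) <;>
        by_cases e' : δ = hd.side z (Sum.inl (x : G ⧸ H))
      · refine Or.inr (Or.inr (Or.inr fun y hy => ?_))
        exact (key y (e ▸ hy)).trans e'.symm
      · refine Or.inr (Or.inl fun y hy => ?_)
        by_contra hy'
        exact e' (hy.symm.trans (key y (e ▸ hy')))
      · refine Or.inl fun y hy => ?_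
        exact (key y (fun h' => e (hy.symm.trans h'))).trans e'.symm
      · refine Or.inr (Or.inr (Or.inl fun y hy hy' => ?_))
        exact e' (hy'.symm.trans (key y (fun h' => e (hy.symm.trans h'))))
  finite_sep := hd.finite_halfspaces_sep
  sep := by
    intro y y' hy
    by_contra! hc
    refine hy (hd.eq_of_side_eq fun x => ?_)
    exact (hc {w | hd.side x w = hd.side x y} ⟨x, _, rfl⟩ rfl).symm
  edge := by
    rintro A ⟨x, ε, rfl⟩
    have key : ∀ B ∈ hd.halfspaces, B ≠ {y | hd.side x y = ε} → B ≠ {y | hd.side x y = ε}ᶜ →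
        (Sum.inl (x : G ⧸ H) ∈ B ↔ Sum.inr (x : G ⧸ K) ∈ B) := by
      rintro B ⟨z, δ, rfl⟩ h1 h2
      by_cases h : x⁻¹ * z ∈ H ⊓ K
      · rw [hd.halfspace_compl] at h2
        simp only [hd.side_eq_of_mem h] at h1 h2
        have : δ = ε ∨ δ = ε + 1 := by
          clear h1 h2
          revert δ ε
          decide
        rcases this with rfl | rfl
        · exact absurd rfl h1
        · exact absurd rfl h2
      · simp only [Set.mem_ofPred_eq, hd.side_adj_of_notMem z x h]
    by_cases hx : hd.side x (Sum.inl (x : G ⧸ H)) = ε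
    · refine ⟨Sum.inr (x : G ⧸ K), fun h => ?_, Sum.inl (x : G ⧸ H), hx, fun B hB h1 h2 =>
        (key B hB h1 h2).symm⟩
      exact hd.side_ne_self x (h.trans hx.symm)
    · refine ⟨Sum.inl (x : G ⧸ H), hx, Sum.inr (x : G ⧸ K), ?_, key⟩
      have := hd.side_adj_of_mem x x (by simp)
      rw [Set.mem_ofPred_eq, this]
      clear this key
      revert hx
      generalize hd.side x (Sum.inl (x : G ⧸ H)) = a
      revert a ε
      decide
  no_inv := by
    rintro g A ⟨x, ε, rfl⟩ h
    have h' := h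
    rw [hd.halfspace_compl] at h'
    have hx := hd.inv_mul_mem_of_smul_halfspace h'
    have e : g • (Sum.inl (x : G ⧸ H) : (G ⧸ H) ⊕ (G ⧸ K)) = Sum.inl (x : G ⧸ H) := by
      show Sum.inl ((g * x : G) : G ⧸ H) = _
      rw [QuotientGroup.eq.2 (by simpa [mul_assoc] using H.inv_mem hx.1)]
    have := Set.smul_mem_smul_set_iff (a := g) (s := {y | hd.side x y = ε})
      (x := (Sum.inl (x : G ⧸ H) : (G ⧸ H) ⊕ (G ⧸ K)))
    rw [e, h] at this
    simp only [Set.mem_compl_iff] at this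
    tauto

end IsCrossingCocycle

namespace GraphProd

variable {n : ℕ} {m : ℕ → ℕ} {Γ : SimpleGraph (Fin n)}

/-- The generator of the vertex group at `i`. -/
def gen (i : Fin n) : GraphProd m Γ := PresentedGroup.of i

theorem gen_pow (i : Fin n) : (gen i : GraphProd m Γ) ^ m i = 1 := by
  have : (PresentedGroup.mk (graphProdRels m Γ) (FreeGroup.of i ^ m i)) = 1 :=
    PresentedGroup.one_of_mem (Or.inl ⟨i, rfl⟩)
  rwa [map_pow] at this

theorem gen_commute {i j : Fin n} (h : Γ.Adj i j) :
    Commute (gen i : GraphProd m Γ) (gen j) := by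
  have : (PresentedGroup.mk (graphProdRels m Γ)
      (FreeGroup.of i * FreeGroup.of j * (FreeGroup.of i)⁻¹ * (FreeGroup.of j)⁻¹)) = 1 :=
    PresentedGroup.one_of_mem (Or.inr ⟨i, j, h, rfl⟩)
  simp only [map_mul, map_inv] at this
  exact mul_inv_eq_iff_eq_mul.1 (mul_inv_eq_one.1 this)

/-- The universal property of the graph product. -/
def lift {G : Type*} [Group G] (f : Fin n → G) (hpow : ∀ i, f i ^ m i = 1)
    (hcomm : ∀ i j, Γ.Adj i j → Commute (f i) (f j)) : GraphProd m Γ →* G :=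
  PresentedGroup.toGroup (f := f) (by
    rintro r (⟨i, rfl⟩ | ⟨i, j, h, rfl⟩)
    · simpa using hpow i
    · have := (hcomm i j h).eq
      simp [this])

@[simp]
theorem lift_gen {G : Type*} [Group G] (f : Fin n → G) (hpow : ∀ i, f i ^ m i = 1)
    (hcomm : ∀ i j, Γ.Adj i j → Commute (f i) (f j)) (i : Fin n) :
    lift f hpow hcomm (gen i : GraphProd m Γ) = f i :=
  PresentedGroup.toGroup.of _

theorem closure_range_gen :
    Subgroup.closure (Set.range (gen : Fin n → GraphProd m Γ)) = ⊤ :=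
  PresentedGroup.closure_range_of _

/-- The parabolic subgroup generated by the vertex groups in `S`. -/
def par (S : Set (Fin n)) : Subgroup (GraphProd m Γ) := Subgroup.closure (gen '' S)

theorem gen_mem_par {S : Set (Fin n)} {i : Fin n} (h : i ∈ S) :
    (gen i : GraphProd m Γ) ∈ par S :=
  Subgroup.subset_closure ⟨i, h, rfl⟩

theorem par_le_iff {S : Set (Fin n)} {L : Subgroup (GraphProd m Γ)} :
    par S ≤ L ↔ ∀ i ∈ S, gen i ∈ L := by
  simp [par, Subgroup.closure_le, Set.subset_def]

theorem par_mono {S T : Set (Fin n)} (h : S ⊆ T) : (par S : Subgroup (GraphProd m Γ)) ≤ par T :=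
  par_le_iff.2 fun _ hi => gen_mem_par (h hi)

theorem par_univ : (par Set.univ : Subgroup (GraphProd m Γ)) = ⊤ := by
  rw [par, Set.image_univ, closure_range_gen]

theorem hom_eq_of_par {G : Type*} [Group G] {f g : GraphProd m Γ →* G} {S : Set (Fin n)}
    (h : ∀ i ∈ S, f (gen i) = g (gen i)) {t : GraphProd m Γ} (ht : t ∈ par S) : f t = g t := by
  have : par S ≤ f.eqLocus g := par_le_iff.2 h
  exact this ht

theorem hom_ext {G : Type*} [Group G] {f g : GraphProd m Γ →* G}
    (h : ∀ i, f (gen i) = g (gen i)) : f = g :=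
  MonoidHom.ext fun t => hom_eq_of_par (S := Set.univ) (fun i _ => h i)
    (par_univ ▸ Subgroup.mem_top t)

/-- The retraction onto a parabolic subgroup. -/
noncomputable def retr (S : Set (Fin n)) : GraphProd m Γ →* GraphProd m Γ :=
  lift (fun i => if i ∈ S then gen i else 1)
    (fun i => by split_ifs <;> simp [gen_pow])
    (fun i j h => by split_ifs <;> simp [gen_commute h])

theorem retr_gen (S : Set (Fin n)) (i : Fin n) :
    retr S (gen i : GraphProd m Γ) = if i ∈ S then gen i else 1 :=
  lift_gen _ _ _ i

theorem retr_of_mem {S : Set (Fin n)} {t : GraphProd m Γ} (ht : t ∈ par S) : retr S t = t :=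
  hom_eq_of_par (g := MonoidHom.id _) (fun i hi => by simp [retr_gen, hi]) ht

theorem retr_mem_of_mem (S : Set (Fin n)) {T : Set (Fin n)} {t : GraphProd m Γ}
    (ht : t ∈ par T) : retr S t ∈ par (S ∩ T) := by
  have : (par T : Subgroup (GraphProd m Γ)) ≤ (par (S ∩ T)).comap (retr S) := par_le_iff.2 fun i hi => by
    rw [Subgroup.mem_comap, retr_gen]
    split_ifs with h
    · exact gen_mem_par ⟨h, hi⟩
    · exact one_mem _
  exact this ht

theorem retr_mem (S : Set (Fin n)) (t : GraphProd m Γ) : retr S t ∈ par S := by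
  have := retr_mem_of_mem S (T := Set.univ) (t := t) (par_univ ▸ Subgroup.mem_top t)
  rwa [Set.inter_univ] at this

theorem mem_par_inter {S T : Set (Fin n)} {t : GraphProd m Γ} (hS : t ∈ par S) (hT : t ∈ par T) :
    t ∈ par (S ∩ T) := by
  have := retr_mem_of_mem S hT
  rwa [retr_of_mem hS] at this

theorem mem_par_of_forall {S : Set (Fin n)} {t : GraphProd m Γ}
    (h : ∀ w ∉ S, t ∈ par ({w}ᶜ : Set (Fin n))) : t ∈ par S := by
  have key : ∀ T : Finset (Fin n), (∀ w ∈ T, w ∉ S) → t ∈ par (T : Set (Fin n))ᶜ := by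
    intro T
    induction T using Finset.induction_on with
    | empty => intro _; simp [par_univ]
    | insert a T _ ih =>
      intro hT
      have := mem_par_inter (h a (hT a (by simp))) (ih fun w hw => hT w (by simp [hw]))
      refine par_mono ?_ this
      intro x
      simp
  have := key (Finset.univ.filter (· ∉ S)) (by simp)
  exact par_mono (by intro x; simp) this

theorem par_singleton (i : Fin n) :
    (par {i} : Subgroup (GraphProd m Γ)) = Subgroup.zpowers (gen i) := by
  rw [par, Set.image_singleton, Subgroup.zpowers_eq_closure]

theorem par_empty : (par ∅ : Subgroup (GraphProd m Γ)) = ⊥ := by simp [par]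

theorem mem_zpowers_of_forall {v : Fin n} {t : GraphProd m Γ}
    (h : ∀ w, w ≠ v → t ∈ par ({w}ᶜ : Set (Fin n))) : t ∈ Subgroup.zpowers (gen v) := by
  rw [← par_singleton]
  exact mem_par_of_forall fun w hw => h w hw

theorem eq_one_of_forall {t : GraphProd m Γ}
    (h : ∀ w, t ∈ par ({w}ᶜ : Set (Fin n))) : t = 1 := by
  have : t ∈ par ∅ := mem_par_of_forall fun w _ => h w
  simpa [par_empty] using this

/-- The projection onto the vertex group at `s`. -/
noncomputable def coord (s : Fin n) : GraphProd m Γ →* Multiplicative (ZMod (m s)) :=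
  lift (fun i => if i = s then Multiplicative.ofAdd 1 else 1)
    (fun i => by
      split_ifs with h
      · subst h
        rw [← ofAdd_nsmul]
        simp
      · simp)
    (fun i j _ => Commute.all _ _)

theorem coord_gen (s i : Fin n) : coord s (gen i : GraphProd m Γ) =
    if i = s then Multiplicative.ofAdd 1 else 1 :=
  lift_gen _ _ _ i

theorem coord_gen_self (s : Fin n) :
    coord s (gen s : GraphProd m Γ) = Multiplicative.ofAdd 1 := by simp [coord_gen]

theorem coord_of_mem_par {s : Fin n} {S : Set (Fin n)} (hs : s ∉ S) {t : GraphProd m Γ}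
    (ht : t ∈ par S) : coord s t = 1 :=
  hom_eq_of_par (g := 1) (fun i hi => by
    have : i ≠ s := fun h => hs (h ▸ hi)
    simp [coord_gen, this]) ht

theorem coord_gen_self_ne_one (hm : ∀ i, m i ≠ 1) (s : Fin n) :
    coord s (gen s : GraphProd m Γ) ≠ 1 := by
  have : Nontrivial (ZMod (m s)) := ZMod.nontrivial_iff.2 (hm s)
  rw [coord_gen_self, Ne, ofAdd_eq_one]
  exact one_ne_zero

theorem gen_ne_one (hm : ∀ i, m i ≠ 1) (s : Fin n) : (gen s : GraphProd m Γ) ≠ 1 :=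
  fun h => coord_gen_self_ne_one (m := m) (Γ := Γ) hm s (by rw [h, map_one])

theorem gen_notMem_par (hm : ∀ i, m i ≠ 1) {s : Fin n} {S : Set (Fin n)} (hs : s ∉ S) :
    (gen s : GraphProd m Γ) ∉ par S :=
  fun h => coord_gen_self_ne_one hm s (coord_of_mem_par hs h)

theorem coord_gen_zpow (s : Fin n) (k : ℤ) : coord s ((gen s : GraphProd m Γ) ^ k) =
    Multiplicative.ofAdd (k : ZMod (m s)) := by
  rw [map_zpow, coord_gen_self, ← ofAdd_zsmul]
  simp

theorem gen_zpow_congr {s : Fin n} {k l : ℤ} (h : (k : ZMod (m s)) = l) :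
    (gen s : GraphProd m Γ) ^ k = gen s ^ l := by
  rw [ZMod.intCast_eq_intCast_iff_dvd_sub] at h
  obtain ⟨c, hc⟩ := h
  rw [show l = k + m s * c by linarith, zpow_add, zpow_mul, zpow_natCast, gen_pow, one_zpow,
    mul_one]

theorem eq_of_coord_eq {s : Fin n} {t t' : GraphProd m Γ}
    (ht : t ∈ Subgroup.zpowers (gen s)) (ht' : t' ∈ Subgroup.zpowers (gen s))
    (h : coord s t = coord s t') : t = t' := by
  obtain ⟨k, rfl⟩ := ht
  obtain ⟨l, rfl⟩ := ht'
  simp only [coord_gen_zpow] at h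
  exact gen_zpow_congr (Multiplicative.ofAdd.injective h)

/-- The closed star of a vertex. -/
def star (Γ : SimpleGraph (Fin n)) (u : Fin n) : Set (Fin n) := {v | v = u ∨ Γ.Adj u v}

theorem commute_of_mem_star {u : Fin n} {t : GraphProd m Γ} (ht : t ∈ par (star Γ u)) :
    Commute t (gen u) := by
  have : par (star Γ u) ≤ Subgroup.centralizer {(gen u : GraphProd m Γ)} :=
    par_le_iff.2 fun i hi => by
      rw [Subgroup.mem_centralizer_singleton_iff]
      rcases hi with rfl | hi
      · rfl
      · exact (gen_commute hi).symm.eq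
  exact (Subgroup.mem_centralizer_singleton_iff.1 (this ht))

section Cocycle

variable (u : Fin n)

/-- Left translation of functions on a group. -/
def leftTranslate (G : Type*) [Group G] : G →* Equiv.Perm (G → ZMod 2) where
  toFun g :=
    { toFun := fun f x => f (g⁻¹ * x)
      invFun := fun f x => f (g * x)
      left_inv := fun f => by ext x; simp
      right_inv := fun f => by ext x; simp }
  map_one' := by ext f x; simp
  map_mul' g g' := by ext f x; simp [mul_assoc]

theorem leftTranslate_apply {G : Type*} [Group G] (g : G) (f : G → ZMod 2) (x : G) :
    leftTranslate G g f x = f (g⁻¹ * x) := rfl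

/-- Translation by the indicator function of the edge group of the splitting over `u`. -/
noncomputable def shift : Equiv.Perm (GraphProd m Γ → ZMod 2) :=
  Equiv.addRight (edgeIndicator (par {u}ᶜ) (par (star Γ u)))

theorem shift_apply (f : GraphProd m Γ → ZMod 2) (x : GraphProd m Γ) :
    shift u f x = f x + edgeIndicator (par {u}ᶜ) (par (star Γ u)) x := rfl

theorem shift_inv_apply (f : GraphProd m Γ → ZMod 2) (x : GraphProd m Γ) :
    (shift u)⁻¹ f x = f x + edgeIndicator (par {u}ᶜ) (par (star Γ u)) x := by
  have h : (shift u)⁻¹ f = f - edgeIndicator (par {u}ᶜ) (par (star Γ u)) := by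
    rw [Equiv.Perm.inv_eq_iff_eq]
    ext x
    simp [shift_apply]
  rw [h, Pi.sub_apply, CharTwo.sub_eq_add]

theorem shift_commute {v : Fin n} (h : Γ.Adj u v) :
    Commute (shift u) (leftTranslate (GraphProd m Γ) (gen v)) := by
  have hv : (gen v : GraphProd m Γ) ∈ par {u}ᶜ ⊓ par (star Γ u) :=
    ⟨gen_mem_par h.ne', gen_mem_par (Or.inr h)⟩
  ext f x
  simp only [Equiv.Perm.mul_apply, shift_apply, leftTranslate_apply, edgeIndicator,
    Subgroup.mul_mem_cancel_left _ (inv_mem hv)]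

/-- The affine action on functions whose translation part is the crossing cocycle. -/
noncomputable def affine : GraphProd m Γ →* Equiv.Perm (GraphProd m Γ → ZMod 2) :=
  lift (fun v => if v = u then shift u * leftTranslate _ (gen v) * (shift u)⁻¹
      else leftTranslate _ (gen v))
    (fun i => by
      split_ifs
      · rw [conj_pow, ← map_pow, gen_pow, map_one, mul_one, mul_inv_cancel]
      · rw [← map_pow, gen_pow, map_one])
    (fun i j h => by
      have hc : Commute (leftTranslate (GraphProd m Γ) (gen i)) (leftTranslate _ (gen j)) :=
        (gen_commute h).map _
      split_ifs with h1 h2 h2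
      · rw [h1, h2] at h
        exact absurd h (Γ.loopless.irrefl u)
      · subst h1
        have := shift_commute (m := m) i h
        exact (this.mul_left hc).mul_left this.inv_left
      · subst h2
        have := shift_commute (m := m) j h.symm
        exact ((this.mul_left hc.symm).mul_left this.inv_left).symm
      · exact hc)

theorem affine_of_mem_compl {t : GraphProd m Γ} (ht : t ∈ par ({u}ᶜ : Set (Fin n))) :
    affine u t = leftTranslate _ t :=
  hom_eq_of_par (fun i hi => by
    rw [affine, lift_gen, if_neg (show i ≠ u from hi)]) ht

theorem affine_of_mem_star {t : GraphProd m Γ} (ht : t ∈ par (star Γ u)) :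
    affine u t = shift u * leftTranslate _ t * (shift u)⁻¹ :=
  hom_eq_of_par (g := (MulAut.conj (shift u)).toMonoidHom.comp (leftTranslate _))
    (fun i hi => by
      rw [affine, lift_gen]
      split_ifs with h
      · simp
      · have := (shift_commute (m := m) u (hi.resolve_left h)).eq
        simp [this]) ht

theorem affine_add (t : GraphProd m Γ) : ∀ f f' : GraphProd m Γ → ZMod 2,
    affine u t (f + f') = leftTranslate _ t f + affine u t f' := by
  have ht : t ∈ Subgroup.closure (Set.range (gen : Fin n → GraphProd m Γ)) :=
    closure_range_gen ▸ Subgroup.mem_top t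
  induction ht using Subgroup.closure_induction with
  | mem x hx =>
    obtain ⟨i, rfl⟩ := hx
    intro f f'
    by_cases h : i = u
    · rw [affine_of_mem_star u (gen_mem_par (Or.inl h))]
      ext x
      simp only [Equiv.Perm.mul_apply, shift_apply, leftTranslate_apply, shift_inv_apply,
        Pi.add_apply]
      ring
    · rw [affine_of_mem_compl u (gen_mem_par h)]
      rfl
  | one => simp
  | mul a b _ _ ha hb =>
    intro f f'
    simp only [map_mul, Equiv.Perm.mul_apply, hb, ha]
  | inv a _ ha =>
    intro f f'
    rw [map_inv, Equiv.Perm.inv_eq_iff_eq, ha, map_inv]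
    simp

theorem isCrossingCocycle : IsCrossingCocycle (par ({u}ᶜ : Set (Fin n)))
    (par (star Γ u) : Subgroup (GraphProd m Γ)) (fun t => affine u t 0) := by
  have hmul : ∀ g g' x : GraphProd m Γ, affine u (g * g') 0 x =
      affine u g 0 x + affine u g' 0 (g⁻¹ * x) := by
    intro g g' x
    rw [map_mul, Equiv.Perm.mul_apply]
    nth_rewrite 1 [← add_zero (affine u g' 0)]
    rw [affine_add, Pi.add_apply, leftTranslate_apply, add_comm]
  have hright : ∀ k ∈ par (star Γ u), ∀ x : GraphProd m Γ, affine u k 0 x =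
      edgeIndicator (par {u}ᶜ) (par (star Γ u)) (k⁻¹ * x) +
        edgeIndicator (par {u}ᶜ) (par (star Γ u)) x := by
    intro k hk x
    rw [affine_of_mem_star u hk]
    simp only [Equiv.Perm.mul_apply, shift_apply, leftTranslate_apply, shift_inv_apply,
      Pi.zero_apply, zero_add]
  refine ⟨hmul, fun h hh x => ?_, hright, fun g => ?_, ?_⟩
  · rw [affine_of_mem_compl u hh]
    rfl
  · have ht : g ∈ Subgroup.closure (Set.range (gen : Fin n → GraphProd m Γ)) :=
      closure_range_gen ▸ Subgroup.mem_top g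
    induction ht using Subgroup.closure_induction with
    | mem x hx =>
      obtain ⟨i, rfl⟩ := hx
      intro x l hl
      by_cases h : i = u
      · rw [hright _ (gen_mem_par (Or.inl h)), hright _ (gen_mem_par (Or.inl h))]
        simp only [edgeIndicator, ← mul_assoc, Subgroup.mul_mem_cancel_right _ hl]
      · rw [affine_of_mem_compl u (gen_mem_par h)]
        rfl
    | one => simp
    | mul a b _ _ ha hb =>
      intro x l hl
      rw [hmul, hmul, ha x l hl, ← mul_assoc, hb _ l hl]
    | inv a _ ha =>
      intro x l hl
      have h1 : ∀ x, affine u a⁻¹ (0 : GraphProd m Γ → ZMod 2) x = affine u a 0 (a * x) := by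
        intro x
        have := hmul a a⁻¹ (a * x)
        rw [mul_inv_cancel, inv_mul_cancel_left, map_one] at this
        exact (CharTwo.add_eq_zero.1 this.symm).symm
      rw [h1, h1, ← mul_assoc, ha _ l hl]
  · rw [eq_top_iff, ← par_univ, par_le_iff]
    intro i _
    by_cases h : i = u
    · exact Subgroup.mem_sup_right (gen_mem_par (Or.inl h))
    · exact Subgroup.mem_sup_left (gen_mem_par h)

end Cocycle

end GraphProd

/-- An extension property of graphs: any two vertices can be separated from any three others by
the neighbourhood of some vertex. -/
structure IsGeneric {n : ℕ} (Γ : SimpleGraph (Fin n)) : Prop where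
  card : 4 ≤ n
  ext : ∀ (a : Fin 2 → Fin n) (b : Fin 3 → Fin n), (∀ i j, a i ≠ b j) →
    ∃ x, (∀ i, Γ.Adj x (a i)) ∧ ∀ j, x ≠ b j ∧ ¬ Γ.Adj x (b j)

namespace IsGeneric

variable {n : ℕ} {Γ : SimpleGraph (Fin n)}

theorem exists_common_neighbor (h : IsGeneric Γ) {v w u : Fin n} (hv : v ≠ u) (hw : w ≠ u) :
    ∃ x, Γ.Adj x v ∧ Γ.Adj x w ∧ x ≠ u ∧ ¬ Γ.Adj x u := by
  obtain ⟨x, hx, hx'⟩ := h.ext ![v, w] ![u, u, u] (by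
    simp [Fin.forall_fin_succ, hv, hw])
  exact ⟨x, hx 0, hx 1, (hx' 0).1, (hx' 0).2⟩

theorem exists_ne_not_adj (h : IsGeneric Γ) (a b u : Fin n) :
    ∃ x, x ≠ a ∧ x ≠ b ∧ x ≠ u ∧ ¬ Γ.Adj x u := by
  obtain ⟨w, hw⟩ : ∃ w, w ∉ ({a, b, u} : Finset (Fin n)) := by
    by_contra! hc
    have h1 := Finset.card_le_card (fun w _ => hc w : (Finset.univ : Finset (Fin n)) ⊆ _)
    have h2 : ({a, b, u} : Finset (Fin n)).card ≤ 3 := Finset.card_le_three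
    have h3 := h.card
    rw [Finset.card_univ, Fintype.card_fin] at h1
    omega
  simp only [Finset.mem_insert, Finset.mem_singleton, not_or] at hw
  obtain ⟨x, -, hx'⟩ := h.ext ![w, w] ![a, b, u] (by
    simp [Fin.forall_fin_succ, hw])
  exact ⟨x, (hx' 0).1, (hx' 1).1, (hx' 2).1, (hx' 2).2⟩

theorem exists_neighbors (h : IsGeneric Γ) {v u : Fin n} (hv : v ≠ u) :
    ∃ a b, Γ.Adj a v ∧ Γ.Adj b v ∧ b ≠ a ∧ ¬ Γ.Adj b a ∧ a ≠ u ∧ b ≠ u ∧ ¬ Γ.Adj a u := by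
  obtain ⟨a, ha, -, hau, ha'⟩ := h.exists_common_neighbor hv hv
  obtain ⟨b, hb, hb'⟩ := h.ext ![v, v] ![a, u, u] (by
    simp [Fin.forall_fin_succ, hv, ha.ne'])
  exact ⟨a, b, ha, hb 0, (hb' 0).1, (hb' 0).2, hau, (hb' 1).1, ha'⟩

end IsGeneric

namespace GraphProd

variable {n : ℕ} {m : ℕ → ℕ} {Γ : SimpleGraph (Fin n)}

/-- The vertices of the Bass-Serre tree of the splitting of the graph product over `u`. -/
abbrev Vert (m : ℕ → ℕ) (Γ : SimpleGraph (Fin n)) (u : Fin n) : Type :=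
  (GraphProd m Γ ⧸ (par {u}ᶜ : Subgroup (GraphProd m Γ))) ⊕
    (GraphProd m Γ ⧸ (par (star Γ u) : Subgroup (GraphProd m Γ)))

/-- The halfspaces of the Bass-Serre tree of the splitting of the graph product over `u`. -/
noncomputable def halfspaces (m : ℕ → ℕ) (Γ : SimpleGraph (Fin n)) (u : Fin n) :
    Set (Set (Vert m Γ u)) :=
  (isCrossingCocycle u).halfspaces

theorem isHalfspaceSystem (u : Fin n) : IsHalfspaceSystem (GraphProd m Γ) (halfspaces m Γ u) :=
  (isCrossingCocycle u).isHalfspaceSystem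

theorem exists_edge {u : Fin n} {A : Set (Vert m Γ u)} (hA : A ∈ halfspaces m Γ u) :
    ∃ x : GraphProd m Γ, ∀ g : GraphProd m Γ, g • A = A →
      x⁻¹ * g * x ∈ (par {u}ᶜ ⊓ par (star Γ u) : Subgroup (GraphProd m Γ)) :=
  (isCrossingCocycle u).exists_edge hA

theorem smul_inl_iff {u : Fin n} (g x : GraphProd m Γ) :
    g • (Sum.inl (x : GraphProd m Γ ⧸ par {u}ᶜ) : Vert m Γ u) = Sum.inl (QuotientGroup.mk x) ↔
      x⁻¹ * g * x ∈ (par {u}ᶜ : Subgroup (GraphProd m Γ)) := by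
  show (Sum.inl (QuotientGroup.mk (g * x)) : Vert m Γ u) = _ ↔ _
  rw [Sum.inl.injEq, eq_comm, QuotientGroup.eq, mul_assoc]

theorem smul_inr_iff {u : Fin n} (g x : GraphProd m Γ) :
    g • (Sum.inr (x : GraphProd m Γ ⧸ par (star Γ u)) : Vert m Γ u) = Sum.inr (QuotientGroup.mk x) ↔
      x⁻¹ * g * x ∈ (par (star Γ u) : Subgroup (GraphProd m Γ)) := by
  show (Sum.inr (QuotientGroup.mk (g * x)) : Vert m Γ u) = _ ↔ _
  rw [Sum.inr.injEq, eq_comm, QuotientGroup.eq, mul_assoc]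

theorem commute_conj_gen {u : Fin n} {g x : GraphProd m Γ}
    (h : x⁻¹ * g * x ∈ (par (star Γ u) : Subgroup (GraphProd m Γ))) :
    Commute (x * gen u * x⁻¹) g := by
  have := (commute_of_mem_star h).symm.map (MulAut.conj x)
  simpa [mul_assoc] using this

theorem exists_of_commute {u : Fin n} {z s : GraphProd m Γ}
    (hs : s ∈ (par {u}ᶜ : Subgroup (GraphProd m Γ))) (hc : Commute z s)
    (hz : z ∉ (par {u}ᶜ : Subgroup (GraphProd m Γ))) :
    ∃ x, x⁻¹ * s * x ∈ (par (star Γ u) : Subgroup (GraphProd m Γ)) := by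
  have hne : (Sum.inl ((1 : GraphProd m Γ) : GraphProd m Γ ⧸ par {u}ᶜ) : Vert m Γ u) ≠
      Sum.inl (QuotientGroup.mk z) := by
    rw [Ne, Sum.inl.injEq, QuotientGroup.eq]
    simpa using hz
  obtain ⟨A, hA, h⟩ := (isHalfspaceSystem u).exists_fixed_of_ne hne
  obtain ⟨x, hx⟩ := exists_edge hA
  refine ⟨x, (Subgroup.mem_inf.1 (hx s (h s ?_ ?_))).2⟩
  · rw [smul_inl_iff]
    simpa using hs
  · rw [smul_inl_iff, mul_assoc, ← hc.eq, inv_mul_cancel_left]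
    exact hs

theorem coord_conj (s : Fin n) (x g : GraphProd m Γ) : coord s (x * g * x⁻¹) = coord s g := by
  rw [map_mul, map_mul, mul_right_comm, map_inv, mul_inv_cancel, one_mul]

theorem coord_conj' (s : Fin n) (x g : GraphProd m Γ) : coord s (x⁻¹ * g * x) = coord s g := by
  rw [map_mul, map_mul, mul_right_comm, map_inv, inv_mul_cancel, one_mul]

/-- An element commuting with a generator that does not commute with `gen u` avoids `u`. -/
theorem mem_par_of_commute_gen (hm : ∀ i, m i ≠ 1) {u s : Fin n} (hs : s ≠ u)
    (hsu : ¬ Γ.Adj s u) {z : GraphProd m Γ} (hz : Commute z (gen s)) :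
    z ∈ (par {u}ᶜ : Subgroup (GraphProd m Γ)) := by
  by_contra hc
  obtain ⟨x, hx⟩ := exists_of_commute (gen_mem_par hs) hz hc
  have hstar : s ∉ star Γ u := by
    rintro (h | h)
    · exact hs h
    · exact hsu h.symm
  have := coord_of_mem_par hstar hx
  rw [coord_conj'] at this
  exact coord_gen_self_ne_one hm s this

theorem commutator_gen_ne_one (hm : ∀ i, m i ≠ 1) {a b : Fin n} (hab : b ≠ a)
    (hadj : ¬ Γ.Adj b a) :
    (gen a * gen b * (gen a)⁻¹ * (gen b)⁻¹ : GraphProd m Γ) ≠ 1 := by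
  intro h
  have hc : Commute (gen a : GraphProd m Γ) (gen b) :=
    mul_inv_eq_iff_eq_mul.1 (mul_inv_eq_one.1 h)
  exact gen_notMem_par hm (by simp) (mem_par_of_commute_gen hm hab hadj hc)

theorem mem_par_of_commute_commutator (hm : ∀ i, m i ≠ 1) {u a b : Fin n} (hau : a ≠ u)
    (hbu : b ≠ u) (hadj : ¬ Γ.Adj a u) (hab : b ≠ a) (habadj : ¬ Γ.Adj b a)
    {z : GraphProd m Γ} (hz : Commute z (gen a * gen b * (gen a)⁻¹ * (gen b)⁻¹)) :
    z ∈ (par {u}ᶜ : Subgroup (GraphProd m Γ)) := by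
  by_contra hc
  have ha : (gen a : GraphProd m Γ) ∈ par {u}ᶜ := gen_mem_par hau
  have hb : (gen b : GraphProd m Γ) ∈ par {u}ᶜ := gen_mem_par hbu
  obtain ⟨x, hx⟩ := exists_of_commute
    (mul_mem (mul_mem (mul_mem ha hb) (inv_mem ha)) (inv_mem hb)) hz hc
  have hstar : star Γ u ⊆ {a}ᶜ := by
    rintro v (h | h) (rfl : v = a)
    · exact hau h
    · exact hadj h.symm
  have h1 := retr_of_mem (par_mono hstar hx)
  have h2 : retr {a}ᶜ (gen a * gen b * (gen a)⁻¹ * (gen b)⁻¹ : GraphProd m Γ) = 1 := by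
    simp [retr_gen, hab]
  rw [map_mul, map_mul, h2, mul_one, ← map_mul, inv_mul_cancel, map_one, eq_comm,
    mul_assoc, inv_mul_eq_one, right_eq_mul] at h1
  exact commutator_gen_ne_one hm hab habadj h1

theorem mem_zpowers_of_commute_commutator (hm : ∀ i, m i ≠ 1) (hΓ : IsGeneric Γ) {v : Fin n}
    {t : GraphProd m Γ} (ht : ∀ a b, Γ.Adj a v → Γ.Adj b v →
      Commute t (gen a * gen b * (gen a)⁻¹ * (gen b)⁻¹)) : t ∈ Subgroup.zpowers (gen v) := by
  refine mem_zpowers_of_forall fun w hw => ?_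
  obtain ⟨a, b, ha, hb, hab, hab', hau, hbu, hadj⟩ := hΓ.exists_neighbors hw.symm
  exact mem_par_of_commute_commutator hm hau hbu hadj hab hab' (ht a b ha hb)

theorem eq_one_of_commute (hm : ∀ i, m i ≠ 1) (hΓ : IsGeneric Γ) (u w : Fin n)
    {t : GraphProd m Γ} (ht : ∀ v, v ≠ u → v ≠ w → Commute t (gen v)) : t = 1 := by
  refine eq_one_of_forall fun s => ?_
  obtain ⟨x, hxu, hxw, hxs, hadj⟩ := hΓ.exists_ne_not_adj u w s
  exact mem_par_of_commute_gen hm hxs hadj (ht x hxu hxw)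

end GraphProd

namespace GraphProd

variable {n : ℕ} {m : ℕ → ℕ} {Γ : SimpleGraph (Fin n)}

theorem commute_symm_of_commute (φ : MulAut (GraphProd m Γ)) {a b : GraphProd m Γ}
    (h : Commute a (φ b)) : Commute (φ.symm a) b := by
  simpa using h.map φ.symm

theorem eq_one_of_commute_image (hm : ∀ i, m i ≠ 1) (hΓ : IsGeneric Γ)
    (φ : MulAut (GraphProd m Γ)) (u w : Fin n) {t : GraphProd m Γ}
    (ht : ∀ v, v ≠ u → v ≠ w → Commute t (φ (gen v))) : t = 1 := by
  have := eq_one_of_commute hm hΓ u w (t := φ.symm t) fun v hu hw =>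
    commute_symm_of_commute φ (ht v hu hw)
  simpa using this

theorem conj_gen_ne_one (hm : ∀ i, m i ≠ 1) (u : Fin n) (x : GraphProd m Γ) :
    x * gen u * x⁻¹ ≠ 1 := by
  rw [Ne, conj_eq_one_iff]
  exact gen_ne_one hm u

/-- Images of the generators are elliptic on each tree. -/
theorem isElliptic_image (hm : ∀ i, m i ≠ 1) (hΓ : IsGeneric Γ) (φ : MulAut (GraphProd m Γ))
    (u v : Fin n) : IsElliptic (halfspaces m Γ u) (φ (gen v)) := by
  by_contra hne
  obtain ⟨A, hA, h⟩ := (isHalfspaceSystem u).exists_fixed_of_hyperbolic hne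
  obtain ⟨x, hx⟩ := exists_edge hA
  obtain ⟨k, hk⟩ := mem_zpowers_of_commute_commutator hm hΓ (v := v)
    (t := φ.symm (x * gen u * x⁻¹)) (fun a b ha hb => by
      refine commute_symm_of_commute φ (commute_conj_gen
        (Subgroup.mem_inf.1 (hx _ ?_)).2)
      simp only [map_mul, map_inv]
      exact h _ _ ((gen_commute ha.symm).map φ).eq ((gen_commute hb.symm).map φ).eq)
  have hk' : φ (gen v) ^ k = x * gen u * x⁻¹ := by
    have : φ (gen v ^ k) = φ (φ.symm (x * gen u * x⁻¹)) := congrArg φ hk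
    simpa using this
  have hk0 : k ≠ 0 := by
    rintro rfl
    exact conj_gen_ne_one hm u x (by simpa using hk'.symm)
  obtain ⟨B, hB, hsub⟩ : ∃ B ∈ halfspaces m Γ u, φ (gen v) • B ⊂ B := by
    simpa [IsElliptic] using hne
  refine (isHalfspaceSystem u).not_isElliptic_zpow hB hsub hk0 ?_
  rw [hk']
  refine (isHalfspaceSystem u).isElliptic_of_fixed (y := Sum.inr (QuotientGroup.mk x)) ?_
  rw [smul_inr_iff]
  simpa [mul_assoc] using gen_mem_par (Or.inl rfl : u ∈ star Γ u)

theorem commute_of_fixed {u : Fin n} {A : Set (Vert m Γ u)} (hA : A ∈ halfspaces m Γ u) :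
    ∃ x : GraphProd m Γ, ∀ g : GraphProd m Γ, g • A = A → Commute (x * gen u * x⁻¹) g := by
  obtain ⟨x, hx⟩ := exists_edge hA
  exact ⟨x, fun g hg => commute_conj_gen (Subgroup.mem_inf.1 (hx g hg)).2⟩

/-- Some halfspace separates the fixed points of the images of two generators. -/
theorem exists_opposite (hm : ∀ i, m i ≠ 1) (hΓ : IsGeneric Γ) (φ : MulAut (GraphProd m Γ))
    (u : Fin n) : ∃ A ∈ halfspaces m Γ u, ∃ l r : Fin n,
      LivesIn (φ (gen l)) A ∧ LivesIn (φ (gen r)) Aᶜ := by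
  by_contra! hc
  have : Nonempty (Vert m Γ u) := ⟨Sum.inl (QuotientGroup.mk 1)⟩
  obtain ⟨y, hy⟩ := (isHalfspaceSystem u).exists_common_fixed (fun v : Fin n => φ (gen v))
    (isElliptic_image hm hΓ φ u) (fun A hA hfix => by
      obtain ⟨x, hx⟩ := commute_of_fixed hA
      exact conj_gen_ne_one hm u x
        (eq_one_of_commute_image hm hΓ φ u u fun v _ _ => hx _ (hfix v)))
    (fun A hA i j hi hj => hc A hA i j hi hj)
  have hall : ∀ g : GraphProd m Γ, g • y = y := by
    have h1 : par Set.univ ≤ (MulAction.stabilizer (GraphProd m Γ) y).comap φ.toMonoidHom :=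
      par_le_iff.2 fun i _ => hy i
    intro g
    have h2 : φ.symm g ∈ par Set.univ := par_univ ▸ Subgroup.mem_top _
    have h3 : φ (φ.symm g) • y = y := h1 h2
    rwa [MulEquiv.apply_symm_apply] at h3
  rcases y with y | y <;> induction y using QuotientGroup.induction_on with | H x => ?_
  · have := (smul_inl_iff _ _).1 (hall (x * gen u * x⁻¹))
    exact gen_notMem_par hm (by simp : u ∉ ({u}ᶜ : Set (Fin n))) (by simpa [mul_assoc] using this)
  · obtain ⟨s, -, -, hsu, hadj⟩ := hΓ.exists_ne_not_adj u u u
    have := (smul_inr_iff _ _).1 (hall (x * gen s * x⁻¹))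
    have hstar : s ∉ star Γ u := by
      rintro (h | h)
      · exact hsu h
      · exact hadj h.symm
    exact gen_notMem_par hm hstar (by simpa [mul_assoc] using this)

/-- A conjugate of `gen u` is a power of the image of a generator, and this generator occurs in
every pair separated by a given halfspace. -/
theorem exists_zpow_eq_conj (hm : ∀ i, m i ≠ 1) (hΓ : IsGeneric Γ) (φ : MulAut (GraphProd m Γ))
    {u : Fin n} {A : Set (Vert m Γ u)} (hA : A ∈ halfspaces m Γ u) {l r : Fin n}
    (hl : LivesIn (φ (gen l)) A) (hr : LivesIn (φ (gen r)) Aᶜ) :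
    ∃ v, (v = l ∨ v = r) ∧ ∃ (k : ℤ) (x : GraphProd m Γ),
      φ (gen v) ^ k = x * gen u * x⁻¹ := by
  have hsys := isHalfspaceSystem (m := m) (Γ := Γ) u
  obtain ⟨x, hx⟩ := commute_of_fixed hA
  set t := φ.symm (x * gen u * x⁻¹) with ht
  have hcomm : ∀ i j, Γ.Adj i j → φ (gen i) * φ (gen j) = φ (gen j) * φ (gen i) :=
    fun i j h => ((gen_commute h).map φ).eq
  have hmem : ∀ l r, LivesIn (φ (gen l)) A → LivesIn (φ (gen r)) Aᶜ → ∀ w, w ≠ l → w ≠ r →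
      t ∈ par ({w}ᶜ : Set (Fin n)) := by
    intro l r hl hr w hwl hwr
    obtain ⟨s, hsl, hsr, hsw, hadj⟩ := hΓ.exists_common_neighbor hwl.symm hwr.symm
    refine mem_par_of_commute_gen hm hsw hadj (commute_symm_of_commute φ (hx _ ?_))
    rcases hsys.trichotomy (isElliptic_image hm hΓ φ u s) hA with h | h | h
    · exact h
    · exact (hsys.not_livesIn_opposite hA (hcomm _ _ hsr) h hr).elim
    · exact (hsys.not_livesIn_opposite hA (hcomm _ _ hsl.symm) hl h).elim
  have hlr : l ≠ r := by
    rintro rfl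
    exact hsys.not_livesIn_both hA hl hr
  have hor : t ∈ par ({l}ᶜ : Set (Fin n)) ∨ t ∈ par ({r}ᶜ : Set (Fin n)) := by
    by_contra! hc
    obtain ⟨s, hsl, hsr, -, hadj⟩ := hΓ.exists_ne_not_adj l r l
    refine hc.1 (mem_par_of_commute_gen hm hsl hadj (commute_symm_of_commute φ (hx _ ?_)))
    rcases hsys.trichotomy (isElliptic_image hm hΓ φ u s) hA with h | h | h
    · exact h
    · exact (hc.1 (hmem s r h hr l hsl.symm hlr)).elim
    · exact (hc.2 (hmem l s hl h r hlr.symm hsr.symm)).elim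
  have key : ∀ v, t ∈ Subgroup.zpowers (gen v) → ∃ (k : ℤ) (x : GraphProd m Γ),
      φ (gen v) ^ k = x * gen u * x⁻¹ := by
    rintro v ⟨k, hk⟩
    refine ⟨k, x, ?_⟩
    have : φ (gen v ^ k) = φ t := congrArg φ hk
    simpa [ht] using this
  rcases hor with h | h
  · refine ⟨r, Or.inr rfl, key r (mem_zpowers_of_forall fun w hw => ?_)⟩
    by_cases hwl : w = l
    · exact hwl ▸ h
    · exact hmem l r hl hr w hwl hw
  · refine ⟨l, Or.inl rfl, key l (mem_zpowers_of_forall fun w hw => ?_)⟩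
    by_cases hwr : w = r
    · exact hwr ▸ h
    · exact hmem l r hl hr w hw hwr

/-- Every automorphism maps each generator to a conjugate of a power of a generator. -/
theorem exists_image_eq_conj (hm : ∀ i, m i ≠ 1) (hΓ : IsGeneric Γ)
    (φ : MulAut (GraphProd m Γ)) (u : Fin n) :
    ∃ (w : Fin n) (k : ℤ) (x : GraphProd m Γ), φ (gen u) = x * gen w ^ k * x⁻¹ := by
  obtain ⟨A, hA, l, r, hl, hr⟩ := exists_opposite hm hΓ φ.symm u
  obtain ⟨v, -, k, x, h⟩ := exists_zpow_eq_conj hm hΓ φ.symm hA hl hr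
  refine ⟨v, k, (φ x)⁻¹, ?_⟩
  have := congrArg φ h
  rw [map_zpow, MulEquiv.apply_symm_apply, map_mul, map_mul, map_inv] at this
  rw [this]
  group

/-- For an automorphism mapping each generator to a conjugate, the images of all generators but
one lie in a common conjugate of the corresponding parabolic subgroup. -/
theorem exists_conj_mem_par (hm : ∀ i, m i ≠ 1) (hΓ : IsGeneric Γ)
    {φ : MulAut (GraphProd m Γ)} (hφ : ∀ v, ∃ x, φ (gen v) = x * gen v * x⁻¹) (u : Fin n) :
    ∃ y : GraphProd m Γ, ∀ v, v ≠ u →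
      y⁻¹ * φ (gen v) * y ∈ (par {u}ᶜ : Subgroup (GraphProd m Γ)) := by
  have : Nonempty (Vert m Γ u) := ⟨Sum.inl (QuotientGroup.mk 1)⟩
  obtain ⟨y, hy⟩ := (isHalfspaceSystem u).exists_common_fixed
    (fun v : {v : Fin n // v ≠ u} => φ (gen v.1))
    (fun v => isElliptic_image hm hΓ φ u v) (fun A hA hfix => by
      obtain ⟨x, hx⟩ := commute_of_fixed hA
      exact conj_gen_ne_one hm u x
        (eq_one_of_commute_image hm hΓ φ u u fun v hv _ => hx _ (hfix ⟨v, hv⟩)))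
    (fun A hA i j hi hj => by
      obtain ⟨v, hv, k, x, h⟩ := exists_zpow_eq_conj hm hΓ φ hA hi hj
      have hvu : v ≠ u := by
        rcases hv with rfl | rfl
        · exact i.2
        · exact j.2
      obtain ⟨z, hz⟩ := hφ v
      have := congrArg (coord u) h
      rw [hz, map_zpow, coord_conj, coord_conj, coord_gen, if_neg hvu, one_zpow] at this
      exact coord_gen_self_ne_one hm u this.symm)
  rcases y with y | y <;> induction y using QuotientGroup.induction_on with | H x => ?_
  · exact ⟨x, fun v hv => (smul_inl_iff _ _).1 (hy ⟨v, hv⟩)⟩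
  · refine (conj_gen_ne_one hm u x (eq_one_of_commute_image hm hΓ φ u u fun v hv _ => ?_)).elim
    exact commute_conj_gen ((smul_inr_iff _ _).1 (hy ⟨v, hv⟩))

/-- The cosets of parabolic subgroups found in `exists_conj_mem_par` intersect in pairs. -/
theorem exists_mem_cosets (hm : ∀ i, m i ≠ 1) (hΓ : IsGeneric Γ) (φ : MulAut (GraphProd m Γ))
    {u w : Fin n} {y z : GraphProd m Γ}
    (hy : ∀ v, v ≠ u → y⁻¹ * φ (gen v) * y ∈ (par {u}ᶜ : Subgroup (GraphProd m Γ)))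
    (hz : ∀ v, v ≠ w → z⁻¹ * φ (gen v) * z ∈ (par {w}ᶜ : Subgroup (GraphProd m Γ))) :
    ∃ g : GraphProd m Γ, y⁻¹ * g ∈ (par {u}ᶜ : Subgroup (GraphProd m Γ)) ∧
      z⁻¹ * g ∈ (par {w}ᶜ : Subgroup (GraphProd m Γ)) := by
  set c := y⁻¹ * z with hc
  set ρ : GraphProd m Γ →* GraphProd m Γ := retr {u}ᶜ with hρ
  have hfix : ∀ v, v ≠ w → c⁻¹ * (y⁻¹ * φ (gen v) * y) * c ∈
      (par {w}ᶜ : Subgroup (GraphProd m Γ)) := by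
    intro v hv
    convert hz v hv using 1
    rw [hc]
    group
  have hfix' : ∀ v, v ≠ u → v ≠ w → (ρ c)⁻¹ * (y⁻¹ * φ (gen v) * y) * ρ c ∈
      (par {w}ᶜ : Subgroup (GraphProd m Γ)) := by
    intro v hu hw
    have := par_mono Set.inter_subset_right (retr_mem_of_mem {u}ᶜ (hfix v hw))
    rwa [map_mul, map_mul, retr_of_mem (hy v hu), map_inv] at this
  by_cases hcc : c⁻¹ * ρ c ∈ (par {w}ᶜ : Subgroup (GraphProd m Γ))
  · refine ⟨y * ρ c, by simpa using retr_mem _ _, ?_⟩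
    convert hcc using 1
    rw [hc]
    group
  · exfalso
    have hne : (Sum.inl (QuotientGroup.mk c) : Vert m Γ w) ≠ Sum.inl (QuotientGroup.mk (ρ c)) := by
      rw [Ne, Sum.inl.injEq, QuotientGroup.eq]
      exact hcc
    obtain ⟨A, hA, h⟩ := (isHalfspaceSystem w).exists_fixed_of_ne hne
    obtain ⟨x, hx⟩ := commute_of_fixed hA
    have h1 := eq_one_of_commute_image hm hΓ φ u w (t := y * (x * gen w * x⁻¹) * y⁻¹)
      (fun v hu hw => by
        have := (hx _ (h (y⁻¹ * φ (gen v) * y) ((smul_inl_iff _ _).2 (hfix v hw))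
          ((smul_inl_iff _ _).2 (hfix' v hu hw)))).map (MulAut.conj y)
        simpa [mul_assoc] using this)
    rw [conj_eq_one_iff] at h1
    exact conj_gen_ne_one hm w x h1

/-- The Helly property for cosets of maximal parabolic subgroups. -/
theorem exists_mem_all_cosets {y : Fin n → GraphProd m Γ}
    (h : ∀ u w, ∃ g : GraphProd m Γ, (y u)⁻¹ * g ∈ (par {u}ᶜ : Subgroup (GraphProd m Γ)) ∧
      (y w)⁻¹ * g ∈ (par {w}ᶜ : Subgroup (GraphProd m Γ))) :
    ∃ g : GraphProd m Γ, ∀ u, (y u)⁻¹ * g ∈ (par {u}ᶜ : Subgroup (GraphProd m Γ)) := by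
  have key : ∀ T : Finset (Fin n), ∃ g : GraphProd m Γ, ∀ u ∈ T,
      (y u)⁻¹ * g ∈ (par {u}ᶜ : Subgroup (GraphProd m Γ)) := by
    intro T
    induction T using Finset.induction_on with
    | empty => exact ⟨1, by simp⟩
    | insert w T _ ih =>
      obtain ⟨z, hz⟩ := ih
      have inner : ∀ T' : Finset (Fin n), T' ⊆ T → ∃ g : GraphProd m Γ,
          (∀ u ∈ T', g ∈ (par {u}ᶜ : Subgroup (GraphProd m Γ))) ∧
            (y w)⁻¹ * (z * g) ∈ (par {w}ᶜ : Subgroup (GraphProd m Γ)) := by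
        intro T'
        induction T' using Finset.induction_on with
        | empty => exact fun _ => ⟨z⁻¹ * y w, by simp, by simp⟩
        | insert u T' _ ih' =>
          intro hT
          obtain ⟨g, hg, hgw⟩ := ih' fun a ha => hT (Finset.mem_insert_of_mem ha)
          obtain ⟨b, hbu, hbw⟩ := h u w
          have hb : z⁻¹ * b ∈ (par {u}ᶜ : Subgroup (GraphProd m Γ)) := by
            have := mul_mem (inv_mem (hz u (hT (Finset.mem_insert_self _ _)))) hbu
            simpa [mul_assoc] using this
          have hgb : (z⁻¹ * b)⁻¹ * g ∈ (par {w}ᶜ : Subgroup (GraphProd m Γ)) := by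
            have := mul_mem (inv_mem hbw) hgw
            simpa [mul_assoc] using this
          refine ⟨retr {u}ᶜ g, fun a ha => ?_, ?_⟩
          · rcases Finset.mem_insert.1 ha with rfl | ha
            · exact retr_mem _ _
            · exact par_mono Set.inter_subset_right (retr_mem_of_mem _ (hg a ha))
          · have h1 := par_mono Set.inter_subset_right (retr_mem_of_mem {u}ᶜ hgb)
            rw [map_mul, map_inv, retr_of_mem hb] at h1
            have := mul_mem hbw h1
            simpa [mul_assoc] using this
      obtain ⟨g, hg, hgw⟩ := inner T subset_rfl
      refine ⟨z * g, fun u hu => ?_⟩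
      rcases Finset.mem_insert.1 hu with rfl | hu
      · exact hgw
      · have := mul_mem (hz u hu) (hg u hu)
        simpa [mul_assoc] using this
  obtain ⟨g, hg⟩ := key Finset.univ
  exact ⟨g, fun u => hg u (Finset.mem_univ u)⟩

/-- An automorphism mapping each generator to a conjugate is inner. -/
theorem mem_range_conj (hm : ∀ i, m i ≠ 1) (hΓ : IsGeneric Γ)
    {φ : MulAut (GraphProd m Γ)} (hφ : ∀ v, ∃ x, φ (gen v) = x * gen v * x⁻¹) :
    φ ∈ (MulAut.conj : GraphProd m Γ →* MulAut (GraphProd m Γ)).range := by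
  choose y hy using exists_conj_mem_par hm hΓ hφ
  obtain ⟨g, hg⟩ := exists_mem_all_cosets fun u w =>
    exists_mem_cosets hm hΓ φ (hy u) (hy w)
  refine ⟨g, MulEquiv.toMonoidHom_injective (hom_ext fun v => ?_)⟩
  have h1 : g⁻¹ * φ (gen v) * g ∈ Subgroup.zpowers (gen v) := by
    refine mem_zpowers_of_forall fun w hw => ?_
    have := mul_mem (mul_mem (inv_mem (hg w)) (hy w v hw.symm)) (hg w)
    simpa [mul_assoc] using this
  have h2 : g⁻¹ * φ (gen v) * g = gen v := by
    refine eq_of_coord_eq h1 (Subgroup.mem_zpowers _) ?_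
    obtain ⟨x, hx⟩ := hφ v
    rw [coord_conj', hx, coord_conj]
  show g * gen v * g⁻¹ = φ (gen v)
  calc g * gen v * g⁻¹ = g * (g⁻¹ * φ (gen v) * g) * g⁻¹ := by rw [h2]
    _ = φ (gen v) := by group

/-- The exponents occurring in `exists_image_eq_conj` may be bounded. -/
theorem exists_image_eq_conj_bounded (hm : ∀ i, m i ≠ 1) (hΓ : IsGeneric Γ)
    (φ : MulAut (GraphProd m Γ)) (v : Fin n) :
    ∃ (w : Fin n) (k : ℤ) (x : GraphProd m Γ), k ∈ Set.Icc (-1 : ℤ) (m w + 1) ∧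
      φ (gen v) = x * gen w ^ k * x⁻¹ := by
  obtain ⟨w, k, x, h⟩ := exists_image_eq_conj hm hΓ φ v
  by_cases hw : m w = 0
  · refine ⟨w, k, x, ?_, h⟩
    suffices hk : IsUnit k by
      rcases Int.isUnit_iff.1 hk with rfl | rfl <;> (rw [Set.mem_Icc]; omega)
    obtain ⟨v', l, z, h'⟩ := exists_image_eq_conj hm hΓ φ.symm w
    have h1 := congrArg (fun t => coord v (φ.symm t)) h
    simp only [MulEquiv.symm_apply_apply, map_mul, map_inv, map_zpow] at h1
    rw [mul_right_comm, mul_inv_cancel, one_mul, h', coord_conj, map_zpow] at h1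
    have hv' : v' = v := by
      by_contra hne
      rw [coord_gen v v', if_neg hne, one_zpow, one_zpow] at h1
      exact coord_gen_self_ne_one hm v h1
    subst hv'
    rw [← zpow_mul, coord_gen_self, ← ofAdd_zsmul, Multiplicative.ofAdd.injective.eq_iff] at h1
    simp only [zsmul_eq_mul, mul_one] at h1
    by_cases hv : m v' = 0
    · have h2 : (1 : ℤ) - l * k = 0 := by
        have h3 : ((1 - l * k : ℤ) : ZMod (m v')) = 0 := by
          push_cast at h1 ⊢
          rw [← h1, sub_self]
        rw [ZMod.intCast_zmod_eq_zero_iff_dvd, hv] at h3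
        simpa using h3
      exact IsUnit.of_mul_eq_one l (by linarith)
    · exfalso
      have h2 : φ (gen v') ^ m v' = 1 := by rw [← map_pow, gen_pow, map_one]
      rw [h, conj_pow, conj_eq_one_iff, ← zpow_natCast, ← zpow_mul] at h2
      have h3 := congrArg (coord w) h2
      rw [coord_gen_zpow, map_one, ofAdd_eq_one, ZMod.intCast_zmod_eq_zero_iff_dvd, hw] at h3
      have hk : k = 0 := by
        simpa [hv] using h3
      rw [hk] at h
      refine gen_ne_one (m := m) (Γ := Γ) hm v' (φ.injective ?_)
      rw [h]
      simp
  · refine ⟨w, k % m w, x, ⟨?_, ?_⟩, ?_⟩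
    · have := Int.emod_nonneg k (show (m w : ℤ) ≠ 0 by exact_mod_cast hw)
      omega
    · have := Int.emod_lt_of_pos k (show (0 : ℤ) < m w by omega)
      omega
    · rw [h, gen_zpow_congr (k := k % m w) (l := k) (by simp)]

theorem finite_out (hm : ∀ i, m i ≠ 1) (hΓ : IsGeneric Γ) :
    Finite (MulAut (GraphProd m Γ) ⧸
      (MulAut.conj : GraphProd m Γ →* MulAut (GraphProd m Γ)).range) := by
  let D : MulAut (GraphProd m Γ) → Fin n → ConjClasses (GraphProd m Γ) :=
    fun φ v => ConjClasses.mk (φ (gen v))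
  let C : Set (ConjClasses (GraphProd m Γ)) :=
    ⋃ w : Fin n, (fun k : ℤ => ConjClasses.mk (gen w ^ k)) '' Set.Icc (-1 : ℤ) (m w + 1)
  have hC : C.Finite := Set.finite_iUnion fun w => (Set.finite_Icc _ _).image _
  have hD : ∀ φ, D φ ∈ Set.pi Set.univ fun _ : Fin n => C := by
    intro φ v _
    obtain ⟨w, k, x, hk, h⟩ := exists_image_eq_conj_bounded hm hΓ φ v
    refine Set.mem_iUnion.2 ⟨w, k, hk, ?_⟩
    exact ConjClasses.mk_eq_mk_iff_isConj.2 (isConj_iff.2 ⟨x, h.symm⟩)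
  have : Finite (Set.pi Set.univ fun _ : Fin n => C) := (Set.Finite.pi fun _ => hC).to_subtype
  refine Finite.of_injective (fun q => (⟨D q.out, hD q.out⟩ :
    (Set.pi Set.univ fun _ : Fin n => C))) fun q q' hq => ?_
  have hq' : D q.out = D q'.out := congrArg Subtype.val hq
  rw [← q.out_eq, ← q'.out_eq]
  refine QuotientGroup.eq.2 (mem_range_conj hm hΓ fun v => ?_)
  obtain ⟨x, hx⟩ := isConj_iff.1 (ConjClasses.mk_eq_mk_iff_isConj.1 (congrFun hq' v))
  refine ⟨q.out⁻¹ x, ?_⟩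
  rw [MulAut.mul_apply, ← hx, map_mul, map_mul, map_inv, MulAut.inv_apply_self]

end GraphProd

section RandomGraph

variable {n : ℕ}

theorem sum_prod_edges (f g : Sym2 (Fin n) → ℝ) :
    ∑ Γ : SimpleGraph (Fin n), ∏ e ∈ (⊤ : SimpleGraph (Fin n)).edgeFinset,
      (if e ∈ Γ.edgeSet then f e else g e) =
    ∏ e ∈ (⊤ : SimpleGraph (Fin n)).edgeFinset, (f e + g e) := by
  rw [Finset.prod_add]
  refine Finset.sum_bij' (fun Γ _ => (⊤ : SimpleGraph (Fin n)).edgeFinset.filter (· ∈ Γ.edgeSet))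
    (fun t _ => SimpleGraph.fromEdgeSet (t : Set (Sym2 (Fin n)))) ?_ ?_ ?_ ?_ ?_
  · intro Γ _
    simp
  · intro t _
    simp
  · intro Γ _
    ext x y
    simp only [Finset.coe_filter, SimpleGraph.mem_edgeFinset, SimpleGraph.fromEdgeSet_adj,
      Set.mem_ofPred_eq, SimpleGraph.mem_edgeSet, SimpleGraph.top_adj]
    exact ⟨fun h => h.1.2, fun h => ⟨⟨h.ne, h⟩, h.ne⟩⟩
  · intro t ht
    have ht' := Finset.mem_powerset.1 ht
    ext e
    have := @ht' e
    simp only [SimpleGraph.mem_edgeFinset, SimpleGraph.edgeSet_top, Set.mem_compl_iff] at this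
    simp only [Finset.mem_filter, SimpleGraph.mem_edgeFinset, SimpleGraph.edgeSet_top,
      SimpleGraph.edgeSet_fromEdgeSet, Set.mem_sdiff, Finset.mem_coe, Set.mem_compl_iff]
    tauto
  · intro Γ _
    rw [Finset.prod_ite, Finset.filter_not]

theorem gnpWeight_eq_prod (p : ℝ) (Γ : SimpleGraph (Fin n)) :
    gnpWeight n p Γ = ∏ e ∈ (⊤ : SimpleGraph (Fin n)).edgeFinset,
      (if e ∈ Γ.edgeSet then p else 1 - p) := by
  have h1 : Γ.edgeSet.ncard =
      ((⊤ : SimpleGraph (Fin n)).edgeFinset.filter (· ∈ Γ.edgeSet)).card := by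
    rw [← Set.ncard_coe_finset]
    congr 1
    ext e
    simp only [Finset.coe_filter, SimpleGraph.mem_edgeFinset, Set.mem_ofPred_eq]
    exact ⟨fun h => ⟨SimpleGraph.edgeSet_mono le_top h, h⟩, fun h => h.2⟩
  have h2 : ((⊤ : SimpleGraph (Fin n)).edgeFinset.filter (¬ · ∈ Γ.edgeSet)).card =
      n.choose 2 - Γ.edgeSet.ncard := by
    have := Finset.card_filter_add_card_filter_not
      (s := (⊤ : SimpleGraph (Fin n)).edgeFinset) (· ∈ Γ.edgeSet)
    rw [SimpleGraph.card_edgeFinset_top_eq_card_choose_two, Fintype.card_fin] at this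
    omega
  rw [gnpWeight, Finset.prod_ite, Finset.prod_const, Finset.prod_const, h2, h1]

theorem sum_gnpWeight (p : ℝ) : ∑ Γ : SimpleGraph (Fin n), gnpWeight n p Γ = 1 := by
  simp only [gnpWeight_eq_prod]
  rw [sum_prod_edges (fun _ => p) (fun _ => 1 - p)]
  simp

theorem gnpWeight_nonneg {p : ℝ} (h0 : 0 ≤ p) (h1 : p ≤ 1) (Γ : SimpleGraph (Fin n)) :
    0 ≤ gnpWeight n p Γ :=
  mul_nonneg (pow_nonneg h0 _) (pow_nonneg (by linarith) _)

/-- `x` is adjacent to all of `A` and to none of `B`. -/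
def Separates (Γ : SimpleGraph (Fin n)) (A B : Finset (Fin n)) (x : Fin n) : Prop :=
  (∀ a ∈ A, Γ.Adj x a) ∧ ∀ b ∈ B, ¬ Γ.Adj x b

theorem sum_gnpWeight_separates (p : ℝ) {A B T : Finset (Fin n)} (hAB : Disjoint A B)
    (hT : Disjoint T (A ∪ B)) :
    ∑ Γ : SimpleGraph (Fin n), gnpWeight n p Γ *
      ∏ x ∈ T, (if Separates Γ A B x then 1 else 0) =
      ∏ _x ∈ T, (p ^ A.card * (1 - p) ^ B.card) := by
  let P : Finset (Sym2 (Fin n)) := (T ×ˢ A).image fun z => s(z.1, z.2)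
  let N : Finset (Sym2 (Fin n)) := (T ×ˢ B).image fun z => s(z.1, z.2)
  have hinj : ∀ C : Finset (Fin n), Disjoint T C →
      Set.InjOn (fun z : Fin n × Fin n => s(z.1, z.2)) (T ×ˢ C : Finset (Fin n × Fin n)) := by
    rintro C hC ⟨x, y⟩ h ⟨x', y'⟩ h' e
    simp only [Finset.coe_product, Set.mem_prod, Finset.mem_coe] at h h'
    rcases Sym2.eq_iff.1 e with ⟨rfl, rfl⟩ | ⟨rfl, rfl⟩
    · rfl
    · exact (Finset.disjoint_left.1 hC h.1 h'.2).elim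
  have hTA : Disjoint T A := hT.mono_right Finset.subset_union_left
  have hTB : Disjoint T B := hT.mono_right Finset.subset_union_right
  have hPN : Disjoint P N := by
    rw [Finset.disjoint_left]
    rintro e he he'
    obtain ⟨⟨x, a⟩, hxa, rfl⟩ := Finset.mem_image.1 he
    obtain ⟨⟨y, b⟩, hyb, e⟩ := Finset.mem_image.1 he'
    rw [Finset.mem_product] at hxa hyb
    rcases Sym2.eq_iff.1 e with ⟨rfl, rfl⟩ | ⟨rfl, rfl⟩
    · exact Finset.disjoint_left.1 hAB hxa.2 hyb.2
    · exact Finset.disjoint_left.1 hTB hxa.1 hyb.2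
  have htop : ∀ C : Finset (Fin n), Disjoint T C →
      (T ×ˢ C).image (fun z => s(z.1, z.2)) ⊆ (⊤ : SimpleGraph (Fin n)).edgeFinset := by
    intro C hC e he
    obtain ⟨⟨x, a⟩, hxa, rfl⟩ := Finset.mem_image.1 he
    rw [Finset.mem_product] at hxa
    simp only [SimpleGraph.mem_edgeFinset, SimpleGraph.mem_edgeSet, SimpleGraph.top_adj]
    rintro rfl
    exact Finset.disjoint_left.1 hC hxa.1 hxa.2
  have hterm : ∀ Γ : SimpleGraph (Fin n), gnpWeight n p Γ *
      ∏ x ∈ T, (if Separates Γ A B x then (1 : ℝ) else 0) =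
      ∏ e ∈ (⊤ : SimpleGraph (Fin n)).edgeFinset,
        (if e ∈ Γ.edgeSet then (if e ∈ N then 0 else p) else (if e ∈ P then 0 else 1 - p)) := by
    intro Γ
    by_cases hs : ∀ x ∈ T, Separates Γ A B x
    · rw [Finset.prod_congr rfl fun x hx => if_pos (hs x hx), Finset.prod_const_one, mul_one,
        gnpWeight_eq_prod]
      refine Finset.prod_congr rfl fun e _ => ?_
      by_cases he : e ∈ Γ.edgeSet
      · rw [if_pos he, if_pos he, if_neg]
        intro heN
        obtain ⟨⟨x, b⟩, hxb, rfl⟩ := Finset.mem_image.1 heN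
        rw [Finset.mem_product] at hxb
        exact (hs x hxb.1).2 b hxb.2 he
      · rw [if_neg he, if_neg he, if_neg]
        intro heP
        obtain ⟨⟨x, a⟩, hxa, rfl⟩ := Finset.mem_image.1 heP
        rw [Finset.mem_product] at hxa
        exact he ((hs x hxa.1).1 a hxa.2)
    · push Not at hs
      obtain ⟨x, hx, hsx⟩ := hs
      rw [Finset.prod_eq_zero hx (if_neg hsx), mul_zero, eq_comm]
      rw [Separates, not_and_or] at hsx
      push Not at hsx
      rcases hsx with ⟨a, ha, hxa⟩ | ⟨b, hb, hxb⟩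
      · have hmem : s(x, a) ∈ P :=
          Finset.mem_image.2 ⟨(x, a), Finset.mem_product.2 ⟨hx, ha⟩, rfl⟩
        refine Finset.prod_eq_zero (htop A hTA hmem) ?_
        rw [if_neg (by simpa using hxa), if_pos hmem]
      · have hmem : s(x, b) ∈ N :=
          Finset.mem_image.2 ⟨(x, b), Finset.mem_product.2 ⟨hx, hb⟩, rfl⟩
        refine Finset.prod_eq_zero (htop B hTB hmem) ?_
        rw [if_pos (by simpa using hxb), if_pos hmem]
  rw [Finset.sum_congr rfl fun Γ _ => hterm Γ, sum_prod_edges]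
  have hsplit : ∀ e : Sym2 (Fin n), ((if e ∈ N then 0 else p) + if e ∈ P then 0 else 1 - p) =
      (if e ∈ P then p else 1) * if e ∈ N then 1 - p else 1 := by
    intro e
    by_cases hP : e ∈ P
    · simp [hP, Finset.disjoint_left.1 hPN hP]
    · by_cases hN : e ∈ N <;> simp [hP, hN]
  rw [Finset.prod_congr rfl fun e _ => hsplit e, Finset.prod_mul_distrib]
  have hprod : ∀ (C : Finset (Fin n)) (c : ℝ), Disjoint T C →
      ∏ e ∈ (⊤ : SimpleGraph (Fin n)).edgeFinset,
        (if e ∈ (T ×ˢ C).image (fun z => s(z.1, z.2)) then c else 1) = ∏ _x ∈ T, c ^ C.card := by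
    intro C c hC
    rw [Finset.prod_ite_mem, Finset.inter_eq_right.2 (htop C hC), Finset.prod_const,
      Finset.card_image_of_injOn (hinj C hC), Finset.card_product, Finset.prod_const, ← pow_mul,
      mul_comm]
  rw [hprod A p hTA, hprod B (1 - p) hTB, ← Finset.prod_mul_distrib]

theorem prod_one_sub_eq_sum_powerset {ι : Type*} (s : Finset ι) (f : ι → ℝ) :
    ∏ x ∈ s, (1 - f x) = ∑ T ∈ s.powerset, (-1) ^ T.card * ∏ x ∈ T, f x := by
  simp only [sub_eq_add_neg]
  rw [Finset.prod_one_add]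
  refine Finset.sum_congr rfl fun T _ => ?_
  rw [← Finset.prod_const, ← Finset.prod_mul_distrib]
  simp

theorem gnpProb_not_separates (p : ℝ) {A B : Finset (Fin n)} (hAB : Disjoint A B) :
    gnpProb n p (fun Γ => ∀ x ∈ (A ∪ B)ᶜ, ¬ Separates Γ A B x) =
      (1 - p ^ A.card * (1 - p) ^ B.card) ^ (n - (A ∪ B).card) := by
  have hterm : ∀ Γ : SimpleGraph (Fin n),
      (if ∀ x ∈ (A ∪ B)ᶜ, ¬ Separates Γ A B x then gnpWeight n p Γ else 0) =
      ∑ T ∈ (A ∪ B)ᶜ.powerset, (-1) ^ T.card * (gnpWeight n p Γ *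
        ∏ x ∈ T, (if Separates Γ A B x then 1 else 0)) := by
    intro Γ
    have h1 : (if ∀ x ∈ (A ∪ B)ᶜ, ¬ Separates Γ A B x then gnpWeight n p Γ else 0) =
        gnpWeight n p Γ * ∏ x ∈ (A ∪ B)ᶜ, (1 - if Separates Γ A B x then (1 : ℝ) else 0) := by
      split_ifs with h
      · rw [Finset.prod_congr rfl fun x hx => by rw [if_neg (h x hx), sub_zero]]
        simp
      · push Not at h
        obtain ⟨x, hx, hs⟩ := h
        rw [Finset.prod_eq_zero hx (by rw [if_pos hs, sub_self]), mul_zero]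
    rw [h1, prod_one_sub_eq_sum_powerset, Finset.mul_sum]
    exact Finset.sum_congr rfl fun T _ => by ring
  have hsum : gnpProb n p (fun Γ => ∀ x ∈ (A ∪ B)ᶜ, ¬ Separates Γ A B x) =
      ∑ Γ : SimpleGraph (Fin n), ∑ T ∈ (A ∪ B)ᶜ.powerset, (-1) ^ T.card * (gnpWeight n p Γ *
        ∏ x ∈ T, (if Separates Γ A B x then 1 else 0)) :=
    Finset.sum_congr rfl fun Γ _ => by
      rw [← hterm Γ]
      congr
  rw [hsum, Finset.sum_comm]
  have hT : ∀ T ∈ (A ∪ B)ᶜ.powerset, ∑ Γ : SimpleGraph (Fin n), (-1) ^ T.card *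
      (gnpWeight n p Γ * ∏ x ∈ T, (if Separates Γ A B x then (1 : ℝ) else 0)) =
      (-1) ^ T.card * ∏ _x ∈ T, (p ^ A.card * (1 - p) ^ B.card) := by
    intro T hT
    rw [← Finset.mul_sum, sum_gnpWeight_separates p hAB]
    exact Finset.disjoint_left.2 fun x hx => Finset.mem_compl.1 (Finset.mem_powerset.1 hT hx)
  rw [Finset.sum_congr rfl hT, ← prod_one_sub_eq_sum_powerset, Finset.prod_const, Finset.card_compl,
    Fintype.card_fin]

theorem gnpProb_le_of_imp {p : ℝ} (h0 : 0 ≤ p) (h1 : p ≤ 1)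
    {P Q : SimpleGraph (Fin n) → Prop} (h : ∀ Γ, P Γ → Q Γ) : gnpProb n p P ≤ gnpProb n p Q := by
  refine Finset.sum_le_sum fun Γ _ => ?_
  have := gnpWeight_nonneg h0 h1 Γ
  split_ifs with hP hQ hQ
  · exact le_rfl
  · exact absurd (h Γ hP) hQ
  · exact this
  · exact le_rfl

theorem gnpProb_add_gnpProb_not (p : ℝ) (P : SimpleGraph (Fin n) → Prop) :
    gnpProb n p P + gnpProb n p (fun Γ => ¬ P Γ) = 1 := by
  rw [gnpProb, gnpProb, ← Finset.sum_add_distrib, ← sum_gnpWeight (n := n) p]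
  refine Finset.sum_congr rfl fun Γ _ => ?_
  by_cases h : P Γ <;> simp [h]

theorem gnpProb_nonneg {p : ℝ} (h0 : 0 ≤ p) (h1 : p ≤ 1) (P : SimpleGraph (Fin n) → Prop) :
    0 ≤ gnpProb n p P :=
  Finset.sum_nonneg fun Γ _ => by
    have := gnpWeight_nonneg h0 h1 Γ
    split_ifs
    · exact this
    · exact le_rfl

theorem gnpProb_exists_le {ι : Type*} [Fintype ι] {p : ℝ} (h0 : 0 ≤ p) (h1 : p ≤ 1)
    (P : ι → SimpleGraph (Fin n) → Prop) :
    gnpProb n p (fun Γ => ∃ i, P i Γ) ≤ ∑ i, gnpProb n p (P i) := by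
  simp only [gnpProb]
  rw [Finset.sum_comm]
  refine Finset.sum_le_sum fun Γ _ => ?_
  have hw := gnpWeight_nonneg h0 h1 Γ
  have hnn : ∀ i ∈ (Finset.univ : Finset ι), 0 ≤ (if P i Γ then gnpWeight n p Γ else 0) := by
    intro i _
    split_ifs
    · exact hw
    · exact le_rfl
  split_ifs with h
  · obtain ⟨i, hi⟩ := h
    refine le_trans ?_ (Finset.single_le_sum hnn (Finset.mem_univ i))
    rw [if_pos hi]
  · exact Finset.sum_nonneg hnn

theorem gnpProb_not_isGeneric_le {p : ℝ} (h0 : 0 ≤ p) (h1 : p ≤ 1) (hn : 4 ≤ n) :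
    gnpProb n p (fun Γ => ¬ IsGeneric Γ) ≤
      (n : ℝ) ^ 5 * (1 - p ^ 2 * (1 - p) ^ 3) ^ (n - 5) := by
  have hp1 : 0 ≤ 1 - p := by linarith
  have hp1' : 1 - p ≤ 1 := by linarith
  let bad : (Fin 2 → Fin n) × (Fin 3 → Fin n) → SimpleGraph (Fin n) → Prop := fun c Γ =>
    (∀ i j, c.1 i ≠ c.2 j) ∧ ∀ x, ¬ ((∀ i, Γ.Adj x (c.1 i)) ∧ ∀ j, x ≠ c.2 j ∧ ¬ Γ.Adj x (c.2 j))
  have hle : gnpProb n p (fun Γ => ¬ IsGeneric Γ) ≤ gnpProb n p (fun Γ => ∃ c, bad c Γ) := by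
    refine gnpProb_le_of_imp h0 h1 fun Γ hΓ => ?_
    by_contra hc
    refine hΓ ⟨hn, fun a b hab => ?_⟩
    by_contra hx
    exact hc ⟨(a, b), hab, fun x h => hx ⟨x, h⟩⟩
  have hbad : ∀ c, gnpProb n p (bad c) ≤ (1 - p ^ 2 * (1 - p) ^ 3) ^ (n - 5) := by
    rintro ⟨a, b⟩
    have hq0 : p ^ 2 * (1 - p) ^ 3 ≤ 1 :=
      mul_le_one₀ (pow_le_one₀ h0 h1) (pow_nonneg hp1 _) (pow_le_one₀ hp1 hp1')
    by_cases hab : ∀ i j, a i ≠ b j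
    · let A : Finset (Fin n) := Finset.univ.image a
      let B : Finset (Fin n) := Finset.univ.image b
      have hA : A.card ≤ 2 := Finset.card_image_le.trans (by simp)
      have hB : B.card ≤ 3 := Finset.card_image_le.trans (by simp)
      have hAB : Disjoint A B := by
        rw [Finset.disjoint_left]
        intro x hx hx'
        obtain ⟨i, -, rfl⟩ := Finset.mem_image.1 hx
        obtain ⟨j, -, hj⟩ := Finset.mem_image.1 hx'
        exact hab i j hj.symm
      have hcard : (A ∪ B).card ≤ 5 := (Finset.card_union_le _ _).trans (by omega)
      have hq : p ^ 2 * (1 - p) ^ 3 ≤ p ^ A.card * (1 - p) ^ B.card :=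
        mul_le_mul (pow_le_pow_of_le_one h0 h1 hA) (pow_le_pow_of_le_one hp1 hp1' hB)
          (pow_nonneg hp1 _) (pow_nonneg h0 _)
      have hq1 : p ^ A.card * (1 - p) ^ B.card ≤ 1 :=
        mul_le_one₀ (pow_le_one₀ h0 h1) (pow_nonneg hp1 _) (pow_le_one₀ hp1 hp1')
      have hq' : 0 ≤ p ^ A.card * (1 - p) ^ B.card :=
        mul_nonneg (pow_nonneg h0 _) (pow_nonneg hp1 _)
      calc gnpProb n p (bad (a, b))
          ≤ gnpProb n p (fun Γ => ∀ x ∈ (A ∪ B)ᶜ, ¬ Separates Γ A B x) := by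
            refine gnpProb_le_of_imp h0 h1 fun Γ hΓ x hx hs => hΓ.2 x ⟨fun i => ?_, fun j => ?_⟩
            · exact hs.1 _ (Finset.mem_image_of_mem a (Finset.mem_univ i))
            · have hj : b j ∈ B := Finset.mem_image_of_mem b (Finset.mem_univ j)
              refine ⟨?_, hs.2 _ hj⟩
              rintro rfl
              exact Finset.mem_compl.1 hx (Finset.mem_union_right _ hj)
        _ = (1 - p ^ A.card * (1 - p) ^ B.card) ^ (n - (A ∪ B).card) :=
            gnpProb_not_separates p hAB
        _ ≤ (1 - p ^ A.card * (1 - p) ^ B.card) ^ (n - 5) :=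
            pow_le_pow_of_le_one (by linarith) (by linarith) (by omega)
        _ ≤ (1 - p ^ 2 * (1 - p) ^ 3) ^ (n - 5) :=
            pow_le_pow_left₀ (by linarith) (by linarith) _
    · have : gnpProb n p (bad (a, b)) = 0 :=
        Finset.sum_eq_zero fun Γ _ => if_neg fun h => hab h.1
      rw [this]
      exact pow_nonneg (by linarith) _
  calc gnpProb n p (fun Γ => ¬ IsGeneric Γ) ≤ gnpProb n p (fun Γ => ∃ c, bad c Γ) := hle
    _ ≤ ∑ c, gnpProb n p (bad c) := gnpProb_exists_le h0 h1 bad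
    _ ≤ ∑ _c : (Fin 2 → Fin n) × (Fin 3 → Fin n), (1 - p ^ 2 * (1 - p) ^ 3) ^ (n - 5) :=
        Finset.sum_le_sum fun c _ => hbad c
    _ = (n : ℝ) ^ 5 * (1 - p ^ 2 * (1 - p) ^ 3) ^ (n - 5) := by
        rw [Finset.sum_const, nsmul_eq_mul, Finset.card_univ, Fintype.card_prod]
        simp only [Fintype.card_fun, Fintype.card_fin, Nat.cast_mul, Nat.cast_pow]
        ring

theorem tendsto_pow_mul_pow_sub {r : ℝ} (h0 : 0 < r) (h1 : r < 1) :
    Tendsto (fun n : ℕ => (n : ℝ) ^ 5 * r ^ (n - 5)) atTop (nhds 0) := by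
  have h := (tendsto_pow_const_mul_const_pow_of_abs_lt_one 5
    (abs_lt.2 ⟨by linarith, h1⟩)).div_const (r ^ 5)
  rw [zero_div] at h
  refine h.congr' ?_
  filter_upwards [eventually_ge_atTop 5] with n hn
  rw [pow_sub₀ r h0.ne' hn, div_eq_mul_inv, mul_assoc]

theorem tendsto_gnpProb_of_isGeneric {p : ℝ} (h0 : 0 < p) (h1 : p < 1)
    (P : ∀ n : ℕ, SimpleGraph (Fin n) → Prop) (hP : ∀ n Γ, IsGeneric Γ → P n Γ) :
    Tendsto (fun n : ℕ => gnpProb n p (P n)) atTop (nhds 1) := by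
  have hq0 : 0 < p ^ 2 * (1 - p) ^ 3 := mul_pos (pow_pos h0 _) (pow_pos (by linarith) _)
  have hq1 : p ^ 2 * (1 - p) ^ 3 < 1 :=
    mul_lt_one_of_nonneg_of_lt_one_left (pow_nonneg h0.le _) (pow_lt_one₀ h0.le h1 (by simp))
      (pow_le_one₀ (by linarith) (by linarith))
  have hlim := (tendsto_pow_mul_pow_sub (r := 1 - p ^ 2 * (1 - p) ^ 3) (by linarith)
    (by linarith)).const_sub 1
  rw [sub_zero] at hlim
  refine tendsto_of_tendsto_of_tendsto_of_le_of_le' hlim tendsto_const_nhds ?_ ?_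
  · filter_upwards [eventually_ge_atTop 4] with n hn
    have h2 := gnpProb_not_isGeneric_le (n := n) h0.le h1.le hn
    have h3 := gnpProb_add_gnpProb_not (n := n) p IsGeneric
    have h4 := gnpProb_le_of_imp (n := n) h0.le h1.le (hP n)
    linarith
  · refine Eventually.of_forall fun n => ?_
    have h3 := gnpProb_add_gnpProb_not (n := n) p (P n)
    have h4 := gnpProb_nonneg (n := n) h0.le h1.le (fun Γ => ¬ P n Γ)
    linarith

end RandomGraph

end

/-- For constant `p` with `1 - 1/√2 < p < 1` and cyclic vertex groups `ℤ/m(i)ℤ` with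
`m i ≠ 1` (where `m i = 0` means `ℤ`), a.a.s. the graph product of these groups along
`Γ ∈ G(n,p)` has finite outer automorphism group. -/
theorem gnp_aas_graph_product_finite_out (m : ℕ → ℕ) (hm : ∀ i, m i ≠ 1)
    (p : ℝ) (h1 : 1 - 1 / Real.sqrt 2 < p) (h2 : p < 1) :
    Tendsto (fun n : ℕ =>
      gnpProb n p (fun Γ =>
        Finite (MulAut (GraphProd m Γ) ⧸
          (MulAut.conj : GraphProd m Γ →* MulAut (GraphProd m Γ)).range)))
      atTop (nhds 1) := by
  have hp : 0 < p := by
    have h : (1 : ℝ) < Real.sqrt 2 := Real.lt_sqrt_of_sq_lt (by norm_num)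
    have h' : 1 / Real.sqrt 2 < 1 := (div_lt_one (by linarith)).2 h
    linarith
  exact tendsto_gnpProb_of_isGeneric hp h2 _ fun n Γ hΓ => GraphProd.finite_out hm hΓ
end
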